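/- Let K be a number field, S a finite set of places of K containing all archimedean places, and 𝔄 the ring of S-integers of K. Then there is a constant C, depending only on 𝔄, such that for every g ≥ 2 the torsion subgroup of the finitely generated abelian group H₂(Sp(2g, 𝔄)) is finite of order at most C. -/

import Mathlib

noncomputable section

namespace GpH2

open Finsupp

variable (G : Type) [Group G]

/-- Second boundary map of the bar complex: `(g,h) ↦ [h] - [gh] + [g]`. -/
def d2 : ((G × G) →₀ ℤ) →ₗ[ℤ] (G →₀ ℤ) :=
  Finsupp.linearCombination ℤ fun p : G × G =>
    Finsupp.single p.2 1 - Finsupp.single (p.1 * p.2) 1 + Finsupp.single p.1 1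

/-- Third boundary map of the bar complex:
`(g,h,k) ↦ [(h,k)] - [(gh,k)] + [(g,hk)] - [(g,h)]`. -/
def d3 : ((G × G × G) →₀ ℤ) →ₗ[ℤ] ((G × G) →₀ ℤ) :=
  Finsupp.linearCombination ℤ fun t : G × G × G =>
    Finsupp.single (t.2.1, t.2.2) 1 - Finsupp.single (t.1 * t.2.1, t.2.2) 1
      + Finsupp.single (t.1, t.2.1 * t.2.2) 1 - Finsupp.single (t.1, t.2.1) 1

/-- 2-cycles. -/
def Z2 : Submodule ℤ ((G × G) →₀ ℤ) := LinearMap.ker (d2 G)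

/-- 2-boundaries. -/
def B2 : Submodule ℤ ((G × G) →₀ ℤ) := LinearMap.range (d3 G)

/-- The second homology group of `G` with trivial integral coefficients,
defined via the bar resolution as 2-cycles modulo 2-boundaries. -/
abbrev H2 := ↥(Z2 G) ⧸ (B2 G).comap (Z2 G).subtype

variable {G} {H : Type} [Group H]

/-- The map induced on bar 2-chains by a group homomorphism. -/
def C2 (f : G →* H) : ((G × G) →₀ ℤ) →ₗ[ℤ] ((H × H) →₀ ℤ) :=
  Finsupp.lmapDomain ℤ ℤ (Prod.map f f)

def C1 (f : G →* H) : (G →₀ ℤ) →ₗ[ℤ] (H →₀ ℤ) :=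
  Finsupp.lmapDomain ℤ ℤ f

def C3 (f : G →* H) : ((G × G × G) →₀ ℤ) →ₗ[ℤ] ((H × H × H) →₀ ℤ) :=
  Finsupp.lmapDomain ℤ ℤ (Prod.map f (Prod.map f f))

@[simp] theorem C2_single (f : G →* H) (p : G × G) (n : ℤ) :
    C2 f (Finsupp.single p n) = Finsupp.single (f p.1, f p.2) n := by
  simp [C2, Finsupp.mapDomain_single, Prod.map]

@[simp] theorem C1_single (f : G →* H) (g : G) (n : ℤ) :
    C1 f (Finsupp.single g n) = Finsupp.single (f g) n := by
  simp [C1, Finsupp.mapDomain_single]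

@[simp] theorem C3_single (f : G →* H) (t : G × G × G) (n : ℤ) :
    C3 f (Finsupp.single t n) = Finsupp.single (f t.1, f t.2.1, f t.2.2) n := by
  simp [C3, Finsupp.mapDomain_single, Prod.map]

theorem d2_comm (f : G →* H) : (d2 H).comp (C2 f) = (C1 f).comp (d2 G) := by
  refine Finsupp.lhom_ext fun p n => ?_
  simp only [LinearMap.comp_apply, C2_single, d2, Finsupp.linearCombination_single,
    map_smul, map_sub, map_add, C1_single, map_mul]

theorem d3_comm (f : G →* H) : (d3 H).comp (C3 f) = (C2 f).comp (d3 G) := by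
  refine Finsupp.lhom_ext fun t n => ?_
  simp only [LinearMap.comp_apply, C3_single, d3, Finsupp.linearCombination_single,
    map_smul, map_sub, map_add, C2_single, map_mul]

theorem C2_mem_Z2 (f : G →* H) : ∀ x ∈ Z2 G, C2 f x ∈ Z2 H := by
  intro x hx
  have := congrArg (fun φ => φ x) (d2_comm f)
  simp only [LinearMap.comp_apply] at this
  simp only [Z2, LinearMap.mem_ker] at hx ⊢
  rw [this, hx, map_zero]

/-- The map induced by a group homomorphism on second homology. -/
def H2Map (f : G →* H) : H2 G →ₗ[ℤ] H2 H :=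
  Submodule.mapQ _ _ ((C2 f).restrict (C2_mem_Z2 f)) (by
    rintro ⟨x, hxZ⟩ hx
    simp only [Submodule.mem_comap, Submodule.subtype_apply] at hx ⊢
    simp only [LinearMap.restrict_apply]
    obtain ⟨w, hw⟩ := hx
    have := congrArg (fun φ => φ w) (d3_comm f)
    simp only [LinearMap.comp_apply] at this
    exact ⟨C3 f w, by rw [this, hw]⟩)

end GpH2

open Matrix

/-- The symplectic group `Sp(2g, R)`: matrices `M` (of size `2g`) with `Mᵀ * J * M = J`,
where `J` is the standard symplectic form (see `SymplecticGroup.mem_iff'`). -/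
abbrev Sp (g : ℕ) (R : Type) [CommRing R] : Submonoid (Matrix (Fin g ⊕ Fin g) (Fin g ⊕ Fin g) R) :=
  Matrix.symplecticGroup (Fin g) R

namespace SpAux

variable {g : ℕ} {R S : Type} [CommRing R] [CommRing S]

theorem J_map (f : R →+* S) : (Matrix.J (Fin g) R).map f = Matrix.J (Fin g) S := by
  ext i j
  rcases i with i | i <;> rcases j with j | j <;>
    simp [Matrix.J, Matrix.fromBlocks, Matrix.one_apply, apply_ite f]

theorem map_mem (f : R →+* S) {A : Matrix (Fin g ⊕ Fin g) (Fin g ⊕ Fin g) R}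
    (hA : A ∈ Sp g R) : A.map f ∈ Sp g S := by
  rw [SymplecticGroup.mem_iff] at hA ⊢
  rw [← J_map f, ← Matrix.transpose_map, ← Matrix.map_mul, ← Matrix.map_mul, hA]

/-- The homomorphism `Sp(2g, R) → Sp(2g, S)` induced by a ring homomorphism `R → S`
(entrywise application). -/
def SpMap (f : R →+* S) (g : ℕ) : Sp g R →* Sp g S where
  toFun A := ⟨Matrix.map A.1 f, map_mem f A.2⟩
  map_one' := Subtype.ext <| by
    show ((1 : Matrix _ _ R)).map f = (1 : Matrix _ _ S)
    exact Matrix.map_one f (map_zero f) (map_one f)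
  map_mul' A B := Subtype.ext <| by
    show Matrix.map (A.1 * B.1) f = Matrix.map A.1 f * Matrix.map B.1 f
    exact Matrix.map_mul

end SpAux

section CentralExtension

open GpH2

variable {G : Type} [Group G] {D : Type} [AddCommGroup D]

/-- A normalization-free additive 2-cocycle. -/
def IsTwoCocycle (c : G → G → D) : Prop :=
  ∀ g h k, c h k - c (g * h) k + c g (h * k) - c g h = 0

/-- The central extension attached to a 2-cocycle. -/
@[ext] structure CocycleExt (c : G → G → D) (hc : IsTwoCocycle c) where
  base : G
  fib : D

namespace CocycleExt

variable {c : G → G → D} {hc : IsTwoCocycle c}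

instance : Mul (CocycleExt c hc) := ⟨fun x y => ⟨x.base * y.base, x.fib + y.fib + c x.base y.base⟩⟩
instance : One (CocycleExt c hc) := ⟨⟨1, - c 1 1⟩⟩
instance : Inv (CocycleExt c hc) :=
  ⟨fun x => ⟨x.base⁻¹, - x.fib - c 1 1 - c x.base⁻¹ x.base⟩⟩

theorem mul_def (x y : CocycleExt c hc) :
    x * y = ⟨x.base * y.base, x.fib + y.fib + c x.base y.base⟩ := rfl

theorem one_def : (1 : CocycleExt c hc) = ⟨1, - c 1 1⟩ := rfl

theorem inv_def (x : CocycleExt c hc) :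
    x⁻¹ = ⟨x.base⁻¹, - x.fib - c 1 1 - c x.base⁻¹ x.base⟩ := rfl

theorem cocycle_one_left (hc : IsTwoCocycle c) (g : G) : c 1 g = c 1 1 := by
  have := hc 1 1 g
  simp only [one_mul] at this
  rw [sub_self, zero_add, sub_eq_zero] at this
  exact this

instance : Group (CocycleExt c hc) := by
  refine Group.ofLeftAxioms ?_ ?_ ?_
  · intro x y z
    have := hc x.base y.base z.base
    simp only [mul_def, mul_assoc, CocycleExt.mk.injEq, true_and]
    have h2 : c x.base (y.base * z.base) + c y.base z.base
      = c (x.base * y.base) z.base + c x.base y.base := by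
      rw [← sub_eq_zero, ← this]; abel
    calc _ = x.fib + y.fib + z.fib + (c (x.base * y.base) z.base + c x.base y.base) := by abel
      _ = _ := by rw [← h2]; abel
  · intro x
    ext
    · simp [mul_def, one_def]
    · simp only [mul_def, one_def]
      rw [cocycle_one_left hc x.base]; abel
  · intro x
    ext
    · simp [mul_def, one_def, inv_def]
    · simp only [mul_def, one_def, inv_def]
      abel

/-- The projection of the extension. -/
def proj (c : G → G → D) (hc : IsTwoCocycle c) : CocycleExt c hc →* G where
  toFun := base
  map_one' := rfl
  map_mul' _ _ := rfl

end CocycleExt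

/-- `c` restricted to 2-chains is a coboundary if its extension splits. -/
theorem exists_cobounding_of_split {c : G → G → D} (hc : IsTwoCocycle c)
    (s : G →* CocycleExt c hc) (hs : ∀ g, CocycleExt.proj c hc (s g) = g) :
    ∃ b : G → D, ∀ g h, c g h = b h - b (g * h) + b g := by
  refine ⟨fun g => - (s g).fib, fun g h => ?_⟩
  have hs' : ∀ g, (s g).base = g := hs
  have := congrArg CocycleExt.fib (s.map_mul g h)
  rw [CocycleExt.mul_def] at this
  simp only [hs'] at this
  beta_reduce
  rw [this]; abel

/-- Duality criterion: 2-cycles supported in `Σ` generate `H₂(G)` as soon as every central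
extension of `G` possessing a set-theoretic section multiplicative on `Σ` splits. -/
theorem exists_cycle_supported (P : Set (G × G))
    (hsplit : ∀ (E : Type) [Group E] (p : E →* G), (∀ e, p e = 1 → ∀ e', e * e' = e' * e) →
      ∀ σ : G → E, (∀ g, p (σ g) = g) → (∀ a b, (a, b) ∈ P → σ a * σ b = σ (a * b)) →
        ∃ s : G →* E, ∀ g, p (s g) = g) (x : H2 G) :
    ∃ z : Z2 G, (z : G × G →₀ ℤ) ∈ Finsupp.supported ℤ ℤ P ∧ Submodule.Quotient.mk z = x := by
  let N : Submodule ℤ (Z2 G) := (Finsupp.supported ℤ ℤ P).comap (Z2 G).subtype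
  let M : Submodule ℤ (H2 G) := N.map (Submodule.mkQ _)
  suffices hM : M = ⊤ by
    have hx : x ∈ M := hM ▸ Submodule.mem_top
    obtain ⟨z, hz, rfl⟩ := hx
    exact ⟨z, hz, rfl⟩
  by_contra hM
  obtain ⟨x, hx⟩ : ∃ x, x ∉ M := by
    by_contra! h
    exact hM (eq_top_iff.2 fun x _ => h x)
  obtain ⟨φ, hφ⟩ := CharacterModule.exists_character_apply_ne_zero_of_ne_zero
    (a := (Submodule.Quotient.mk x : H2 G ⧸ M)) (by rwa [Ne, Submodule.Quotient.mk_eq_zero])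
  let φ' : CharacterModule (Z2 G) :=
    (φ.comp (Submodule.mkQ M).toAddMonoidHom).comp (Submodule.mkQ _).toAddMonoidHom
  obtain ⟨C, hC⟩ := CharacterModule.dual_surjective_of_injective (R := ℤ) (Z2 G).subtype
    (Submodule.subtype_injective _) φ'
  have hC' : ∀ z : Z2 G, C (z : G × G →₀ ℤ) = φ' z := fun z => DFunLike.congr_fun hC z
  have hB : ∀ w, C (d3 G w) = 0 := by
    intro w
    have hdd : d2 G (d3 G w) = 0 := by
      have : (d2 G).comp (d3 G) = 0 := by
        refine Finsupp.lhom_ext fun t n => ?_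
        simp only [d2, d3, LinearMap.comp_apply, Finsupp.linearCombination_single, map_smul,
          map_sub, map_add, LinearMap.zero_apply, one_smul, mul_assoc]
        rw [← smul_zero n]; congr 1; abel
      exact LinearMap.congr_fun this w
    rw [hC' ⟨d3 G w, hdd⟩]
    have : (Submodule.mkQ ((B2 G).comap (Z2 G).subtype)) ⟨d3 G w, hdd⟩ = 0 := by
      rw [Submodule.mkQ_apply, Submodule.Quotient.mk_eq_zero]
      exact ⟨w, rfl⟩
    change φ (Submodule.mkQ M (Submodule.mkQ _ _)) = 0
    rw [this, map_zero, map_zero]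
  let c : G → G → AddCircle (1 : ℚ) := fun g h => C (Finsupp.single (g, h) 1)
  have hc : IsTwoCocycle c := by
    intro g h k
    have := hB (Finsupp.single (g, h, k) 1)
    simpa [d3] using this
  -- the restriction to chains supported in `P` is a coboundary
  let dP : Finsupp.supported ℤ ℤ P →ₗ[ℤ] (G →₀ ℤ) := (d2 G).comp (Submodule.subtype _)
  let CP : Finsupp.supported ℤ ℤ P →+ AddCircle (1 : ℚ) :=
    C.comp (Submodule.subtype (Finsupp.supported ℤ ℤ P)).toAddMonoidHom
  have hker : LinearMap.ker dP ≤ LinearMap.ker CP.toIntLinearMap := by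
    rintro ⟨z, hzP⟩ hz
    have hz2 : z ∈ Z2 G := hz
    change C z = 0
    rw [hC' ⟨z, hz2⟩]
    change φ (Submodule.mkQ M (Submodule.mkQ _ _)) = 0
    have : Submodule.mkQ M (Submodule.mkQ ((B2 G).comap (Z2 G).subtype) ⟨z, hz2⟩) = 0 := by
      rw [Submodule.mkQ_apply, Submodule.Quotient.mk_eq_zero]
      exact ⟨⟨z, hz2⟩, hzP, rfl⟩
    rw [this, map_zero]
  obtain ⟨β, hβ⟩ := CharacterModule.dual_surjective_of_injective (R := ℤ)
    ((LinearMap.ker dP).liftQ dP le_rfl)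
    (LinearMap.ker_eq_bot.1 (Submodule.ker_liftQ_eq_bot _ _ _ le_rfl))
    (((LinearMap.ker dP).liftQ CP.toIntLinearMap hker).toAddMonoidHom)
  have hβ' : ∀ z : Finsupp.supported ℤ ℤ P, β (d2 G z) = C z := fun z =>
    DFunLike.congr_fun hβ (Submodule.Quotient.mk z)
  obtain ⟨s, hs⟩ := hsplit (CocycleExt c hc) (CocycleExt.proj c hc)
    (by
      intro e he e'
      have he : e.base = 1 := he
      have h1 : c e'.base 1 = c 1 e'.base := by
        rw [CocycleExt.cocycle_one_left hc]
        have := hc e'.base 1 1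
        simp only [mul_one] at this
        rw [← sub_eq_zero, ← neg_eq_zero, ← this]; abel
      ext
      · simp [CocycleExt.mul_def, he]
      · simp only [CocycleExt.mul_def, he, h1]; abel)
    (fun g => ⟨g, - β (Finsupp.single g 1)⟩) (fun g => rfl)
    (by
      intro a b hab
      have := hβ' ⟨Finsupp.single (a, b) 1, Finsupp.single_mem_supported ℤ _ hab⟩
      have h2 : c a b = β (Finsupp.single b 1) - β (Finsupp.single (a * b) 1)
          + β (Finsupp.single a 1) := by
        change C _ = _
        rw [← this]; simp [d2]
      rw [CocycleExt.mul_def]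
      simp only [h2, CocycleExt.mk.injEq, true_and]; abel)
  obtain ⟨b, hb⟩ := exists_cobounding_of_split hc s hs
  obtain ⟨z, rfl⟩ := Submodule.Quotient.mk_surjective _ x
  apply hφ
  change φ' z = 0
  rw [← hC']
  let bl : (G →₀ ℤ) →+ AddCircle (1 : ℚ) := Finsupp.liftAddHom fun g =>
    (AddMonoidHom.flip (smulAddHom ℤ (AddCircle (1 : ℚ)))) (b g)
  let C' : (G × G →₀ ℤ) →+ AddCircle (1 : ℚ) := C
  change C' z = 0
  have : C' = bl.comp (d2 G).toAddMonoidHom := by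
    refine Finsupp.addHom_ext fun p n => ?_
    have h1 : Finsupp.single p n = n • Finsupp.single p (1 : ℤ) := by simp
    rw [h1, map_zsmul, map_zsmul]
    congr 1
    obtain ⟨g, h⟩ := p
    have hbl : ∀ g, bl (Finsupp.single g 1) = b g := fun g => by simp [bl]
    change c g h = bl (d2 G _)
    rw [hb]
    simp [d2, hbl]
  rw [this]
  change bl (d2 G z) = 0
  have hz : d2 G z = 0 := z.2
  rw [hz, map_zero]

/-- If `G` is generated by a finite set `F` subject to the relations `a * b = ab` with
`a, b, ab ∈ F`, then `H₂(G)` is finitely generated. -/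
theorem H2_finite_of_local_presentation (F : Set G) (hF : F.Finite)
    (hgen : Subgroup.closure F = ⊤)
    (hext : ∀ (Q : Type) [Group Q] (θ : G → Q),
      (∀ a b, a ∈ F → b ∈ F → a * b ∈ F → θ (a * b) = θ a * θ b) →
        ∃ s : G →* Q, ∀ a ∈ F, s a = θ a) :
    Module.Finite ℤ (H2 G) := by
  let P : Set (G × G) := {p | p.1 ∈ F ∧ p.2 ∈ F ∧ p.1 * p.2 ∈ F}
  have hP : P.Finite := (hF.prod hF).subset fun p hp => ⟨hp.1, hp.2.1⟩
  have key := exists_cycle_supported (G := G) P (by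
    intro E _ p _ σ hσ hmul
    obtain ⟨s, hs⟩ := hext E σ fun a b ha hb hab => (hmul a b ⟨ha, hb, hab⟩).symm
    refine ⟨s, fun g => ?_⟩
    have : p.comp s = MonoidHom.id G := MonoidHom.eq_of_eqOn_dense hgen fun a ha => by
      simp [hs a ha, hσ]
    exact DFunLike.congr_fun this g)
  have : Finite P := hP
  let L := Finsupp.supported ℤ ℤ P
  have hL : Module.Finite ℤ L := Module.Finite.equiv (Finsupp.supportedEquivFinsupp (M := ℤ) (R := ℤ) P).symm
  let N : Submodule ℤ L := (Z2 G).comap L.subtype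
  have : IsNoetherian ℤ L := isNoetherian_of_isNoetherianRing_of_finite ℤ L
  have hN : Module.Finite ℤ N := inferInstance
  let f : N →ₗ[ℤ] H2 G := (Submodule.mkQ _).comp
    ((L.subtype.comp N.subtype).codRestrict (Z2 G) fun n => n.2)
  refine Module.Finite.of_surjective f fun x => ?_
  obtain ⟨z, hz, rfl⟩ := key x
  exact ⟨⟨⟨z, hz⟩, z.2⟩, rfl⟩

/-- `H₂(H) → H₂(G)` is onto if a central extension of `G` splits as soon as it splits over the
image of the injective homomorphism `f`. -/
theorem H2Map_surjective_of_split {H : Type} [Group H] (f : H →* G) (hf : Function.Injective f)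
    (hsplit : ∀ (E : Type) [Group E] (p : E →* G), (∀ e, p e = 1 → ∀ e', e * e' = e' * e) →
      ∀ s₀ : f.range →* E, (∀ h, p (s₀ h) = h) → Function.Surjective p →
        ∃ s : G →* E, ∀ g, p (s g) = g) :
    Function.Surjective (H2Map f) := by
  classical
  intro x
  let P : Set (G × G) := Set.range (Prod.map f f)
  obtain ⟨z, hz, rfl⟩ := exists_cycle_supported (G := G) P (by
    intro E _ p hp σ hσ hmul
    have hm : ∀ a b : f.range, σ (a * b : G) = σ a * σ b := by
      rintro ⟨_, a, rfl⟩ ⟨_, b, rfl⟩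
      exact (hmul _ _ ⟨(a, b), rfl⟩).symm
    exact hsplit E p hp (MonoidHom.mk' (fun h : f.range => σ h) hm) (fun h => hσ _)
      (fun g => ⟨σ g, hσ g⟩)) x
  obtain ⟨w, hw⟩ : ∃ w : H × H →₀ ℤ, C2 f w = z := by
    have : Finsupp.supported ℤ ℤ P ≤ LinearMap.range (C2 f) := by
      rw [Finsupp.supported_eq_span_single, Submodule.span_le]
      rintro _ ⟨_, ⟨p, rfl⟩, rfl⟩
      exact ⟨Finsupp.single p 1, by simp [Prod.map]⟩
    exact this hz
  have hwZ : w ∈ Z2 H := by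
    have h1 := LinearMap.congr_fun (d2_comm f) w
    simp only [LinearMap.comp_apply] at h1
    rw [hw, show d2 G z = 0 from z.2] at h1
    have hinj : Function.Injective (C1 f) := Finsupp.mapDomain_injective hf
    exact hinj (h1.symm.trans (map_zero _).symm)
  refine ⟨Submodule.Quotient.mk ⟨w, hwZ⟩, ?_⟩
  change Submodule.Quotient.mk _ = _
  congr 1
  exact Subtype.ext hw

end CentralExtension

section BoundedTorsion

theorem card_torsion_congr {M N : Type} [AddCommGroup M] [AddCommGroup N] (e : M ≃ₗ[ℤ] N) :
    Nat.card (Submodule.torsion ℤ M) = Nat.card (Submodule.torsion ℤ N) := by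
  have h : (Submodule.torsion ℤ M).map (e : M →ₗ[ℤ] N) = Submodule.torsion ℤ N := by
    ext y
    constructor
    · rintro ⟨x, ⟨a, ha⟩, rfl⟩
      exact ⟨a, by rw [Submonoid.smul_def] at ha ⊢; simp [← map_zsmul, ha]⟩
    · rintro ⟨a, ha⟩
      refine ⟨e.symm y, ⟨a, ?_⟩, by simp⟩
      rw [Submonoid.smul_def] at ha ⊢
      simp [← map_zsmul, ha]
  rw [← h]
  exact Nat.card_congr (e.submoduleMap _).toEquiv

theorem finite_torsion (M : Type) [AddCommGroup M] [Module.Finite ℤ M] :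
    Finite (Submodule.torsion ℤ M) := by
  have : IsNoetherian ℤ M := isNoetherian_of_isNoetherianRing_of_finite ℤ M
  exact Module.finite_of_fg_torsion _ (Submodule.torsion_isTorsion)

/-- Finitely generated abelian groups in a sequence whose transition maps are eventually onto
have torsion of bounded order. -/
theorem exists_torsion_bound (A : ℕ → Type) [∀ n, AddCommGroup (A n)]
    [∀ n, Module.Finite ℤ (A n)] (f : ∀ n, A n →ₗ[ℤ] A (n + 1)) (N : ℕ)
    (hf : ∀ n, N ≤ n → Function.Surjective (f n)) :
    ∃ C : ℕ, ∀ n, Nat.card (Submodule.torsion ℤ (A n)) ≤ C := by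
  let F : ∀ k, A N →ₗ[ℤ] A (N + k) :=
    fun k => Nat.rec LinearMap.id (fun k φ => (f (N + k)).comp φ) k
  have hF : ∀ k, Function.Surjective (F k) := by
    intro k
    induction k with
    | zero => exact Function.surjective_id
    | succ k ih => exact (hf (N + k) (by omega)).comp ih
  have hmono : Monotone fun k => LinearMap.ker (F k) := by
    refine monotone_nat_of_le_succ fun k x hx => ?_
    change f (N + k) (F k x) = 0
    rw [show F k x = 0 from hx, map_zero]
  have : IsNoetherian ℤ (A N) := isNoetherian_of_isNoetherianRing_of_finite ℤ _
  obtain ⟨k₀, hk₀⟩ := monotone_stabilizes_iff_noetherian.2 this ⟨_, hmono⟩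
  have hstab : ∀ k, k₀ ≤ k → Nat.card (Submodule.torsion ℤ (A (N + k)))
      = Nat.card (Submodule.torsion ℤ (A (N + k₀))) := by
    intro k hk
    have h1 := card_torsion_congr ((F k).quotKerEquivOfSurjective (hF k))
    have h2 := card_torsion_congr ((F k₀).quotKerEquivOfSurjective (hF k₀))
    have h3 : LinearMap.ker (F k₀) = LinearMap.ker (F k) := hk₀ k hk
    rw [← h1, ← h2, h3]
  refine ⟨∑ n ∈ Finset.range (N + k₀ + 1), Nat.card (Submodule.torsion ℤ (A n)), fun n => ?_⟩
  have hle : ∀ m, m ≤ N + k₀ → Nat.card (Submodule.torsion ℤ (A m)) ≤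
      ∑ n ∈ Finset.range (N + k₀ + 1), Nat.card (Submodule.torsion ℤ (A n)) := fun m hm =>
    Finset.single_le_sum (f := fun n => Nat.card (Submodule.torsion ℤ (A n)))
      (fun _ _ => Nat.zero_le _) (Finset.mem_range.2 (by omega))
  rcases le_total n (N + k₀) with h | h
  · exact hle n h
  · obtain ⟨j, rfl⟩ := Nat.exists_eq_add_of_le h
    rw [add_assoc, hstab _ (by omega)]
    exact hle _ le_rfl

end BoundedTorsion

section GraphSplitting

/-- A `G`-invariant graph which is highly transitive: finitely many vertices have common
neighbours, `G` is transitive on extensions of small cliques, and adjacent vertices may be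
exchanged by an element commuting with their common stabilizer. -/
structure HighlyTransitive (G : Type) [Group G] (Y : Type) [MulAction G Y]
    (adj : Y → Y → Prop) : Prop where
  symm : ∀ {v w}, adj v w → adj w v
  smul : ∀ (g : G) {v w}, adj v w → adj (g • v) (g • w)
  nbr : ∀ a b c d e f, ∃ u, adj u a ∧ adj u b ∧ adj u c ∧ adj u d ∧ adj u e ∧ adj u f
  trans : ∀ {a b c d v v'}, adj a b → adj a c → adj a d → adj b c → adj b d → adj c d →
    adj v a → adj v b → adj v c → adj v d → adj v' a → adj v' b → adj v' c → adj v' d →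
    ∃ k : G, k • a = a ∧ k • b = b ∧ k • c = c ∧ k • d = d ∧ k • v = v'
  swap : ∀ {v w}, adj v w → ∃ σ : G, σ • v = w ∧ σ • w = v ∧
    (∀ h : G, h • v = v → h • w = w → σ * h = h * σ) ∧ ∀ u, adj u v → adj u w → σ • u = u

variable {G : Type} [Group G] {Y : Type} [MulAction G Y] {adj : Y → Y → Prop}

namespace HighlyTransitive

theorem trans₃ (T : HighlyTransitive G Y adj) {a b c v v' : Y} (hab : adj a b) (hac : adj a c)
    (hbc : adj b c) (h1 : adj v a) (h2 : adj v b) (h3 : adj v c) (h1' : adj v' a)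
    (h2' : adj v' b) (h3' : adj v' c) :
    ∃ k : G, k • a = a ∧ k • b = b ∧ k • c = c ∧ k • v = v' := by
  obtain ⟨d, da, db, dc, dv, dv', -⟩ := T.nbr a b c v v' v'
  obtain ⟨k, h⟩ := T.trans hab hac (T.symm da) hbc (T.symm db) (T.symm dc) h1 h2 h3 (T.symm dv)
    h1' h2' h3' (T.symm dv')
  exact ⟨k, h.1, h.2.1, h.2.2.1, h.2.2.2.2⟩

theorem trans₂ (T : HighlyTransitive G Y adj) {a b v v' : Y} (hab : adj a b)
    (h1 : adj v a) (h2 : adj v b) (h1' : adj v' a) (h2' : adj v' b) :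
    ∃ k : G, k • a = a ∧ k • b = b ∧ k • v = v' := by
  obtain ⟨d, da, db, dv, dv', -, -⟩ := T.nbr a b v v' v' v'
  obtain ⟨k, h⟩ := T.trans₃ hab (T.symm da) (T.symm db) h1 h2 (T.symm dv) h1' h2' (T.symm dv')
  exact ⟨k, h.1, h.2.1, h.2.2.2⟩

theorem trans₁ (T : HighlyTransitive G Y adj) {a v v' : Y} (h1 : adj v a) (h1' : adj v' a) :
    ∃ k : G, k • a = a ∧ k • v = v' := by
  obtain ⟨d, da, dv, dv', -, -, -⟩ := T.nbr a v v' v' v' v'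
  obtain ⟨k, h⟩ := T.trans₂ (T.symm da) h1 (T.symm dv) h1' (T.symm dv')
  exact ⟨k, h.1, h.2.2⟩

theorem trans₀ (T : HighlyTransitive G Y adj) (v v' : Y) : ∃ k : G, k • v = v' := by
  obtain ⟨d, dv, dv', -, -, -, -⟩ := T.nbr v v' v' v' v' v'
  obtain ⟨k, h⟩ := T.trans₁ (T.symm dv) (T.symm dv')
  exact ⟨k, h.2⟩

end HighlyTransitive

theorem smul_eq_of_inv_mul {h k : G} {v w : Y} (hh : h • v = w) (hk : k • v = w) :
    (k⁻¹ * h) • v = v := by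
  rw [mul_smul, hh, ← hk, inv_smul_smul]

theorem inv_smul_of_smul {h : G} {v : Y} (hh : h • v = v) : h⁻¹ • v = v :=
  inv_smul_eq_iff.2 hh.symm

/-- Sections over vertex stabilizers agreeing along edges give a global section. -/
theorem exists_section_of_vertex_sections (T : HighlyTransitive G Y adj) {E : Type} [Group E]
    (p : E →* G) (s : Y → G → E) (v : Y)
    (hp : ∀ v h, h • v = v → p (s v h) = h)
    (hmul : ∀ v h h', h • v = v → h' • v = v → s v (h * h') = s v h * s v h')
    (hconj : ∀ (e : E) v h, h • v = v → s (p e • v) (p e * h * (p e)⁻¹) = e * s v h * e⁻¹)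
    (hedge : ∀ v w h, adj v w → h • v = v → h • w = w → s v h = s w h) :
    ∃ S : G →* E, ∀ g, p (S g) = g := by
  have key₁ : ∀ g u k k', adj u v → k • u = u → k' • u = u → k • v = g • v → k' • v = g • v →
      s u k * s v (k⁻¹ * g) = s u k' * s v (k'⁻¹ * g) := by
    intro g u k k' huv hk hk' hkv hkv'
    have h1 : (k'⁻¹ * k) • v = v := smul_eq_of_inv_mul hkv hkv'
    have h2 : (k'⁻¹ * k) • u = u := smul_eq_of_inv_mul hk hk'
    have h3 : (k⁻¹ * g) • v = v := smul_eq_of_inv_mul rfl hkv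
    calc s u k * s v (k⁻¹ * g) = s u (k' * (k'⁻¹ * k)) * s v (k⁻¹ * g) := by
            rw [mul_inv_cancel_left]
      _ = s u k' * (s v (k'⁻¹ * k) * s v (k⁻¹ * g)) := by
            rw [hmul u _ _ hk' h2, hedge u v _ huv h2 h1, mul_assoc]
      _ = s u k' * s v (k'⁻¹ * g) := by
            rw [← hmul v _ _ h1 h3, mul_assoc, mul_inv_cancel_left]
  have key : ∀ g u u' k k', adj u v → adj u (g • v) → adj u' v → adj u' (g • v) →
      k • u = u → k' • u' = u' → k • v = g • v → k' • v = g • v →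
      s u k * s v (k⁻¹ * g) = s u' k' * s v (k'⁻¹ * g) := by
    intro g u u' k k' h1 h2 h1' h2' hk hk' hkv hkv'
    obtain ⟨w, wv, wg, wu, wu', -, -⟩ := T.nbr v (g • v) u u' u' u'
    obtain ⟨l, lw, lu, lv⟩ := T.trans₂ wu (T.symm wv) (T.symm h1) (T.symm wg) (T.symm h2)
    obtain ⟨l', lw', lu', lv'⟩ := T.trans₂ wu' (T.symm wv) (T.symm h1') (T.symm wg) (T.symm h2')
    rw [key₁ g u k l h1 hk lu hkv lv, hedge u w l (T.symm wu) lu lw,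
      key₁ g w l l' wv lw lw' lv lv', ← hedge u' w l' (T.symm wu') lu' lw',
      key₁ g u' l' k' h1' lu' hk' lv' hkv']
  have hex : ∀ g : G, ∃ x : Y × G, adj x.1 v ∧ adj x.1 (g • v) ∧ x.2 • x.1 = x.1 ∧
      x.2 • v = g • v := by
    intro g
    obtain ⟨u, uv, ug, -, -, -, -⟩ := T.nbr v (g • v) v v v v
    obtain ⟨k, ku, kv⟩ := T.trans₁ (T.symm uv) (T.symm ug)
    exact ⟨(u, k), uv, ug, ku, kv⟩
  choose x hx1 hx2 hx3 hx4 using hex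
  let S : G → E := fun g => s (x g).1 (x g).2 * s v ((x g).2⁻¹ * g)
  have hS : ∀ g u k, adj u v → adj u (g • v) → k • u = u → k • v = g • v →
      S g = s u k * s v (k⁻¹ * g) := fun g u k h1 h2 h3 h4 =>
    key g _ _ _ _ (hx1 g) (hx2 g) h1 h2 (hx3 g) h3 (hx4 g) h4
  refine ⟨MonoidHom.mk' S fun g g' => ?_, fun g => ?_⟩
  · obtain ⟨u, uv, ug, ugg, -, -, -⟩ := T.nbr v (g • v) ((g * g') • v) v v v
    obtain ⟨k, ku, kv⟩ := T.trans₁ (T.symm uv) (T.symm ug)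
    let h := k⁻¹ * g
    have hv : h • v = v := smul_eq_of_inv_mul rfl kv
    have hiv := inv_smul_of_smul hv
    have ukg : adj u ((h * g') • v) := by
      have := T.smul k⁻¹ ugg
      rwa [inv_smul_of_smul ku, ← mul_smul, ← mul_assoc] at this
    obtain ⟨l, lu, lv⟩ := T.trans₁ (T.symm uv) (T.symm ukg)
    have hSg' := hS g' (h⁻¹ • u) (h⁻¹ * l * h)
      (by have := T.smul h⁻¹ uv; rwa [hiv] at this)
      (by have := T.smul h⁻¹ ukg; rwa [← mul_smul, inv_mul_cancel_left] at this)
      (by rw [mul_smul, smul_inv_smul, mul_smul, lu])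
      (by rw [mul_smul, hv, mul_smul, lv, ← mul_smul, inv_mul_cancel_left])
    have hc := hconj (s v h)⁻¹ u l lu
    rw [map_inv, hp v h hv, inv_inv, inv_inv] at hc
    have hSgg := hS (g * g') u (k * l) uv ugg (by rw [mul_smul, lu, ku])
      (by rw [mul_smul, lv, ← mul_smul, ← mul_assoc, mul_inv_cancel_left])
    have hfix : ((h⁻¹ * l * h)⁻¹ * g') • v = v := smul_eq_of_inv_mul rfl
      (by rw [mul_smul, hv, mul_smul, lv, ← mul_smul, inv_mul_cancel_left])
    change S (g * g') = S g * S g'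
    rw [hSg', hSgg, hS g u k uv ug ku kv, hc, hmul u k l ku lu]
    have h5 : s v ((k * l)⁻¹ * (g * g')) = s v h * s v ((h⁻¹ * l * h)⁻¹ * g') := by
      rw [← hmul v _ _ hv hfix]
      congr 1
      simp only [h]
      group
    rw [h5]
    simp only [h]
    group
  · change p (s _ _ * s _ _) = g
    rw [map_mul, hp _ _ (hx3 g), hp v _ (smul_eq_of_inv_mul rfl (hx4 g)), mul_inv_cancel_left]

/-- A character of `G` trivial on a point stabilizer is trivial if elements may be moved
into it. -/
theorem char_trivial {M : Type} [Group M] (χ : G → M) (P : G → Prop)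
    (hPm : ∀ a b, P a → P b → P (a * b)) (hPi : ∀ a, P a → P a⁻¹)
    (hχ : ∀ a b, P a → P b → χ (a * b) = χ a * χ b)
    (v : Y)
    (hv : ∀ g, P g → g • v = v → χ g = 1)
    (hmove : ∀ g, P g → ∃ u k m, P k ∧ P m ∧ k • u = u ∧ k • v = g • v ∧ m • u = v)
    (g : G) (hg : P g) : χ g = 1 := by
  obtain ⟨u, k, m, hk, hm, ku, kv, mu⟩ := hmove g hg
  have h1 : χ (m * k * m⁻¹) = 1 := hv _ (hPm _ _ (hPm _ _ hm hk) (hPi _ hm)) (by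
    rw [mul_smul, ← mu, inv_smul_smul, mul_smul, ku])
  have h2 : χ (m * k) = χ m := by
    have := hχ (m * k * m⁻¹) m (hPm _ _ (hPm _ _ hm hk) (hPi _ hm)) hm
    rwa [h1, one_mul, inv_mul_cancel_right] at this
  rw [hχ m k hm hk] at h2
  have h3 : χ k = 1 := by simpa using h2
  have h4 := hχ k (k⁻¹ * g) hk (hPm _ _ (hPi _ hk) hg)
  rw [mul_inv_cancel_left, h3, one_mul, hv _ (hPm _ _ (hPi _ hk) hg)
    (smul_eq_of_inv_mul rfl kv)] at h4
  exact h4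

/-- A central extension split over a vertex stabilizer of a highly transitive graph splits. -/
theorem exists_section_of_stabilizer_section (T : HighlyTransitive G Y adj) {E : Type} [Group E]
    (p : E →* G) (hsurj : Function.Surjective p) (hcen : ∀ e, p e = 1 → ∀ e', e * e' = e' * e)
    (v₀ : Y) (s₀ : G → E) (hp₀ : ∀ h, h • v₀ = v₀ → p (s₀ h) = h)
    (hmul₀ : ∀ h h', h • v₀ = v₀ → h' • v₀ = v₀ → s₀ (h * h') = s₀ h * s₀ h') :
    ∃ S : G →* E, ∀ g, p (S g) = g := by
  have hconj_of_eq : ∀ a b x : E, p a = p b → a * x * a⁻¹ = b * x * b⁻¹ := by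
    intro a b x hab
    have h1 := hcen (b⁻¹ * a) (by simp [hab]) x
    calc a * x * a⁻¹ = b * ((b⁻¹ * a) * x) * a⁻¹ := by group
      _ = b * x * b⁻¹ := by rw [h1]; group
  have hlift : ∀ v, ∃ e : E, p e • v₀ = v := by
    intro v
    obtain ⟨k, hk⟩ := T.trans₀ v₀ v
    obtain ⟨e, rfl⟩ := hsurj k
    exact ⟨e, hk⟩
  choose t ht using hlift
  let s : Y → G → E := fun v h => t v * s₀ ((p (t v))⁻¹ * h * p (t v)) * (t v)⁻¹
  have hfix : ∀ v h, h • v = v → ((p (t v))⁻¹ * h * p (t v)) • v₀ = v₀ := by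
    intro v h hv
    rw [mul_smul, mul_smul, ht, hv, inv_smul_eq_iff, ht]
  have hone : s₀ 1 = 1 := by
    have := hmul₀ 1 1 (one_smul _ _) (one_smul _ _)
    rw [mul_one] at this
    simpa using this
  have hinv : ∀ h, h • v₀ = v₀ → s₀ h⁻¹ = (s₀ h)⁻¹ := by
    intro h hh
    have := hmul₀ h h⁻¹ hh (inv_smul_of_smul hh)
    rw [mul_inv_cancel, hone] at this
    exact (inv_eq_of_mul_eq_one_right this.symm).symm
  have hp : ∀ v h, h • v = v → p (s v h) = h := by
    intro v h hv
    simp only [s, map_mul, map_inv, hp₀ _ (hfix v h hv)]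
    group
  have hmul : ∀ v h h', h • v = v → h' • v = v → s v (h * h') = s v h * s v h' := by
    intro v h h' hv hv'
    have h1 : (p (t v))⁻¹ * (h * h') * p (t v)
        = ((p (t v))⁻¹ * h * p (t v)) * ((p (t v))⁻¹ * h' * p (t v)) := by group
    simp only [s]
    rw [h1, hmul₀ _ _ (hfix v h hv) (hfix v h' hv')]
    group
  have hconj : ∀ (e : E) v h, h • v = v →
      s (p e • v) (p e * h * (p e)⁻¹) = e * s v h * e⁻¹ := by
    intro e v h hv
    let w := p e • v
    let x := (t w)⁻¹ * e * t v
    have hx : p x • v₀ = v₀ := by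
      have h1 : p e • p (t v) • v₀ = w := by rw [ht]
      simp only [x, map_mul, map_inv, mul_smul, h1]
      rw [inv_smul_eq_iff, ht]
    let h' := (p (t v))⁻¹ * h * p (t v)
    have hh' : h' • v₀ = v₀ := hfix v h hv
    have h2 : (p (t w))⁻¹ * (p e * h * (p e)⁻¹) * p (t w) = p x * h' * (p x)⁻¹ := by
      simp only [x, h', map_mul, map_inv]; group
    have h3 : (p x * h') • v₀ = v₀ := by rw [mul_smul, hh', hx]
    have h4 := hconj_of_eq (s₀ (p x)) x (s₀ h') (hp₀ _ hx)
    change t w * s₀ ((p (t w))⁻¹ * (p e * h * (p e)⁻¹) * p (t w)) * (t w)⁻¹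
      = e * (t v * s₀ h' * (t v)⁻¹) * e⁻¹
    rw [h2, hmul₀ _ _ h3 (inv_smul_of_smul hx), hmul₀ _ _ hx hh', hinv _ hx, h4]
    simp only [x]; group
  refine exists_section_of_vertex_sections T p s v₀ hp hmul hconj ?_
  intro v w h hvw hv hw
  obtain ⟨σ, σv, σw, σc, σu⟩ := T.swap hvw
  obtain ⟨σ', rfl⟩ := hsurj σ
  let P : G → Prop := fun g => g • v = v ∧ g • w = w
  have hPm : ∀ a b, P a → P b → P (a * b) := fun a b ha hb =>
    ⟨by rw [mul_smul, hb.1, ha.1], by rw [mul_smul, hb.2, ha.2]⟩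
  have hPi : ∀ a, P a → P a⁻¹ := fun a ha => ⟨inv_smul_of_smul ha.1, inv_smul_of_smul ha.2⟩
  have hsw : ∀ g, P g → s w g = σ' * s v g * σ'⁻¹ := by
    intro g hg
    rw [← hconj σ' v g hg.1, σv, σc g hg.1 hg.2, mul_inv_cancel_right]
  let χ : G → E := fun g => s w g * (s v g)⁻¹
  have hχ1 : ∀ g, P g → ∀ e, χ g * e = e * χ g := fun g hg => hcen _ (by
    simp only [χ, map_mul, map_inv, hp v g hg.1, hp w g hg.2, mul_inv_cancel])
  have hχ : ∀ a b, P a → P b → χ (a * b) = χ a * χ b := by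
    intro a b ha hb
    have h1 := hχ1 b hb (s v a)⁻¹
    calc χ (a * b) = s w a * (χ b * (s v a)⁻¹) := by
          simp only [χ]
          rw [hmul w a b ha.2 hb.2, hmul v a b ha.1 hb.1]
          group
      _ = χ a * χ b := by rw [h1]; simp only [χ]; group
  suffices hmain : χ h = 1 from (mul_inv_eq_one.1 hmain).symm
  obtain ⟨v₂, h20, h21, -, -, -, -⟩ := T.nbr v w v w v w
  obtain ⟨v₃, h30, h31, h32, -, -, -⟩ := T.nbr v w v₂ v w v₂
  refine char_trivial χ P hPm hPi hχ v₂ ?_ ?_ h ⟨hv, hw⟩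
  · intro g hg hg2
    let P₂ : G → Prop := fun g => P g ∧ g • v₂ = v₂
    refine char_trivial χ P₂ (fun a b ha hb => ⟨hPm a b ha.1 hb.1, by
      rw [mul_smul, hb.2, ha.2]⟩) (fun a ha => ⟨hPi a ha.1, inv_smul_of_smul ha.2⟩)
      (fun a b ha hb => hχ a b ha.1 hb.1) v₃ ?_ ?_ g ⟨hg, hg2⟩
    · rintro g ⟨hg, hg2⟩ hg3
      obtain ⟨α, α0, α2, αc, αu⟩ := T.swap (T.symm h20)
      obtain ⟨β, β1, β3, βc, βu⟩ := T.swap (T.symm h31)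
      obtain ⟨τ, hτ⟩ := hsurj (α * β)
      have hτg : p τ * g = g * p τ := by
        rw [hτ, mul_assoc, βc g hg.2 hg3, ← mul_assoc, αc g hg.1 hg2, mul_assoc]
      have hτv : p τ • v = v₂ := by
        rw [hτ, mul_smul, βu v hvw (T.symm h30), α0]
      have hσg := σc g hg.1 hg.2
      let ρ := (p τ)⁻¹ * p σ' * p τ
      have hρv : ρ • v = v := by
        simp only [ρ]
        rw [mul_smul, mul_smul, hτv, σu v₂ h20 h21, ← hτv, inv_smul_smul]
      have hτg' : (p τ)⁻¹ * g = g * (p τ)⁻¹ := by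
        rw [inv_mul_eq_iff_eq_mul, ← mul_assoc, hτg, mul_inv_cancel_right]
      have hρg : ρ * g = g * ρ := by
        simp only [ρ]
        rw [mul_assoc, hτg, ← mul_assoc, mul_assoc _ (p σ') g, hσg, ← mul_assoc, hτg']
        simp only [mul_assoc]
      have h1 : s v g = τ * s v g * τ⁻¹ * ((τ * s v g * τ⁻¹)⁻¹ * s v g) := by group
      set z := (τ * s v g * τ⁻¹)⁻¹ * s v g with hz
      have hzc : ∀ e, z * e = e * z := hcen _ (by
        simp only [hz, map_mul, map_inv, hp v g hg.1, hτg]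
        group)
      have h2 : s v ρ * s v g * (s v ρ)⁻¹ = s v g := by
        rw [← hmul v _ _ hρv hg.1, hρg, hmul v _ _ hg.1 hρv, mul_inv_cancel_right]
      have h3 : σ' * s v g * σ'⁻¹ = s v g := by
        rw [hconj_of_eq σ' (τ * s v ρ * τ⁻¹) _ (by
          simp only [map_mul, map_inv, hp v ρ hρv, ρ]; group)]
        conv_lhs => rw [h1]
        calc τ * s v ρ * τ⁻¹ * (τ * s v g * τ⁻¹ * z) * (τ * s v ρ * τ⁻¹)⁻¹
            = τ * s v ρ * s v g * τ⁻¹ * (z * (τ * s v ρ * τ⁻¹)⁻¹) := by group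
          _ = τ * (s v ρ * s v g * (s v ρ)⁻¹) * τ⁻¹ * z := by rw [hzc]; group
          _ = s v g := by rw [h2, ← h1]
      simp only [χ]
      rw [hsw g hg, h3, mul_inv_cancel]
    · rintro g ⟨hg, hg2⟩
      have g30 : adj (g • v₃) v := by have := T.smul g h30; rwa [hg.1] at this
      have g31 : adj (g • v₃) w := by have := T.smul g h31; rwa [hg.2] at this
      have g32 : adj (g • v₃) v₂ := by have := T.smul g h32; rwa [hg2] at this
      obtain ⟨u, u0, u1, u2, u3, ug, -⟩ := T.nbr v w v₂ v₃ (g • v₃) v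
      obtain ⟨k, k0, k1, k2, ku, k3⟩ := T.trans hvw (T.symm h20) (T.symm u0) (T.symm h21)
        (T.symm u1) (T.symm u2) h30 h31 h32 (T.symm u3) g30 g31 g32 (T.symm ug)
      obtain ⟨m, m0, m1, m2, mu⟩ := T.trans₃ hvw (T.symm h20) (T.symm h21) u0 u1 u2 h30 h31 h32
      exact ⟨u, k, m, ⟨⟨k0, k1⟩, k2⟩, ⟨⟨m0, m1⟩, m2⟩, ku, k3, mu⟩
  · intro g hg
    have g20 : adj (g • v₂) v := by have := T.smul g h20; rwa [hg.1] at this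
    have g21 : adj (g • v₂) w := by have := T.smul g h21; rwa [hg.2] at this
    obtain ⟨u, u0, u1, u2, ug, -, -⟩ := T.nbr v w v₂ (g • v₂) v v
    obtain ⟨k, k0, k1, ku, k2⟩ := T.trans₃ hvw (T.symm u0) (T.symm u1) h20 h21 (T.symm u2) g20 g21
      (T.symm ug)
    obtain ⟨m, m0, m1, mu⟩ := T.trans₂ hvw u0 u1 h20 h21
    exact ⟨u, k, m, ⟨k0, k1⟩, ⟨m0, m1⟩, ku, k2, mu⟩

end GraphSplitting

section HyperbolicPair

open IsDedekindDomain

variable {A : Type} [CommRing A] [IsDedekindDomain A]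

theorem finite_primes_containing {d : A} (hd : d ≠ 0) :
    {v : HeightOneSpectrum A | d ∈ v.asIdeal}.Finite := by
  refine (Ideal.finite_factors (I := Ideal.span {d}) (by simpa using hd)).subset fun v hv => ?_
  simpa [Ideal.dvd_span_singleton] using hv

theorem exists_crt (s : Finset (HeightOneSpectrum A)) (x : HeightOneSpectrum A → A) :
    ∃ y : A, ∀ v ∈ s, y - x v ∈ v.asIdeal := by
  obtain ⟨y, hy⟩ := IsDedekindDomain.exists_forall_sub_mem_ideal (s := s)
    (fun v => v.asIdeal) (fun _ => 1) (fun v _ => v.prime)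
    (fun v _ w _ h h' => h (HeightOneSpectrum.ext h')) (fun v => x v)
  exact ⟨y, fun v hv => by simpa using hy v hv⟩

/-- An alternating form over a Dedekind domain which is nonzero modulo every prime has a
hyperbolic pair. -/
theorem exists_hyperbolic_pair {M : Type} [AddCommGroup M] [Module A M]
    (B : M →ₗ[A] M →ₗ[A] A) (hB : ∀ x, B x x = 0) (h0 : ∃ x y, B x y ≠ 0)
    (h : ∀ v : HeightOneSpectrum A, ∃ x y, B x y ∉ v.asIdeal) : ∃ e f, B e f = 1 := by
  classical
  obtain ⟨e₀, y₀, hd⟩ := h0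
  let P := (finite_primes_containing hd).toFinset
  have hP : ∀ v, v ∈ P ↔ B e₀ y₀ ∈ v.asIdeal := fun v => by simp [P]
  choose x y hxy using h
  -- a vector whose content is prime to `P`
  have hε : ∀ p : HeightOneSpectrum A, ∃ ε : A, ∀ v ∈ P, ε - (if v = p then 1 else 0) ∈ v.asIdeal :=
    fun p => exists_crt P fun v => if v = p then 1 else 0
  choose ε hε using hε
  obtain ⟨π, hπ0, hπ⟩ : ∃ π : A, π ≠ 0 ∧ ∀ v ∈ P, π ∈ v.asIdeal := ⟨_, hd, fun v hv => (hP v).1 hv⟩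
  let e₁ := ∑ p ∈ P, ε p • x p
  have he₁ : ∀ v ∈ P, B e₁ (y v) ∉ v.asIdeal := by
    intro v hv hmem
    apply hxy v
    have h1 : B e₁ (y v) - B (x v) (y v) ∈ v.asIdeal := by
      have h2 : B e₁ (y v) - B (x v) (y v) =
          ∑ p ∈ P, (ε p - if v = p then 1 else 0) * B (x p) (y v) := by
        simp [e₁, sub_mul, Finset.sum_sub_distrib, hv]
      rw [h2]
      exact Ideal.sum_mem _ fun p _ => Ideal.mul_mem_right _ _ (hε p v hv)
    exact (Submodule.sub_mem_iff_right _ hmem).1 h1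
  obtain ⟨e, he, he0⟩ : ∃ e, (∀ v ∈ P, B e (y v) ∉ v.asIdeal) ∧ B e e₀ ≠ 0 := by
    by_cases h1 : B e₁ e₀ = 0
    · refine ⟨e₁ + π • y₀, fun v hv hmem => he₁ v hv ?_, ?_⟩
      · have h2 : π * B y₀ (y v) ∈ v.asIdeal := Ideal.mul_mem_right _ _ (hπ v hv)
        simp only [map_add, LinearMap.add_apply, map_smul, LinearMap.smul_apply, smul_eq_mul]
          at hmem
        exact (Submodule.add_mem_iff_left _ h2).1 hmem
      · have h2 : B y₀ e₀ ≠ 0 := by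
          intro h3
          have := hB (y₀ + e₀)
          simp only [map_add, LinearMap.add_apply, hB, h3, zero_add, add_zero] at this
          exact hd this
        simp only [map_add, LinearMap.add_apply, map_smul, LinearMap.smul_apply, smul_eq_mul, h1,
          zero_add]
        exact mul_ne_zero hπ0 h2
    · exact ⟨e₁, he₁, h1⟩
  have hΔ : B e₀ y₀ * B e e₀ ≠ 0 := mul_ne_zero hd he0
  let Q := (finite_primes_containing hΔ).toFinset
  have hQ : ∀ v, v ∈ Q ↔ B e₀ y₀ * B e e₀ ∈ v.asIdeal := fun v => by simp [Q]
  obtain ⟨c, hc⟩ := exists_crt Q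
    fun v => if (∀ z, B e₀ z ∈ v.asIdeal) then 1 else 0
  have htop : LinearMap.range (B (e₀ + c • e)) = ⊤ := by
    by_contra hne
    obtain ⟨p, hp, hle⟩ := Ideal.exists_le_maximal _ hne
    have hmem : ∀ z, B e₀ z + c * B e z ∈ p := fun z => hle ⟨z, by simp⟩
    have hprime := hp.isPrime
    by_cases hΔp : B e₀ y₀ * B e e₀ ∈ p
    · let v : HeightOneSpectrum A := ⟨p, hprime, by rintro rfl; exact hΔ hΔp⟩
      have hvQ := hc v ((hQ v).2 hΔp)
      split_ifs at hvQ with hall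
      · apply he v ((hP v).2 (hall y₀))
        have h1 : c * B e (y v) ∈ p := (Submodule.add_mem_iff_right _ (hall (y v))).1 (hmem _)
        rcases hprime.mem_or_mem h1 with h2 | h2
        · exact absurd ((Submodule.sub_mem_iff_right _ h2).1 hvQ)
            ((Ideal.ne_top_iff_one _).1 hprime.ne_top)
        · exact h2
      · rw [sub_zero] at hvQ
        exact hall fun z => (Submodule.add_mem_iff_left _ (Ideal.mul_mem_right _ _ hvQ)).1 (hmem z)
    · have h1 := hmem e₀
      rw [hB, zero_add] at h1
      rcases hprime.mem_or_mem h1 with h2 | h2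
      · have h3 := (Submodule.add_mem_iff_left _ (Ideal.mul_mem_right _ _ h2)).1 (hmem y₀)
        exact hΔp (Ideal.mul_mem_right _ _ h3)
      · exact hΔp (Ideal.mul_mem_left _ _ h2)
  obtain ⟨f, hf⟩ : (1 : A) ∈ LinearMap.range (B (e₀ + c • e)) := htop ▸ Submodule.mem_top
  exact ⟨_, f, hf⟩

end HyperbolicPair

section UnimodularLattice

open IsDedekindDomain

variable {A K V : Type} [CommRing A] [Field K] [Algebra A K]
  [AddCommGroup V] [Module K V] [Module A V] [IsScalarTower A K V]

/-- A finitely generated `A`-submodule on which `ω` is integral, and which is self-dual inside its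
`K`-span. -/
structure IsUnimod (ω : V →ₗ[K] V →ₗ[K] K) (Λ : Submodule A V) : Prop where
  fg : Λ.FG
  int : ∀ x ∈ Λ, ∀ y ∈ Λ, ω x y ∈ (algebraMap A K).range
  sat : ∀ x ∈ Λ, ∀ a : K, (∀ y ∈ Λ, a * ω x y ∈ (algebraMap A K).range) → a • x ∈ Λ
  nd : ∀ x ∈ Λ, (∀ y ∈ Λ, ω x y = 0) → x = 0

/-- A symplectic family of vectors. -/
structure IsSympl (ω : V →ₗ[K] V →ₗ[K] K) {n : ℕ} (e f : Fin n → V) : Prop where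
  ee : ∀ i j, ω (e i) (e j) = 0
  ff : ∀ i j, ω (f i) (f j) = 0
  ef : ∀ i j, ω (e i) (f j) = if i = j then 1 else 0

/-- A symplectic basis of a lattice. -/
structure IsSymplBasis (ω : V →ₗ[K] V →ₗ[K] K) (Λ : Submodule A V) {n : ℕ} (e f : Fin n → V) :
    Prop extends IsSympl ω e f where
  mem_e : ∀ i, e i ∈ Λ
  mem_f : ∀ i, f i ∈ Λ
  expand : ∀ x ∈ Λ, x = ∑ i, (ω x (f i) • e i + ω (e i) x • f i)

/-- The vectors of `Λ` orthogonal to `x` and `z`. -/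
def Submodule.orthPair (ω : V →ₗ[K] V →ₗ[K] K) (Λ : Submodule A V) (x z : V) :
    Submodule A V where
  carrier := {y | y ∈ Λ ∧ ω x y = 0 ∧ ω z y = 0}
  add_mem' := by
    rintro a b ⟨h1, h2, h3⟩ ⟨h1', h2', h3'⟩
    exact ⟨add_mem h1 h1', by rw [map_add, h2, h2', add_zero], by rw [map_add, h3, h3', add_zero]⟩
  zero_mem' := ⟨zero_mem _, map_zero _, map_zero _⟩
  smul_mem' := by
    rintro c a ⟨h1, h2, h3⟩
    refine ⟨Λ.smul_mem c h1, ?_, ?_⟩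
    · rw [← algebraMap_smul K c a, map_smul, h2, smul_zero]
    · rw [← algebraMap_smul K c a, map_smul, h3, smul_zero]

theorem smul_mem_of_range {Λ : Submodule A V} {x : V} (hx : x ∈ Λ) {a : K}
    (ha : a ∈ (algebraMap A K).range) : a • x ∈ Λ := by
  obtain ⟨b, rfl⟩ := ha
  rw [algebraMap_smul]
  exact Λ.smul_mem b hx

theorem finite_span_of_fg {Λ : Submodule A V} (h : Λ.FG) :
    Module.Finite K (Submodule.span K (Λ : Set V)) := by
  obtain ⟨s, rfl⟩ := h
  rw [Submodule.span_span_of_tower]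
  exact Module.Finite.span_finset K s

variable {ω : V →ₗ[K] V →ₗ[K] K}

namespace IsUnimod

/-- The orthogonal complement of a suitable plane in a unimodular lattice is unimodular. -/
theorem orthPair [IsNoetherianRing A] (hω : ω.IsAlt) {Λ : Submodule A V} (hΛ : IsUnimod ω Λ)
    {x z : V} (hzx : ω z x = 1)
    (hdec : ∀ y ∈ Λ, ω z y • x + ω y x • z ∈ Λ) : IsUnimod ω (Λ.orthPair ω x z) := by
  have hxz : ω x z = -1 := by rw [← hω.neg, hzx]
  have hproj : ∀ y ∈ Λ, y - (ω z y • x + ω y x • z) ∈ Λ.orthPair ω x z := by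
    intro y hy
    refine ⟨sub_mem hy (hdec y hy), ?_, ?_⟩
    · simp [hω.self_eq_zero, hxz, ← hω.neg x y]
    · simp [hω.self_eq_zero, hzx]
  have hsplit : ∀ w ∈ Λ.orthPair ω x z, ∀ y, ω w y = ω w (y - (ω z y • x + ω y x • z)) := by
    rintro w ⟨-, h1, h2⟩ y
    have h3 : ω w x = 0 := by rw [← hω.neg, h1, neg_zero]
    have h4 : ω w z = 0 := by rw [← hω.neg, h2, neg_zero]
    simp [h3, h4]
  refine ⟨?_, ?_, ?_, ?_⟩
  · have := isNoetherian_of_fg_of_noetherian Λ hΛ.fg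
    have h := (IsNoetherian.noetherian ((Λ.orthPair ω x z).comap Λ.subtype)).map Λ.subtype
    rwa [Submodule.map_comap_subtype, inf_eq_right.2 (fun y hy => hy.1)] at h
  · exact fun w hw y hy => hΛ.int w hw.1 y hy.1
  · intro w hw a ha
    refine ⟨hΛ.sat w hw.1 a fun y hy => ?_, by simp [hw.2.1], by simp [hw.2.2]⟩
    rw [hsplit w hw y]
    exact ha _ (hproj y hy)
  · intro w hw h
    refine hΛ.nd w hw.1 fun y hy => ?_
    rw [hsplit w hw y]
    exact h _ (hproj y hy)

theorem exists_hyperbolic [IsDedekindDomain A] [IsFractionRing A K] (hω : ω.IsAlt)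
    {Λ : Submodule A V} (hΛ : IsUnimod ω Λ) (hne : Λ ≠ ⊥) :
    ∃ e ∈ Λ, ∃ f ∈ Λ, ω e f = 1 := by
  have hinj : Function.Injective (algebraMap A K) := IsFractionRing.injective A K
  have hch : ∀ x y : Λ, ∃ a : A, algebraMap A K a = ω x y := fun x y =>
    hΛ.int x x.2 y y.2
  choose b hb using hch
  let B : Λ →ₗ[A] Λ →ₗ[A] A := LinearMap.mk₂ A b
    (fun x x' y => hinj (by simp [hb]))
    (fun c x y => hinj (by
      rw [hb, smul_eq_mul, map_mul, hb]
      rw [Submodule.coe_smul, ← algebraMap_smul K c (x : V), map_smul, LinearMap.smul_apply,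
        smul_eq_mul]))
    (fun x y y' => hinj (by simp [hb]))
    (fun c x y => hinj (by
      rw [hb, smul_eq_mul, map_mul, hb]
      rw [Submodule.coe_smul, ← algebraMap_smul K c (y : V), map_smul, smul_eq_mul]))
  have hB : ∀ x y, algebraMap A K (B x y) = ω x y := hb
  obtain ⟨w, hw, hw0⟩ := Submodule.exists_mem_ne_zero_of_ne_bot hne
  obtain ⟨e, f, hef⟩ := exists_hyperbolic_pair B
    (fun x => hinj (by rw [hB, hω.self_eq_zero, map_zero]))
    (by
      by_contra! h
      refine hw0 (hΛ.nd w hw fun y hy => ?_)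
      rw [← hB ⟨w, hw⟩ ⟨y, hy⟩, h, map_zero])
    (by
      intro v
      by_contra! h
      obtain ⟨a, ha, ha1⟩ := FractionalIdeal.exists_notMem_one_of_ne_bot (K := K) v.ne_bot
        v.isPrime.ne_top
      rw [FractionalIdeal.mem_inv_iff (by simpa using v.ne_bot)] at ha
      have ha' : ∀ x ∈ v.asIdeal, a * algebraMap A K x ∈ (algebraMap A K).range := by
        intro x hx
        obtain ⟨c, hc⟩ := (FractionalIdeal.mem_one_iff _).1 (ha _ (FractionalIdeal.mem_coeIdeal_of_mem _ hx))
        exact ⟨c, hc⟩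
      have htf : Module.IsTorsionFree K V := inferInstance
      have hstab : ∀ x ∈ Λ, a • x ∈ Λ := fun x hx => hΛ.sat x hx a fun y hy => by
        rw [← hB ⟨x, hx⟩ ⟨y, hy⟩]
        exact ha' _ (h _ _)
      obtain ⟨c, hc⟩ := IsIntegrallyClosed.isIntegral_iff.1
        (isIntegral_of_smul_mem_submodule Λ hne hΛ.fg a hstab)
      exact ha1 ((FractionalIdeal.mem_one_iff _).2 ⟨c, hc⟩))
  exact ⟨e, e.2, f, f.2, by rw [← hB, hef, map_one]⟩

theorem hyperbolic_dec {Λ : Submodule A V} (hΛ : IsUnimod ω Λ) {e f : V} (he : e ∈ Λ)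
    (hf : f ∈ Λ) : ∀ y ∈ Λ, ω e y • f + ω y f • e ∈ Λ := fun y hy =>
  add_mem (smul_mem_of_range hf (hΛ.int _ he _ hy)) (smul_mem_of_range he (hΛ.int _ hy _ hf))

theorem basis_cons (hω : ω.IsAlt) {Λ : Submodule A V} {e₀ f₀ : V} (he : e₀ ∈ Λ) (hf : f₀ ∈ Λ)
    (h1 : ω e₀ f₀ = 1) (hdec : ∀ y ∈ Λ, ω e₀ y • f₀ + ω y f₀ • e₀ ∈ Λ) {n : ℕ} {e f : Fin n → V}
    (h : IsSymplBasis ω (Λ.orthPair ω f₀ e₀) e f) :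
    IsSymplBasis ω Λ (Fin.cons e₀ e : Fin (n + 1) → V) (Fin.cons f₀ f : Fin (n + 1) → V) := by
  have hfe : ω f₀ e₀ = -1 := by rw [← hω.neg, h1]
  have a1 : ∀ i, ω e₀ (e i) = 0 := fun i => (h.mem_e i).2.2
  have a2 : ∀ i, ω e₀ (f i) = 0 := fun i => (h.mem_f i).2.2
  have a3 : ∀ i, ω f₀ (e i) = 0 := fun i => (h.mem_e i).2.1
  have a4 : ∀ i, ω f₀ (f i) = 0 := fun i => (h.mem_f i).2.1
  have b1 : ∀ i, ω (e i) e₀ = 0 := fun i => by rw [← hω.neg, a1, neg_zero]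
  have b3 : ∀ i, ω (e i) f₀ = 0 := fun i => by rw [← hω.neg, a3, neg_zero]
  have b4 : ∀ i, ω (f i) f₀ = 0 := fun i => by rw [← hω.neg, a4, neg_zero]
  refine ⟨⟨?_, ?_, ?_⟩, ?_, ?_, ?_⟩
  · simp [Fin.forall_fin_succ, hω.self_eq_zero, a1, b1, h.ee]
  · simp [Fin.forall_fin_succ, hω.self_eq_zero, a4, b4, h.ff]
  · intro i j
    refine Fin.cases ?_ (fun i => ?_) i <;> refine Fin.cases ?_ (fun j => ?_) j
    · simp [h1]
    · simp [a2, (Fin.succ_ne_zero j).symm]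
    · simp [b3]
    · simp [h.ef]
  · simpa [Fin.forall_fin_succ, he] using fun i => (h.mem_e i).1
  · simpa [Fin.forall_fin_succ, hf] using fun i => (h.mem_f i).1
  · intro y hy
    have hy' : y - (ω e₀ y • f₀ + ω y f₀ • e₀) ∈ Λ.orthPair ω f₀ e₀ := by
      refine ⟨sub_mem hy (hdec y hy), ?_, ?_⟩
      · simp [hω.self_eq_zero, hfe, ← hω.neg f₀ y]
      · simp [hω.self_eq_zero, h1]
    have h5 := h.expand _ hy'
    have c2 : ∀ i, ω f₀ (f i) = 0 := a4
    simp only [map_sub, map_add, map_smul, LinearMap.sub_apply, LinearMap.add_apply,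
      LinearMap.smul_apply, a2, a4, b1, b3, smul_zero, add_zero, sub_zero] at h5
    rw [Fin.sum_univ_succ]
    simp only [Fin.cons_zero, Fin.cons_succ]
    rw [← h5]
    abel

theorem finrank_orthPair_lt {Λ : Submodule A V} (hΛ : IsUnimod ω Λ) {x z : V}
    (hx : x ∈ Λ) (hzx : ω z x = 1) :
    Module.finrank K (Submodule.span K (Λ.orthPair ω x z : Set V)) <
      Module.finrank K (Submodule.span K (Λ : Set V)) := by
  have := finite_span_of_fg (K := K) hΛ.fg
  apply Submodule.finrank_lt_finrank_of_lt
  refine lt_of_le_of_ne (Submodule.span_mono fun y hy => hy.1) fun heq => ?_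
  have h1 : x ∈ Submodule.span K (Λ.orthPair ω x z : Set V) := by
    rw [heq]; exact Submodule.subset_span hx
  have h2 : Submodule.span K (Λ.orthPair ω x z : Set V) ≤ LinearMap.ker (ω z) :=
    Submodule.span_le.2 fun y hy => hy.2.2
  have h3 : ω z x = 0 := h2 h1
  rw [hzx] at h3
  exact one_ne_zero h3

/-- Unimodular symplectic lattices over a Dedekind domain have symplectic bases. -/
theorem exists_basis [IsDedekindDomain A] [IsFractionRing A K] (hω : ω.IsAlt)
    {Λ : Submodule A V} (hΛ : IsUnimod ω Λ) :
    ∃ (n : ℕ) (e f : Fin n → V), IsSymplBasis ω Λ e f := by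
  induction hd : Module.finrank K (Submodule.span K (Λ : Set V)) using Nat.strong_induction_on
    generalizing Λ with
  | _ d ih =>
    by_cases hne : Λ = ⊥
    · refine ⟨0, Fin.elim0, Fin.elim0, ⟨⟨?_, ?_, ?_⟩, ?_, ?_, ?_⟩⟩
      all_goals try exact fun i => i.elim0
      intro x hx
      rw [hne, Submodule.mem_bot] at hx
      simp [hx]
    · obtain ⟨e₀, he, f₀, hf, h1⟩ := hΛ.exists_hyperbolic hω hne
      obtain ⟨n, e, f, h⟩ := ih _ (hd ▸ hΛ.finrank_orthPair_lt hf h1)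
        (hΛ.orthPair hω h1 (hΛ.hyperbolic_dec he hf)) rfl
      exact ⟨n + 1, _, _, basis_cons hω he hf h1 (hΛ.hyperbolic_dec he hf) h⟩

/-- A symplectic family in a unimodular lattice extends to a symplectic basis. -/
theorem exists_basis_extending [IsDedekindDomain A] [IsFractionRing A K] (hω : ω.IsAlt)
    {k : ℕ} {Λ : Submodule A V} (hΛ : IsUnimod ω Λ) (e f : Fin k → V) (hef : IsSympl ω e f)
    (he : ∀ i, e i ∈ Λ) (hf : ∀ i, f i ∈ Λ) :
    ∃ (n : ℕ) (hk : k ≤ n) (e' f' : Fin n → V), IsSymplBasis ω Λ e' f' ∧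
      ∀ i, e' (Fin.castLE hk i) = e i ∧ f' (Fin.castLE hk i) = f i := by
  induction k generalizing Λ with
  | zero =>
    obtain ⟨n, e', f', h⟩ := hΛ.exists_basis hω
    exact ⟨n, Nat.zero_le _, e', f', h, fun i => i.elim0⟩
  | succ k ih =>
    have h1 : ω (e 0) (f 0) = 1 := by simp [hef.ef]
    have hfe : ∀ i j, ω (f i) (e j) = - (if j = i then 1 else 0) := fun i j => by
      rw [← hω.neg, hef.ef]
    have hdec := hΛ.hyperbolic_dec (he 0) (hf 0)
    obtain ⟨n, hk, e', f', h, hext⟩ := ih (hΛ.orthPair hω h1 hdec) (fun i => e i.succ)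
      (fun i => f i.succ)
      ⟨fun i j => hef.ee _ _, fun i j => hef.ff _ _, fun i j => by simp [hef.ef]⟩
      (fun i => ⟨he _, by simp [hfe], hef.ee _ _⟩)
      (fun i => ⟨hf _, hef.ff _ _, by simp [hef.ef, (Fin.succ_ne_zero i).symm]⟩)
    refine ⟨n + 1, Nat.succ_le_succ hk, _, _, basis_cons hω (he 0) (hf 0) h1 hdec h, ?_⟩
    intro i
    refine Fin.cases ?_ (fun i => ?_) i
    · exact ⟨rfl, rfl⟩
    · exact hext i

/-- Every nonzero vector of a unimodular lattice `Λ` spans together with some `z` a plane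
splitting off `Λ`. The scalars `a ∈ A` in the content of `x` satisfy `a • z ∈ Λ`. -/
theorem exists_dual_vector [IsDedekindDomain A] [IsFractionRing A K] (hω : ω.IsAlt)
    {Λ : Submodule A V} (hΛ : IsUnimod ω Λ) {x : V} (hx : x ∈ Λ) (hx0 : x ≠ 0) :
    ∃ z, ω z x = 1 ∧ (∀ y ∈ Λ, ω z y • x + ω y x • z ∈ Λ) ∧ (∀ y ∈ Λ, ω y x • z ∈ Λ) := by
  obtain ⟨y₀, hy₀, hne⟩ : ∃ y ∈ Λ, ω x y ≠ 0 := by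
    by_contra! h
    exact hx0 (hΛ.nd x hx h)
  have hne' : ω y₀ x ≠ 0 := by rw [← hω.neg]; exact neg_ne_zero.2 hne
  -- the content ideal
  let J : Ideal A :=
    { carrier := {a | ∃ y ∈ Λ, algebraMap A K a = ω y x}
      add_mem' := by
        rintro a b ⟨y, hy, h⟩ ⟨y', hy', h'⟩
        exact ⟨y + y', add_mem hy hy', by simp [h, h']⟩
      zero_mem' := ⟨0, zero_mem _, by simp⟩
      smul_mem' := by
        rintro c a ⟨y, hy, h⟩
        exact ⟨c • y, Λ.smul_mem c hy, by
          rw [smul_eq_mul, map_mul, h, ← algebraMap_smul K c y, map_smul, LinearMap.smul_apply,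
            smul_eq_mul]⟩ }
  have hJ0 : J ≠ 0 := by
    intro h0
    obtain ⟨a, ha⟩ := hΛ.int y₀ hy₀ x hx
    have : a ∈ J := ⟨y₀, hy₀, ha⟩
    rw [h0, Ideal.zero_eq_bot, Ideal.mem_bot] at this
    rw [this, map_zero] at ha
    exact hne' ha.symm
  have hinv : (J : FractionalIdeal (nonZeroDivisors A) K) * (J : FractionalIdeal _ K)⁻¹ = 1 :=
    mul_inv_cancel₀ (by simpa using hJ0)
  have hone : (1 : K) ∈ (J : FractionalIdeal (nonZeroDivisors A) K) * (J : FractionalIdeal _ K)⁻¹ := by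
    rw [hinv]; exact FractionalIdeal.one_mem_one _
  have key : ∀ r : K, r ∈ (J : FractionalIdeal (nonZeroDivisors A) K) * (J : FractionalIdeal _ K)⁻¹ →
      ∃ z, ω z x = r ∧ ∀ a ∈ J, algebraMap A K a • z ∈ Λ := by
    intro r hr
    refine FractionalIdeal.mul_induction_on hr ?_ ?_
    · rintro i hi b hb
      obtain ⟨i, ⟨y, hy, h⟩, rfl⟩ := (FractionalIdeal.mem_coeIdeal _).1 hi
      rw [FractionalIdeal.mem_inv_iff (by simpa using hJ0)] at hb
      refine ⟨b • y, ?_, fun a ha => ?_⟩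
      · simp only [map_smul, LinearMap.smul_apply, ← h, smul_eq_mul, mul_comm]
      · rw [← mul_smul]
        obtain ⟨c, hc⟩ := (FractionalIdeal.mem_one_iff _).1
          (hb _ (FractionalIdeal.mem_coeIdeal_of_mem _ ha))
        exact smul_mem_of_range hy ⟨c, by rw [hc, mul_comm]⟩
    · rintro r r' ⟨z, hz, h⟩ ⟨z', hz', h'⟩
      exact ⟨z + z', by simp [hz, hz'], fun a ha => by
        rw [smul_add]; exact add_mem (h a ha) (h' a ha)⟩
  obtain ⟨z, hzx, hz⟩ := key 1 hone
  have hJz : ∀ y ∈ Λ, ω y x • z ∈ Λ := by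
    intro y hy
    obtain ⟨a, ha⟩ := hΛ.int y hy x hx
    rw [← ha]
    exact hz a ⟨y, hy, ha⟩
  refine ⟨z, hzx, fun y hy => add_mem ?_ (hJz y hy), hJz⟩
  refine hΛ.sat x hx _ fun w hw => ?_
  have h1 := hΛ.int _ (hJz w hw) y hy
  have h2 : ω z y * ω x w = - ω (ω w x • z) y := by
    rw [← hω.neg w x]
    simp [mul_comm]
  rw [h2]
  exact neg_mem h1

theorem finrank_le_orthPair_add_two [IsNoetherianRing A] {Λ : Submodule A V}
    (hω : ω.IsAlt) (hΛ : IsUnimod ω Λ) {x z : V}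
    (hzx : ω z x = 1) (hdec : ∀ y ∈ Λ, ω z y • x + ω y x • z ∈ Λ) :
    Module.finrank K (Submodule.span K (Λ : Set V)) ≤
      Module.finrank K (Submodule.span K (Λ.orthPair ω x z : Set V)) + 2 := by
  have := finite_span_of_fg (K := K) (hΛ.orthPair hω hzx hdec).fg
  have hxz : ω x z = -1 := by rw [← hω.neg, hzx]
  have hle : Submodule.span K (Λ : Set V) ≤
      Submodule.span K (Λ.orthPair ω x z : Set V) ⊔ Submodule.span K ({x, z} : Set V) := by
    refine Submodule.span_le.2 fun y hy => ?_
    have h1 : y - (ω z y • x + ω y x • z) ∈ Λ.orthPair ω x z := by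
      refine ⟨sub_mem hy (hdec y hy), ?_, ?_⟩
      · simp [hω.self_eq_zero, hxz, ← hω.neg x y]
      · simp [hω.self_eq_zero, hzx]
    have h2 : y = (y - (ω z y • x + ω y x • z)) + (ω z y • x + ω y x • z) := by abel
    rw [h2]
    refine Submodule.add_mem_sup (Submodule.subset_span h1) (add_mem ?_ ?_)
    · exact Submodule.smul_mem _ _ (Submodule.subset_span (by simp))
    · exact Submodule.smul_mem _ _ (Submodule.subset_span (by simp))
  have hfin : Module.Finite K (Submodule.span K ({x, z} : Set V)) :=
    Module.Finite.span_of_finite K (Set.toFinite _)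
  have h3 : Module.finrank K (Submodule.span K ({x, z} : Set V)) ≤ 2 := by
    classical
    have h4 := finrank_span_finset_le_card (R := K) ({x, z} : Finset V)
    rw [Finset.coe_pair] at h4
    exact h4.trans Finset.card_le_two
  calc _ ≤ _ := Submodule.finrank_mono hle
    _ ≤ _ := Submodule.finrank_add_le_finrank_add_finrank _ _
    _ ≤ _ := Nat.add_le_add_left h3 _

/-- Finitely many integral functionals on a unimodular lattice of large rank vanish on a
nonzero unimodular sublattice. -/
theorem exists_sublattice_orthogonal [IsDedekindDomain A] [IsFractionRing A K] (hω : ω.IsAlt)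
    {Λ : Submodule A V} (hΛ : IsUnimod ω Λ) (l : List V)
    (hl : ∀ x ∈ l, ∀ y ∈ Λ, ω y x ∈ (algebraMap A K).range) :
    ∃ Λ' ≤ Λ, IsUnimod ω Λ' ∧ (∀ x ∈ l, ∀ y ∈ Λ', ω y x = 0) ∧
      Module.finrank K (Submodule.span K (Λ : Set V)) ≤
        Module.finrank K (Submodule.span K (Λ' : Set V)) + 2 * l.length := by
  induction l with
  | nil => exact ⟨Λ, le_rfl, hΛ, by simp, by simp⟩
  | cons x l ih =>
    obtain ⟨Λ₁, hle, h1, horth, hfin⟩ := ih fun y hy => hl y (List.mem_cons_of_mem _ hy)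
    obtain ⟨n, e, f, hef⟩ := h1.exists_basis hω
    let x' := ∑ i, (ω x (f i) • e i + ω (e i) x • f i)
    have hx' : ∀ y ∈ Λ₁, ω y x = ω y x' := by
      intro y hy
      have hsk : ω x' y = ω x y := by
        conv_rhs => rw [hef.expand y hy]
        simp only [x', map_sum, LinearMap.sum_apply, map_add, LinearMap.add_apply, map_smul,
          LinearMap.smul_apply, smul_eq_mul]
        refine Finset.sum_congr rfl fun i _ => ?_
        rw [← hω.neg y (f i), ← hω.neg (e i) x]; ring
      rw [← hω.neg x y, ← hω.neg x' y, hsk]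
    have hmem : x' ∈ Λ₁ := Submodule.sum_mem _ fun i _ => add_mem
      (smul_mem_of_range (hef.mem_e i) (by
        rw [← hω.neg]; exact neg_mem (hl x (by simp) _ (hle (hef.mem_f i)))))
      (smul_mem_of_range (hef.mem_f i) (hl x (by simp) _ (hle (hef.mem_e i))))
    by_cases h0 : x' = 0
    · refine ⟨Λ₁, hle, h1, ?_, by simp only [List.length_cons]; omega⟩
      intro y hy w hw
      rcases List.mem_cons.1 hy with rfl | hy
      · rw [hx' w hw, h0, map_zero]
      · exact horth y hy w hw
    · obtain ⟨z, hz, hdec, -⟩ := h1.exists_dual_vector hω hmem h0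
      refine ⟨Λ₁.orthPair ω x' z, fun y hy => hle hy.1, h1.orthPair hω hz hdec, ?_, ?_⟩
      · intro y hy w hw
        rcases List.mem_cons.1 hy with rfl | hy
        · rw [hx' w hw.1, ← hω.neg, hw.2.1, neg_zero]
        · exact horth y hy w hw.1
      · have := finrank_le_orthPair_add_two hω h1 hz hdec
        simp only [List.length_cons]; omega

end IsUnimod

end UnimodularLattice

section Glue

variable {α : Type} {g : ℕ}

/-- The inclusion of the index set of `2g` coordinates into that of `2(g+1)` coordinates. -/
def idxSucc : Fin g ⊕ Fin g → Fin (g + 1) ⊕ Fin (g + 1) := Sum.map Fin.succ Fin.succ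

/-- Prepend one coordinate to both halves of a vector. -/
def glue (x y : α) (v : Fin g ⊕ Fin g → α) : Fin (g + 1) ⊕ Fin (g + 1) → α :=
  Sum.elim (Fin.cons x (v ∘ Sum.inl) : Fin (g + 1) → α) (Fin.cons y (v ∘ Sum.inr) : Fin (g + 1) → α)

@[simp] theorem glue_inl (x y : α) (v : Fin g ⊕ Fin g → α) : glue x y v (Sum.inl 0) = x := rfl
@[simp] theorem glue_inr (x y : α) (v : Fin g ⊕ Fin g → α) : glue x y v (Sum.inr 0) = y := rfl
@[simp] theorem glue_idxSucc (x y : α) (v : Fin g ⊕ Fin g → α) (m) :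
    glue x y v (idxSucc m) = v m := by
  rcases m with m | m <;> rfl

theorem idx_cases {P : Fin (g + 1) ⊕ Fin (g + 1) → Prop} (h1 : P (Sum.inl 0)) (h2 : P (Sum.inr 0))
    (h3 : ∀ m, P (idxSucc m)) : ∀ a, P a := by
  rintro (i | i)
  · exact Fin.cases h1 (fun i => h3 (Sum.inl i)) i
  · exact Fin.cases h2 (fun i => h3 (Sum.inr i)) i

theorem idxSucc_injective : Function.Injective (idxSucc (g := g)) :=
  Sum.map_injective.2 ⟨Fin.succ_injective _, Fin.succ_injective _⟩

@[simp] theorem idxSucc_inj {m n : Fin g ⊕ Fin g} : idxSucc m = idxSucc n ↔ m = n :=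
  idxSucc_injective.eq_iff

@[simp] theorem idxSucc_ne_inl (m : Fin g ⊕ Fin g) : idxSucc m ≠ Sum.inl 0 := by
  rcases m with m | m <;> simp [idxSucc, Fin.succ_ne_zero]
@[simp] theorem idxSucc_ne_inr (m : Fin g ⊕ Fin g) : idxSucc m ≠ Sum.inr 0 := by
  rcases m with m | m <;> simp [idxSucc, Fin.succ_ne_zero]
@[simp] theorem inl_ne_idxSucc (m : Fin g ⊕ Fin g) : Sum.inl 0 ≠ idxSucc m :=
  (idxSucc_ne_inl m).symm
@[simp] theorem inr_ne_idxSucc (m : Fin g ⊕ Fin g) : Sum.inr 0 ≠ idxSucc m :=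
  (idxSucc_ne_inr m).symm

theorem sum_idx {M : Type} [AddCommMonoid M] (F : Fin (g + 1) ⊕ Fin (g + 1) → M) :
    ∑ a, F a = F (Sum.inl 0) + F (Sum.inr 0) + ∑ m, F (idxSucc m) := by
  rw [Fintype.sum_sum_type, Fintype.sum_sum_type, Fin.sum_univ_succ, Fin.sum_univ_succ]
  simp only [idxSucc, Sum.map_inl, Sum.map_inr]
  abel

theorem glue_ext {f h : Fin (g + 1) ⊕ Fin (g + 1) → α} (h1 : f (Sum.inl 0) = h (Sum.inl 0))
    (h2 : f (Sum.inr 0) = h (Sum.inr 0)) (h3 : ∀ m, f (idxSucc m) = h (idxSucc m)) : f = h :=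
  funext (idx_cases h1 h2 h3)

end Glue

section SympForm

variable {g : ℕ} {R : Type} [CommRing R]

/-- The standard alternating form on `R^{2g}`. -/
def sform (g : ℕ) (R : Type) [CommRing R] :
    (Fin g ⊕ Fin g → R) →ₗ[R] (Fin g ⊕ Fin g → R) →ₗ[R] R :=
  LinearMap.mk₂ R (fun x y => ∑ i, (x (Sum.inl i) * y (Sum.inr i) - x (Sum.inr i) * y (Sum.inl i)))
    (fun x x' y => by simp only [Pi.add_apply, ← Finset.sum_add_distrib]; congr 1; ext i; ring)
    (fun c x y => by
      simp only [Pi.smul_apply, smul_eq_mul, Finset.mul_sum]; congr 1; ext i; ring)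
    (fun x y y' => by simp only [Pi.add_apply, ← Finset.sum_add_distrib]; congr 1; ext i; ring)
    (fun c x y => by
      simp only [Pi.smul_apply, smul_eq_mul, Finset.mul_sum]; congr 1; ext i; ring)

theorem sform_apply (x y : Fin g ⊕ Fin g → R) : sform g R x y =
    ∑ i, (x (Sum.inl i) * y (Sum.inr i) - x (Sum.inr i) * y (Sum.inl i)) := rfl

theorem sform_isAlt : (sform g R).IsAlt := fun x => by
  rw [sform_apply]
  exact Finset.sum_eq_zero fun i _ => by ring

theorem sform_eq_J (x y : Fin g ⊕ Fin g → R) :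
    sform g R x y = - (x ⬝ᵥ (Matrix.J (Fin g) R *ᵥ y)) := by
  have hJ : Matrix.J (Fin g) R *ᵥ y = Sum.elim (fun i => - y (Sum.inr i)) (fun i => y (Sum.inl i)) := by
    rw [Matrix.J, Matrix.fromBlocks_mulVec]
    congr 1
    · ext i; simp [Matrix.neg_mulVec]
    · ext i; simp
  rw [hJ, sform_apply, dotProduct, Fintype.sum_sum_type, ← Finset.sum_add_distrib,
    ← Finset.sum_neg_distrib]
  refine Finset.sum_congr rfl fun i _ => ?_
  simp only [Sum.elim_inl, Sum.elim_inr]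
  ring

theorem sform_glue (x y x' y' : R) (v v' : Fin g ⊕ Fin g → R) :
    sform (g + 1) R (glue x y v) (glue x' y' v') = x * y' - y * x' + sform g R v v' := by
  simp [sform_apply, Fin.sum_univ_succ, glue]
  try ring

theorem sform_map {S : Type} [CommRing S] (f : R →+* S) (x y : Fin g ⊕ Fin g → R) :
    sform g S (f ∘ x) (f ∘ y) = f (sform g R x y) := by
  simp [sform_apply]

theorem sform_single (a b : Fin g ⊕ Fin g) :
    sform g R (Pi.single a 1) (Pi.single b 1) = - Matrix.J (Fin g) R a b := by
  simp [sform_eq_J]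

theorem mem_Sp_iff_col {M : Matrix (Fin g ⊕ Fin g) (Fin g ⊕ Fin g) R} :
    M ∈ Sp g R ↔ ∀ a b, sform g R (M.col a) (M.col b)
      = sform g R (Pi.single a 1) (Pi.single b 1) := by
  rw [SymplecticGroup.mem_iff', ← Matrix.ext_iff]
  refine forall_congr' fun a => forall_congr' fun b => ?_
  have : (Mᵀ * Matrix.J (Fin g) R * M) a b = - sform g R (M.col a) (M.col b) := by
    rw [sform_eq_J, neg_neg, Matrix.mul_assoc]
    rfl
  rw [this, sform_single, neg_eq_iff_eq_neg]

theorem mem_Sp_iff_row {M : Matrix (Fin g ⊕ Fin g) (Fin g ⊕ Fin g) R} :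
    M ∈ Sp g R ↔ ∀ a b, sform g R (M a) (M b)
      = sform g R (Pi.single a 1) (Pi.single b 1) := by
  rw [← SymplecticGroup.transpose_mem_iff, mem_Sp_iff_col]
  rfl

theorem sform_mulVec {M : Matrix (Fin g ⊕ Fin g) (Fin g ⊕ Fin g) R} (hM : M ∈ Sp g R)
    (x y : Fin g ⊕ Fin g → R) : sform g R (M *ᵥ x) (M *ᵥ y) = sform g R x y := by
  rw [sform_eq_J, sform_eq_J]
  conv_rhs => rw [← SymplecticGroup.mem_iff'.1 hM]
  simp only [← Matrix.mulVec_mulVec]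
  rw [Matrix.dotProduct_mulVec x, Matrix.vecMul_transpose]

/-- The block embedding of matrices of size `2g` into matrices of size `2(g+1)`. -/
def embMat (M : Matrix (Fin g ⊕ Fin g) (Fin g ⊕ Fin g) R) :
    Matrix (Fin (g + 1) ⊕ Fin (g + 1)) (Fin (g + 1) ⊕ Fin (g + 1)) R :=
  Matrix.of (glue (glue 1 0 0) (glue 0 1 0) fun m => glue 0 0 (M m))

@[simp] theorem embMat_inl (M : Matrix (Fin g ⊕ Fin g) (Fin g ⊕ Fin g) R) :
    embMat M (Sum.inl 0) = glue 1 0 0 := rfl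
@[simp] theorem embMat_inr (M : Matrix (Fin g ⊕ Fin g) (Fin g ⊕ Fin g) R) :
    embMat M (Sum.inr 0) = glue 0 1 0 := rfl
@[simp] theorem embMat_idxSucc (M : Matrix (Fin g ⊕ Fin g) (Fin g ⊕ Fin g) R) (m) :
    embMat M (idxSucc m) = glue 0 0 (M m) := by
  rcases m with m | m <;> rfl

theorem embMat_mul (M N : Matrix (Fin g ⊕ Fin g) (Fin g ⊕ Fin g) R) :
    embMat (M * N) = embMat M * embMat N := by
  ext a b
  revert a b
  refine idx_cases ?_ ?_ fun m => ?_ <;> refine idx_cases ?_ ?_ fun n => ?_ <;>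
    simp [-Fintype.sum_sum_type, Matrix.mul_apply, sum_idx]

theorem embMat_one : embMat (1 : Matrix (Fin g ⊕ Fin g) (Fin g ⊕ Fin g) R) = 1 := by
  ext a b
  revert a b
  refine idx_cases ?_ ?_ fun m => ?_ <;> refine idx_cases ?_ ?_ fun n => ?_ <;>
    simp [Matrix.one_apply]

theorem single_inl_zero : (Pi.single (Sum.inl 0) 1 : Fin (g + 1) ⊕ Fin (g + 1) → R) = glue 1 0 0 := by
  refine glue_ext ?_ ?_ fun m => ?_ <;> simp

theorem single_inr_zero : (Pi.single (Sum.inr 0) 1 : Fin (g + 1) ⊕ Fin (g + 1) → R) = glue 0 1 0 := by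
  refine glue_ext ?_ ?_ fun m => ?_ <;> simp

theorem single_idxSucc (m : Fin g ⊕ Fin g) :
    (Pi.single (idxSucc m) 1 : Fin (g + 1) ⊕ Fin (g + 1) → R) = glue 0 0 (Pi.single m 1) := by
  refine glue_ext ?_ ?_ fun n => ?_ <;> simp [Pi.single_apply]

theorem embMat_mem {M : Matrix (Fin g ⊕ Fin g) (Fin g ⊕ Fin g) R} :
    embMat M ∈ Sp (g + 1) R ↔ M ∈ Sp g R := by
  rw [mem_Sp_iff_row, mem_Sp_iff_row]
  constructor
  · intro h a b
    have := h (idxSucc a) (idxSucc b)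
    simpa [sform_glue, single_idxSucc] using this
  · intro h
    refine idx_cases ?_ ?_ fun m => ?_ <;> refine idx_cases ?_ ?_ fun n => ?_ <;>
      simp [sform_glue, single_idxSucc, single_inl_zero, single_inr_zero, h]

/-- The stabilization homomorphism `Sp(2g, R) → Sp(2(g+1), R)`. -/
def stabHom (g : ℕ) (R : Type) [CommRing R] : Sp g R →* Sp (g + 1) R where
  toFun M := ⟨embMat M.1, embMat_mem.2 M.2⟩
  map_one' := Subtype.ext embMat_one
  map_mul' M N := Subtype.ext (embMat_mul M.1 N.1)

theorem stabHom_injective : Function.Injective (stabHom g R) := by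
  intro M N h
  have h1 : embMat M.1 = embMat N.1 := congrArg Subtype.val h
  refine Subtype.ext (Matrix.ext fun a b => ?_)
  have := congrFun (congrFun h1 (idxSucc a)) (idxSucc b)
  simpa using this

/-- A symplectic matrix fixing the first hyperbolic pair is a stabilization. -/
theorem mem_range_stabHom {M : Sp (g + 1) R} (h1 : M.1.col (Sum.inl 0) = glue 1 0 0)
    (h2 : M.1.col (Sum.inr 0) = glue 0 1 0) : M ∈ (stabHom g R).range := by
  have hM := mem_Sp_iff_col.1 M.2
  have hcol : ∀ m, M.1.col (idxSucc m) = glue 0 0 fun n => M.1 (idxSucc n) (idxSucc m) := by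
    intro m
    have hdec : M.1.col (idxSucc m) = glue (M.1 (Sum.inl 0) (idxSucc m)) (M.1 (Sum.inr 0) (idxSucc m))
        fun n => M.1 (idxSucc n) (idxSucc m) := by
      refine glue_ext ?_ ?_ fun n => ?_ <;> simp
    have e1 := hM (Sum.inl 0) (idxSucc m)
    have e2 := hM (Sum.inr 0) (idxSucc m)
    rw [h1, hdec, single_inl_zero, single_idxSucc, sform_glue, sform_glue] at e1
    rw [h2, hdec, single_inr_zero, single_idxSucc, sform_glue, sform_glue] at e2
    simp only [map_zero, LinearMap.zero_apply, one_mul, zero_mul, mul_zero, sub_zero, add_zero,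
      zero_sub, neg_eq_zero] at e1 e2
    rw [hdec, e1, e2]
  let N : Matrix (Fin g ⊕ Fin g) (Fin g ⊕ Fin g) R := Matrix.of fun n m => M.1 (idxSucc n) (idxSucc m)
  have hN : M.1 = embMat N := by
    refine Matrix.ext_col ?_
    refine idx_cases ?_ ?_ fun m => ?_
    · rw [h1]
      refine glue_ext ?_ ?_ fun n => ?_ <;> simp
    · rw [h2]
      refine glue_ext ?_ ?_ fun n => ?_ <;> simp
    · rw [hcol]
      refine glue_ext ?_ ?_ fun n => ?_ <;> simp [N]
  exact ⟨⟨N, embMat_mem.1 (hN ▸ M.2)⟩, Subtype.ext hN.symm⟩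

end SympForm

section StdLattice

variable {g : ℕ} {A K : Type} [CommRing A] [Field K] [Algebra A K]

/-- The standard lattice `A^{2g}` in `K^{2g}`. -/
def stdLattice (g : ℕ) (A K : Type) [CommRing A] [Field K] [Algebra A K] :
    Submodule A (Fin g ⊕ Fin g → K) :=
  LinearMap.range ((Algebra.linearMap A K).compLeft (Fin g ⊕ Fin g))

theorem mem_stdLattice {x : Fin g ⊕ Fin g → K} :
    x ∈ stdLattice g A K ↔ ∀ i, x i ∈ (algebraMap A K).range := by
  constructor
  · rintro ⟨y, rfl⟩ i
    exact ⟨y i, rfl⟩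
  · intro h
    choose y hy using h
    exact ⟨y, funext hy⟩

theorem map_mem_stdLattice (x : Fin g ⊕ Fin g → A) : algebraMap A K ∘ x ∈ stdLattice g A K :=
  mem_stdLattice.2 fun i => ⟨x i, rfl⟩

theorem single_mem_stdLattice (a : Fin g ⊕ Fin g) : Pi.single a 1 ∈ stdLattice g A K :=
  mem_stdLattice.2 fun i => by
    rw [Pi.single_apply]
    split_ifs
    · exact one_mem _
    · exact zero_mem _

theorem sform_single_inr {R : Type} [CommRing R] (x : Fin g ⊕ Fin g → R) (i : Fin g) :
    sform g R x (Pi.single (Sum.inr i) 1) = x (Sum.inl i) := by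
  simp [sform_apply, Pi.single_apply]

theorem sform_single_inl {R : Type} [CommRing R] (x : Fin g ⊕ Fin g → R) (i : Fin g) :
    sform g R x (Pi.single (Sum.inl i) 1) = - x (Sum.inr i) := by
  simp [sform_apply, Pi.single_apply]

theorem sform_swap {R : Type} [CommRing R] (x y : Fin g ⊕ Fin g → R) :
    sform g R x y = - sform g R y x := (sform_isAlt.neg y x).symm

theorem span_stdLattice : Submodule.span K (stdLattice g A K : Set (Fin g ⊕ Fin g → K)) = ⊤ := by
  rw [eq_top_iff, ← (Pi.basisFun K (Fin g ⊕ Fin g)).span_eq]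
  refine Submodule.span_mono ?_
  rintro _ ⟨a, rfl⟩
  rw [Pi.basisFun_apply]
  exact single_mem_stdLattice a

theorem isUnimod_stdLattice : IsUnimod (sform g K) (stdLattice g A K) where
  fg := by
    rw [stdLattice, LinearMap.range_eq_map]
    exact Submodule.FG.map _ Module.Finite.fg_top
  int := by
    rintro _ ⟨x, rfl⟩ _ ⟨y, rfl⟩
    exact ⟨sform g A x y, (sform_map (algebraMap A K) x y).symm⟩
  sat := by
    intro x _ a h
    refine mem_stdLattice.2 ?_
    rintro (i | i)
    · have := h _ (single_mem_stdLattice (Sum.inr i))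
      rwa [sform_single_inr] at this
    · have := h _ (single_mem_stdLattice (Sum.inl i))
      rw [sform_single_inl, mul_neg] at this
      simpa using neg_mem this
  nd := by
    intro x _ h
    funext a
    rcases a with i | i
    · have := h _ (single_mem_stdLattice (Sum.inr i))
      rwa [sform_single_inr] at this
    · have := h _ (single_mem_stdLattice (Sum.inl i))
      rwa [sform_single_inl, neg_eq_zero] at this

end StdLattice

section SymplMat

variable {g : ℕ} {R : Type} [CommRing R]

/-- The matrix with prescribed columns. -/
def colMat {n : ℕ} (e f : Fin n → Fin g ⊕ Fin g → R) : Matrix (Fin g ⊕ Fin g) (Fin n ⊕ Fin n) R :=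
  Matrix.of fun a b => Sum.elim e f b a

theorem colMat_mem {e f : Fin g → Fin g ⊕ Fin g → R} (ee : ∀ i j, sform g R (e i) (e j) = 0)
    (ff : ∀ i j, sform g R (f i) (f j) = 0)
    (ef : ∀ i j, sform g R (e i) (f j) = if i = j then 1 else 0) : colMat e f ∈ Sp g R := by
  have hcol : ∀ b, (colMat e f).col b = Sum.elim e f b := fun b => rfl
  rw [mem_Sp_iff_col]
  rintro (i | i) (j | j) <;> rw [hcol, hcol, sform_single]
  · simpa [Matrix.J] using ee i j
  · simpa [Matrix.J, Matrix.one_apply] using ef i j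
  · rw [sform_swap]
    simpa [Matrix.J, Matrix.one_apply, eq_comm] using ef j i
  · simpa [Matrix.J] using ff i j

variable {K : Type} [Field K]

theorem IsSymplBasis.card_eq {A : Type} [CommRing A] [Algebra A K]
    {Λ : Submodule A (Fin g ⊕ Fin g → K)} (hΛ : Submodule.span K (Λ : Set (Fin g ⊕ Fin g → K)) = ⊤)
    {n : ℕ} {e f : Fin n → Fin g ⊕ Fin g → K} (h : IsSymplBasis (sform g K) Λ e f) : n = g := by
  have hsw : ∀ i j, sform g K (f j) (e i) = - if i = j then 1 else 0 := fun i j => by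
    rw [sform_swap, h.ef]
  have hli : LinearIndependent K (Sum.elim e f) := by
    rw [Fintype.linearIndependent_iff]
    intro c hc a
    rw [Fintype.sum_sum_type] at hc
    simp only [Sum.elim_inl, Sum.elim_inr] at hc
    rcases a with i | i
    · have := congrArg (fun v => sform g K v (f i)) hc
      simpa [h.ef, h.ff] using this
    · have := congrArg (fun v => sform g K v (e i)) hc
      simpa [h.ee, hsw] using this
  have hsp : ⊤ ≤ Submodule.span K (Set.range (Sum.elim e f)) := by
    rw [← hΛ, Submodule.span_le]
    intro x hx
    rw [h.expand x hx]
    exact sum_mem fun i _ => add_mem (Submodule.smul_mem _ _ (Submodule.subset_span ⟨Sum.inl i, rfl⟩))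
      (Submodule.smul_mem _ _ (Submodule.subset_span ⟨Sum.inr i, rfl⟩))
  have h1 := Module.finrank_eq_card_basis (Module.Basis.mk hli hsp)
  simp at h1
  omega

theorem exists_Sp_of_map {A : Type} [CommRing A] [Algebra A K] [FaithfulSMul A K] {M : Sp g K}
    (hM : ∀ a b, M.1 a b ∈ (algebraMap A K).range) :
    ∃ N : Sp g A, SpAux.SpMap (algebraMap A K) g N = M := by
  choose N hN using hM
  have h1 : (Matrix.of N).map (algebraMap A K) = M.1 := by
    ext a b
    exact hN a b
  have hinj := FaithfulSMul.algebraMap_injective A K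
  refine ⟨⟨Matrix.of N, ?_⟩, Subtype.ext h1⟩
  rw [SymplecticGroup.mem_iff]
  have h2 := SymplecticGroup.mem_iff.1 M.2
  rw [← h1, ← SpAux.J_map (algebraMap A K), ← Matrix.transpose_map, ← Matrix.map_mul,
    ← Matrix.map_mul] at h2
  exact Matrix.map_injective hinj h2

end SymplMat

section DedekindSymplectic

variable {g : ℕ} {A : Type} [CommRing A] [IsDedekindDomain A]

/-- Hyperbolic pairs extend to a symplectic basis. -/
theorem exists_Sp_extending {k : ℕ} {e f : Fin k → Fin g ⊕ Fin g → A}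
    (ee : ∀ i j, sform g A (e i) (e j) = 0) (ff : ∀ i j, sform g A (f i) (f j) = 0)
    (ef : ∀ i j, sform g A (e i) (f j) = if i = j then 1 else 0) :
    ∃ (hk : k ≤ g) (N : Sp g A), ∀ i, N.1.col (Sum.inl (Fin.castLE hk i)) = e i ∧
      N.1.col (Sum.inr (Fin.castLE hk i)) = f i := by
  let K := FractionRing A
  let φ := algebraMap A K
  have hinj : Function.Injective φ := IsFractionRing.injective A K
  obtain ⟨n, hk, e', f', hB, hext⟩ := IsUnimod.exists_basis_extending (k := k)
    (sform_isAlt (g := g) (R := K)) (isUnimod_stdLattice (A := A)) (fun i => φ ∘ e i) (fun i => φ ∘ f i)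
    ⟨fun i j => by rw [sform_map, ee, map_zero], fun i j => by rw [sform_map, ff, map_zero],
      fun i j => by rw [sform_map, ef]; split_ifs <;> simp⟩
    (fun i => map_mem_stdLattice _) (fun i => map_mem_stdLattice _)
  obtain rfl : n = g := hB.card_eq span_stdLattice
  obtain ⟨N, hN⟩ := exists_Sp_of_map (A := A) (M := ⟨colMat e' f', colMat_mem hB.ee hB.ff hB.ef⟩) (by
    rintro a (i | i)
    · exact mem_stdLattice.1 (hB.mem_e i) a
    · exact mem_stdLattice.1 (hB.mem_f i) a)
  have hN' : ∀ a b, φ (N.1 a b) = Sum.elim e' f' b a := fun a b =>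
    congrFun (congrFun (congrArg Subtype.val hN) a) b
  refine ⟨hk, N, fun i => ⟨funext fun a => hinj ?_, funext fun a => hinj ?_⟩⟩
  · exact (hN' a _).trans (congrFun (hext i).1 a)
  · exact (hN' a _).trans (congrFun (hext i).2 a)

/-- A short list of vectors is orthogonal to some hyperbolic pair. -/
theorem exists_hyperbolic_orthogonal (l : List (Fin g ⊕ Fin g → A)) (hl : l.length < g) :
    ∃ e f, sform g A e f = 1 ∧ ∀ x ∈ l, sform g A e x = 0 ∧ sform g A f x = 0 := by
  let K := FractionRing A
  let φ := algebraMap A K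
  have hinj : Function.Injective φ := IsFractionRing.injective A K
  obtain ⟨Λ', hle, hU, horth, hrank⟩ := IsUnimod.exists_sublattice_orthogonal
    (sform_isAlt (g := g) (R := K)) (isUnimod_stdLattice (A := A)) (l.map fun x => φ ∘ x) (by
      intro x hx y hy
      obtain ⟨x, -, rfl⟩ := List.mem_map.1 hx
      exact isUnimod_stdLattice.int y hy _ (map_mem_stdLattice x))
  have hne : Λ' ≠ ⊥ := by
    rintro rfl
    rw [span_stdLattice, Submodule.bot_coe, Submodule.span_zero_singleton] at hrank
    simp at hrank
    omega
  obtain ⟨e, he, f, hf, h1⟩ := hU.exists_hyperbolic sform_isAlt hne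
  obtain ⟨e₀, rfl⟩ := hle he
  obtain ⟨f₀, rfl⟩ := hle hf
  refine ⟨e₀, f₀, hinj ?_, fun x hx => ⟨hinj ?_, hinj ?_⟩⟩
  · rw [← sform_map, map_one]; exact h1
  · rw [← sform_map, map_zero]; exact horth _ (List.mem_map_of_mem hx) _ he
  · rw [← sform_map, map_zero]; exact horth _ (List.mem_map_of_mem hx) _ hf

end DedekindSymplectic

section HyperbolicPairs

variable (g : ℕ) (A : Type) [CommRing A]

/-- Hyperbolic pairs in `A^{2g}`. -/
@[ext] structure HypPair where
  /-- The first vector. -/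
  e : Fin g ⊕ Fin g → A
  /-- The second vector. -/
  f : Fin g ⊕ Fin g → A
  eq_one : sform g A e f = 1

variable {g A}

instance HypPair.instSMul : SMul (Sp g A) (HypPair g A) where
  smul M p := ⟨M.1 *ᵥ p.e, M.1 *ᵥ p.f, by rw [sform_mulVec M.2]; exact p.eq_one⟩

theorem HypPair.smul_e (M : Sp g A) (p : HypPair g A) : (M • p).e = M.1 *ᵥ p.e := rfl
theorem HypPair.smul_f (M : Sp g A) (p : HypPair g A) : (M • p).f = M.1 *ᵥ p.f := rfl

instance HypPair.instMulAction : MulAction (Sp g A) (HypPair g A) where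
  one_smul p := HypPair.ext (Matrix.one_mulVec p.e) (Matrix.one_mulVec p.f)
  mul_smul M N p := HypPair.ext
    (Matrix.mulVec_mulVec p.e M.1 N.1).symm (Matrix.mulVec_mulVec p.f M.1 N.1).symm

/-- Orthogonality of hyperbolic pairs. -/
def HypPair.adj (p q : HypPair g A) : Prop :=
  (sform g A p.e q.e = 0 ∧ sform g A p.e q.f = 0) ∧
    (sform g A p.f q.e = 0 ∧ sform g A p.f q.f = 0)

theorem HypPair.adj.symm {p q : HypPair g A} (h : p.adj q) : q.adj p := by
  obtain ⟨⟨h1, h2⟩, h3, h4⟩ := h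
  refine ⟨⟨?_, ?_⟩, ?_, ?_⟩ <;> rw [sform_swap] <;> simp [*]

theorem HypPair.exists_Sp [IsDedekindDomain A] {k : ℕ} (P : Fin k → HypPair g A)
    (hP : ∀ i j, i ≠ j → (P i).adj (P j)) :
    ∃ (hk : k ≤ g) (N : Sp g A), ∀ i, N.1 *ᵥ (Pi.single (Sum.inl (Fin.castLE hk i)) 1) = (P i).e ∧
      N.1 *ᵥ (Pi.single (Sum.inr (Fin.castLE hk i)) 1) = (P i).f := by
  simp only [Matrix.mulVec_single_one]
  refine exists_Sp_extending (fun i j => ?_) (fun i j => ?_) (fun i j => ?_) <;>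
    rcases eq_or_ne i j with rfl | hij
  · exact sform_isAlt _
  · exact (hP i j hij).1.1
  · exact sform_isAlt _
  · exact (hP i j hij).2.2
  · rw [if_pos rfl]; exact (P i).eq_one
  · rw [if_neg hij]; exact (hP i j hij).1.2

theorem HypPair.exists_smul_eq [IsDedekindDomain A] {k : ℕ} (P Q : Fin k → HypPair g A)
    (hP : ∀ i j, i ≠ j → (P i).adj (P j)) (hQ : ∀ i j, i ≠ j → (Q i).adj (Q j)) :
    ∃ k : Sp g A, ∀ i, k • P i = Q i := by
  obtain ⟨hk, N, hN⟩ := HypPair.exists_Sp P hP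
  obtain ⟨_, N', hN'⟩ := HypPair.exists_Sp Q hQ
  have key : ∀ x y z, N.1 *ᵥ x = y → N'.1 *ᵥ x = z → (N' * N⁻¹).1 *ᵥ y = z := by
    rintro x _ _ rfl rfl
    have : N' = (N' * N⁻¹) * N := by group
    conv_rhs => rw [this]
    rw [Matrix.mulVec_mulVec]
    rfl
  exact ⟨N' * N⁻¹, fun i => HypPair.ext
    (key _ _ _ (hN i).1 (hN' i).1) (key _ _ _ (hN i).2 (hN' i).2)⟩

/-- The isometry exchanging two orthogonal hyperbolic pairs with differences `d` and `k`. -/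
theorem exists_Sp_exchange {d k : Fin g ⊕ Fin g → A} (hdk : sform g A d k = 2) :
    ∃ σ : Sp g A, ∀ x, σ.1 *ᵥ x = x - sform g A x k • d + sform g A x d • k := by
  let L : (Fin g ⊕ Fin g → A) →ₗ[A] (Fin g ⊕ Fin g → A) :=
    LinearMap.id - ((sform g A).flip k).smulRight d + ((sform g A).flip d).smulRight k
  have hL : ∀ x, L x = x - sform g A x k • d + sform g A x d • k := fun x => rfl
  refine ⟨⟨LinearMap.toMatrix' L, ?_⟩, fun x => ?_⟩
  · rw [mem_Sp_iff_col]
    intro a b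
    have hcol : ∀ a, (LinearMap.toMatrix' L).col a = L (Pi.single a 1) := fun a => by
      rw [← Matrix.mulVec_single_one, LinearMap.toMatrix'_mulVec]
    rw [hcol, hcol, hL, hL]
    generalize (Pi.single a 1 : Fin g ⊕ Fin g → A) = x
    generalize (Pi.single b 1 : Fin g ⊕ Fin g → A) = y
    simp only [map_add, map_sub, map_smul, LinearMap.add_apply, LinearMap.sub_apply,
      LinearMap.smul_apply, smul_eq_mul, hdk, sform_isAlt d, sform_isAlt k, sform_swap k d,
      sform_swap d y, sform_swap k y]
    ring
  · rw [← hL, LinearMap.toMatrix'_mulVec]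

theorem HypPair.highlyTransitive [IsDedekindDomain A] (hg : 13 ≤ g) :
    HighlyTransitive (Sp g A) (HypPair g A) HypPair.adj where
  symm := HypPair.adj.symm
  smul M v w h := by
    refine ⟨⟨?_, ?_⟩, ?_, ?_⟩ <;>
      simp only [HypPair.smul_e, HypPair.smul_f, sform_mulVec M.2]
    exacts [h.1.1, h.1.2, h.2.1, h.2.2]
  nbr a b c d e f := by
    obtain ⟨x, y, h1, h⟩ := exists_hyperbolic_orthogonal (A := A) (g := g)
      [a.e, a.f, b.e, b.f, c.e, c.f, d.e, d.f, e.e, e.f, f.e, f.f]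
      (by simp; omega)
    refine ⟨⟨x, y, h1⟩, ?_⟩
    simp only [List.mem_cons, List.not_mem_nil, or_false, forall_eq_or_imp, forall_eq] at h
    simp only [HypPair.adj]
    tauto
  trans {a b c d v v'} hab hac had hbc hbd hcd hva hvb hvc hvd hva' hvb' hvc' hvd' := by
    obtain ⟨k, hk⟩ := HypPair.exists_smul_eq ![a, b, c, d, v] ![a, b, c, d, v'] (by
      intro i j hij
      fin_cases i <;> fin_cases j <;> first | exact absurd rfl hij | assumption |
        (apply HypPair.adj.symm; assumption)) (by
      intro i j hij
      fin_cases i <;> fin_cases j <;> first | exact absurd rfl hij | assumption |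
        (apply HypPair.adj.symm; assumption))
    exact ⟨k, hk 0, hk 1, hk 2, hk 3, hk 4⟩
  swap {v w} h := by
    obtain ⟨e, f, h1⟩ := v
    obtain ⟨e', f', h1'⟩ := w
    obtain ⟨⟨hee, hef⟩, hfe, hff⟩ := h
    dsimp only at h1 h1' hee hef hfe hff
    have s1 := sform_swap (R := A) f e
    have s2 := sform_swap (R := A) f' e'
    have s3 := sform_swap (R := A) e' e
    have s4 := sform_swap (R := A) f' e
    have s5 := sform_swap (R := A) e' f
    have s6 := sform_swap (R := A) f' f
    rw [h1] at s1
    rw [h1'] at s2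
    rw [hee, neg_zero] at s3
    rw [hef, neg_zero] at s4
    rw [hfe, neg_zero] at s5
    rw [hff, neg_zero] at s6
    have a1 := sform_isAlt (R := A) e
    have a2 := sform_isAlt (R := A) f
    have a3 := sform_isAlt (R := A) e'
    have a4 := sform_isAlt (R := A) f'
    obtain ⟨σ, hσ⟩ := exists_Sp_exchange (d := e - e') (k := f - f') (by
      simp only [map_sub, LinearMap.sub_apply, h1, hef, s5, h1']; norm_num)
    refine ⟨σ, ?_, ?_, ?_, ?_⟩
    · refine HypPair.ext ?_ ?_ <;> simp only [HypPair.smul_e, HypPair.smul_f, hσ] <;>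
      simp [h1, hef, hee, s1, hfe, hff, a1, a2]
    · refine HypPair.ext ?_ ?_ <;> simp only [HypPair.smul_e, HypPair.smul_f, hσ] <;>
      simp [h1', s2, s3, s4, s5, s6, a3, a4]
    · intro h hv hw
      have e1 : h.1 *ᵥ e = e := congrArg HypPair.e hv
      have e2 : h.1 *ᵥ f = f := congrArg HypPair.f hv
      have e3 : h.1 *ᵥ e' = e' := congrArg HypPair.e hw
      have e4 : h.1 *ᵥ f' = f' := congrArg HypPair.f hw
      have e5 : h.1 *ᵥ (e - e') = e - e' := by rw [Matrix.mulVec_sub, e1, e3]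
      have e6 : h.1 *ᵥ (f - f') = f - f' := by rw [Matrix.mulVec_sub, e2, e4]
      refine Subtype.ext (Matrix.mulVec_injective (funext fun x => ?_))
      show (σ.1 * h.1) *ᵥ x = (h.1 * σ.1) *ᵥ x
      rw [← Matrix.mulVec_mulVec, ← Matrix.mulVec_mulVec, hσ, hσ, Matrix.mulVec_add,
        Matrix.mulVec_sub, Matrix.mulVec_smul, Matrix.mulVec_smul, e5, e6]
      have e7 := sform_mulVec h.2 x (f - f')
      have e8 := sform_mulVec h.2 x (e - e')
      rw [e6] at e7
      rw [e5] at e8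
      rw [e7, e8]
    · rintro u ⟨⟨u1, u2⟩, u3, u4⟩ ⟨⟨v1, v2⟩, v3, v4⟩
      dsimp only at u1 u2 u3 u4 v1 v2 v3 v4
      refine HypPair.ext ?_ ?_ <;> simp only [HypPair.smul_e, HypPair.smul_f, hσ] <;>
      simp [u1, u2, u3, u4, v1, v2, v3, v4]

/-- Homological stability for the second homology of symplectic groups over Dedekind domains. -/
theorem H2Map_stabHom_surjective [IsDedekindDomain A] (hg : 12 ≤ g) :
    Function.Surjective (GpH2.H2Map (stabHom g A)) := by
  refine H2Map_surjective_of_split _ stabHom_injective ?_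
  intro E _ p hcen s₀ hs₀ hp
  let v₀ : HypPair (g + 1) A := ⟨glue 1 0 0, glue 0 1 0, by simp [sform_glue]⟩
  have hstab : ∀ h : Sp (g + 1) A, h • v₀ = v₀ → h ∈ (stabHom g A).range := by
    intro h hh
    have e1 : h.1 *ᵥ glue 1 0 0 = glue 1 0 0 := congrArg HypPair.e hh
    have e2 : h.1 *ᵥ glue 0 1 0 = glue 0 1 0 := congrArg HypPair.f hh
    refine mem_range_stabHom ?_ ?_
    · rwa [← Matrix.mulVec_single_one, single_inl_zero]
    · rwa [← Matrix.mulVec_single_one, single_inr_zero]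
  classical
  refine exists_section_of_stabilizer_section (HypPair.highlyTransitive (by omega)) p hp hcen v₀
    (fun h => if hh : h ∈ (stabHom g A).range then s₀ ⟨h, hh⟩ else 1) (fun h hh => ?_)
    (fun h h' hh hh' => ?_)
  · rw [dif_pos (hstab h hh)]
    exact hs₀ _
  · rw [dif_pos (hstab h hh), dif_pos (hstab h' hh'), dif_pos (mul_mem (hstab h hh) (hstab h' hh')),
      ← map_mul]
    rfl

end HyperbolicPairs

/-- A locally constant cocycle on an open cover of a contractible space by connected sets is a
coboundary. -/
theorem exists_primitive_of_cocycle {X : Type*} [TopologicalSpace X] [ContractibleSpace X]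
    {ι Q : Type*} [Group Q] (U : ι → Set X) (hU : ∀ i, IsOpen (U i))
    (hpre : ∀ i, IsPreconnected (U i)) (hcov : ∀ x, ∃ i, x ∈ U i) (θ : ι → ι → Q)
    (hθ : ∀ i j k x, x ∈ U i → x ∈ U j → x ∈ U k → θ i j * θ j k = θ i k) :
    ∃ s : ι → Q, ∀ i j x, x ∈ U i → x ∈ U j → s j = s i * θ i j := by
  classical
  letI : TopologicalSpace Q := ⊥
  have : DiscreteTopology Q := ⟨rfl⟩
  choose idx hidx using hcov
  let Z : FiberBundleCore ι X Q :=
    { baseSet := U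
      isOpen_baseSet := hU
      indexAt := idx
      mem_baseSet_at := hidx
      coordChange := fun i j _ q => q * θ i j
      coordChange_self := fun i x hx v => by
        have h := hθ i i i x hx hx hx
        have : θ i i = 1 := by simpa using h
        simp [this]
      continuousOn_coordChange := fun i j => by
        apply Continuous.continuousOn
        exact (continuous_of_discreteTopology (f := fun q : Q => q * θ i j)).comp continuous_snd
      coordChange_comp := fun i j k x hx v => by
        rw [mul_assoc, hθ i j k x hx.1.1 hx.1.2 hx.2] }
  have hc : IsCoveringMap Z.proj := by
    have : ∀ x, DiscreteTopology (Z.Fiber x) := fun x => ⟨rfl⟩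
    exact FiberBundle.isCoveringMap (F := Q) (E := Z.Fiber)
  obtain ⟨x₀, ⟨H⟩⟩ := id_nullhomotopic X
  let e₀ : Z.TotalSpace := ⟨x₀, (1 : Q)⟩
  let H' := H.symm
  let L := hc.liftHomotopy H'.toContinuousMap (ContinuousMap.const X e₀) (by
    intro a
    simp [e₀, H'])
  let e : X → Z.TotalSpace := fun x => L (1, x)
  have he : Continuous e := L.continuous.comp (Continuous.prodMk_right (1 : unitInterval))
  have hproj : ∀ x, (e x).1 = x := by
    intro x
    have := congrFun (hc.liftHomotopy_lifts H'.toContinuousMap (ContinuousMap.const X e₀) (by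
      intro a
      simp [e₀, H'])) (1, x)
    simpa [H'] using this
  have hconst : ∀ i x y, x ∈ U i → y ∈ U i → (Z.localTriv i (e x)).2 = (Z.localTriv i (e y)).2 := by
    intro i x y hx hy
    have hcont : ContinuousOn (fun x => (Z.localTriv i (e x)).2) (U i) := by
      refine continuous_snd.comp_continuousOn
        ((Z.localTriv i).continuousOn.comp he.continuousOn ?_)
      intro z hz
      rw [Bundle.Trivialization.mem_source]
      show (e z).1 ∈ U i
      rwa [hproj]
    exact (hpre i).constant hcont hx hy
  let s : ι → Q := fun i => if h : (U i).Nonempty then (Z.localTriv i (e h.some)).2 else 1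
  have hs : ∀ i x, x ∈ U i → s i = (Z.localTriv i (e x)).2 := by
    intro i x hx
    have h : (U i).Nonempty := ⟨x, hx⟩
    simp only [s, dif_pos h]
    exact hconst i _ _ h.some_mem hx
  refine ⟨s, fun i j x hi hj => ?_⟩
  rw [hs i x hi, hs j x hj]
  have h1 : ∀ k, (Z.localTriv k (e x)).2 = (show Q from (e x).2) * θ (idx (e x).1) k := fun k => rfl
  have hb : (e x).1 ∈ U (idx (e x).1) := hidx _
  rw [h1, h1, mul_assoc, hθ _ i j (e x).1 hb (by rwa [hproj]) (by rwa [hproj])]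

/-- A function on the index set of an open cover of a preconnected space by nonempty sets is
constant if it agrees on indices of intersecting members. -/
theorem eq_of_cover_of_preconnected {X : Type*} [TopologicalSpace X] [PreconnectedSpace X]
    {ι Q : Type*} (V : ι → Set X) (hV : ∀ i, IsOpen (V i)) (hne : ∀ i, (V i).Nonempty)
    (hcov : ∀ x, ∃ i, x ∈ V i) (f : ι → Q)
    (hf : ∀ i j x, x ∈ V i → x ∈ V j → f i = f j) (i j : ι) : f i = f j := by
  choose idx hidx using hcov
  have hloc : IsLocallyConstant (fun x => f (idx x)) := by
    rw [IsLocallyConstant.iff_exists_open]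
    intro x
    exact ⟨V (idx x), hV _, hidx x, fun y hy => hf _ _ y (hidx y) hy⟩
  obtain ⟨x, hx⟩ := hne i
  obtain ⟨y, hy⟩ := hne j
  have := hloc.apply_eq_of_preconnectedSpace x y
  rw [hf i (idx x) x hx (hidx x), this, hf j (idx y) y hy (hidx y)]

section Macbeath

variable {Γ X : Type*} [Group Γ] [TopologicalSpace X] [MulAction Γ X]

/-- The translate of `U` by `γ` meets `U`. -/
def IsNear (U : Set X) (γ : Γ) : Prop := ∃ x, x ∈ U ∧ γ⁻¹ • x ∈ U

omit [TopologicalSpace X] in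
theorem IsNear.of_mem {U : Set X} {γ δ : Γ} {x : X} (h : γ⁻¹ • x ∈ U) (h' : δ⁻¹ • x ∈ U) :
    IsNear U (γ⁻¹ * δ) :=
  ⟨γ⁻¹ • x, h, by simpa [smul_smul] using h'⟩

/-- Translates of an open set. -/
theorem isOpen_translate [ContinuousConstSMul Γ X] {U : Set X} (hU : IsOpen U) (γ : Γ) :
    IsOpen {x : X | γ • x ∈ U} := hU.preimage (continuous_const_smul γ)

theorem isPreconnected_translate [ContinuousConstSMul Γ X] {U : Set X} (hU : IsPreconnected U)
    (γ : Γ) : IsPreconnected {x : X | γ • x ∈ U} := by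
  have : {x : X | γ • x ∈ U} = (fun x => γ⁻¹ • x) '' U := by
    ext x
    constructor
    · intro h
      exact ⟨γ • x, h, by simp⟩
    · rintro ⟨y, hy, rfl⟩
      simpa using hy
  rw [this]
  exact hU.image _ (continuous_const_smul γ⁻¹).continuousOn

variable [ContractibleSpace X] [ContinuousConstSMul Γ X]

/-- A locally multiplicative map on the near elements of a subgroup determines a homomorphism. -/
theorem exists_hom_of_near {Q : Type*} [Group Q] (Γ₀ : Subgroup Γ) {U : Set X} (hU : IsOpen U)
    (hpre : IsPreconnected U) (hne : U.Nonempty) (hcov : ∀ x, ∃ α ∈ Γ₀, α⁻¹ • x ∈ U) (θ : Γ → Q)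
    (hθ : ∀ a b, a ∈ Γ₀ → b ∈ Γ₀ → IsNear U a → IsNear U b → IsNear U (a * b) →
      θ (a * b) = θ a * θ b) :
    ∃ θ₀ : Γ₀ →* Q, ∀ (γ δ : Γ₀) (x : X), (γ : Γ)⁻¹ • x ∈ U → (δ : Γ)⁻¹ • x ∈ U →
      θ₀ δ = θ₀ γ * θ ((γ : Γ)⁻¹ * δ) := by
  obtain ⟨s, hs⟩ := exists_primitive_of_cocycle (ι := Γ₀)
    (fun γ => {x : X | (γ : Γ)⁻¹ • x ∈ U}) (fun γ => isOpen_translate hU _)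
    (fun γ => isPreconnected_translate hpre _)
    (fun x => by
      obtain ⟨α, h, hx⟩ := hcov x
      exact ⟨⟨α, h⟩, hx⟩)
    (fun γ δ => θ ((γ : Γ)⁻¹ * δ)) (by
      intro i j k x hi hj hk
      have := hθ ((i : Γ)⁻¹ * j) ((j : Γ)⁻¹ * k) (Γ₀.mul_mem (Γ₀.inv_mem i.2) j.2)
        (Γ₀.mul_mem (Γ₀.inv_mem j.2) k.2) (IsNear.of_mem hi hj) (IsNear.of_mem hj hk)
        (by
          have e : (i : Γ)⁻¹ * j * ((j : Γ)⁻¹ * k) = (i : Γ)⁻¹ * k := by group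
          rw [e]
          exact IsNear.of_mem (U := U) hi hk)
      rw [← this]
      simp [mul_assoc])
  have hinv : ∀ γ δ δ' : Γ₀, s (γ * δ) * (s δ)⁻¹ = s (γ * δ') * (s δ')⁻¹ := by
    intro γ
    refine eq_of_cover_of_preconnected (fun δ : Γ₀ => {x : X | (δ : Γ)⁻¹ • x ∈ U})
      (fun δ => isOpen_translate hU _) (fun δ => ?_) (fun x => ?_)
      (fun δ => s (γ * δ) * (s δ)⁻¹) ?_
    · obtain ⟨x, hx⟩ := hne
      exact ⟨(δ : Γ) • x, by simpa using hx⟩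
    · obtain ⟨α, h, hx⟩ := hcov x
      exact ⟨⟨α, h⟩, hx⟩
    · intro i j x hi hj
      have h1 := hs i j x hi hj
      have h2 := hs (γ * i) (γ * j) ((γ : Γ) • x) (by simpa [smul_smul] using hi)
        (by simpa [smul_smul] using hj)
      show s (γ * i) * (s i)⁻¹ = s (γ * j) * (s j)⁻¹
      rw [h2, h1]
      simp [mul_assoc]
  refine ⟨MonoidHom.mk' (fun γ => (s 1)⁻¹ * s γ) ?_, ?_⟩
  · intro γ δ
    have := hinv γ δ 1
    rw [mul_inv_eq_iff_eq_mul] at this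
    rw [this]
    simp [mul_assoc]
  · intro γ δ x h h'
    simp [hs γ δ x h h', mul_assoc]

/-- Extension of a locally multiplicative map from the near elements of `E` to all of `E`. -/
theorem exists_extension_of_near {Q : Type*} [Group Q] (Γ₀ : Subgroup Γ) (E : Set Γ)
    (hE₀ : ∀ a ∈ Γ₀, a ∈ E)
    (hE : ∀ a b c, a ∈ Γ₀ → b ∈ E → c ∈ Γ₀ → a * b * c ∈ E)
    {U : Set X} (hU : IsOpen U)
    (hpre : IsPreconnected U) (hne : U.Nonempty) (hcov : ∀ x, ∃ α ∈ Γ₀, α⁻¹ • x ∈ U) (θ : Γ → Q)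
    (hθ : ∀ a b, a ∈ E → b ∈ E → a * b ∈ E → IsNear U a → IsNear U b → IsNear U (a * b) →
      θ (a * b) = θ a * θ b) :
    ∃ φ : Γ → Q, (∀ a b, a ∈ E → b ∈ E → a * b ∈ E → φ (a * b) = φ a * φ b) ∧
      ∀ a ∈ E, IsNear U a → φ a = θ a := by
  classical
  obtain ⟨θ₀, h₀⟩ := exists_hom_of_near Γ₀ hU hpre hne hcov θ
    (fun a b ha hb h1 h2 h3 => hθ a b (hE₀ _ ha) (hE₀ _ hb) (hE₀ _ (Γ₀.mul_mem ha hb)) h1 h2 h3)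
  have key : ∀ a ∈ E, ∃ q : Q, ∀ (α β : Γ₀) (x : X), (α : Γ)⁻¹ • x ∈ U →
      (a * β)⁻¹ • x ∈ U → q = θ₀ α * θ ((α : Γ)⁻¹ * a * β) * (θ₀ β)⁻¹ := by
    intro a ha
    let ι := {p : Γ₀ × Γ₀ // ∃ x : X, (p.1 : Γ)⁻¹ • x ∈ U ∧ (a * p.2)⁻¹ • x ∈ U}
    have hcov' : ∀ x : X, ∃ i : ι, x ∈ {x : X | (i.1.1 : Γ)⁻¹ • x ∈ U} ∩
        {x : X | (a * i.1.2)⁻¹ • x ∈ U} := by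
      intro x
      obtain ⟨α, h, hx⟩ := hcov x
      obtain ⟨β, h', hx'⟩ := hcov (a⁻¹ • x)
      have h2 : (a * β)⁻¹ • x ∈ U := by simpa [smul_smul] using hx'
      exact ⟨⟨(⟨α, h⟩, ⟨β, h'⟩), x, hx, h2⟩, hx, h2⟩
    have hconst : ∀ i j : ι, θ₀ i.1.1 * θ ((i.1.1 : Γ)⁻¹ * a * i.1.2) * (θ₀ i.1.2)⁻¹ =
        θ₀ j.1.1 * θ ((j.1.1 : Γ)⁻¹ * a * j.1.2) * (θ₀ j.1.2)⁻¹ := by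
      refine eq_of_cover_of_preconnected (ι := ι) (fun i => {x : X | (i.1.1 : Γ)⁻¹ • x ∈ U} ∩
        {x : X | (a * i.1.2)⁻¹ • x ∈ U}) (fun i => (isOpen_translate hU _).inter
          (isOpen_translate hU _)) (fun i => i.2) hcov'
        (fun i => θ₀ i.1.1 * θ ((i.1.1 : Γ)⁻¹ * a * i.1.2) * (θ₀ i.1.2)⁻¹) ?_
      rintro ⟨⟨α, β⟩, hi⟩ ⟨⟨α', β'⟩, hj⟩ x ⟨hx1, hx2⟩ ⟨hx1', hx2'⟩
      simp only [Set.mem_ofPred_eq] at hx1 hx2 hx1' hx2' ⊢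
      have e1 := h₀ α α' x hx1 hx1'
      have e2 := h₀ β β' (a⁻¹ • x) (by simpa [smul_smul] using hx2)
        (by simpa [smul_smul] using hx2')
      have mem : ∀ γ δ : Γ₀, (γ : Γ)⁻¹ * δ ∈ E := fun γ δ =>
        hE₀ _ (Γ₀.mul_mem (Γ₀.inv_mem γ.2) δ.2)
      have mem' : ∀ γ δ : Γ₀, (γ : Γ)⁻¹ * a * δ ∈ E := fun γ δ =>
        hE _ _ _ (Γ₀.inv_mem γ.2) ha δ.2
      have n1 : IsNear U ((α : Γ)⁻¹ * α') := IsNear.of_mem hx1 hx1'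
      have n2 : IsNear U ((α' : Γ)⁻¹ * a * β') := by
        simpa [mul_assoc] using IsNear.of_mem hx1' hx2'
      have n3 : IsNear U ((α : Γ)⁻¹ * a * β') := by
        simpa [mul_assoc] using IsNear.of_mem hx1 hx2'
      have n4 : IsNear U ((α : Γ)⁻¹ * a * β) := by
        simpa [mul_assoc] using IsNear.of_mem hx1 hx2
      have n5 : IsNear U ((β : Γ)⁻¹ * β') := by
        simpa [mul_assoc] using IsNear.of_mem hx2 hx2'
      have p1 : ((α : Γ)⁻¹ * α') * ((α' : Γ)⁻¹ * a * β') = (α : Γ)⁻¹ * a * β' := by group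
      have p2 : ((α : Γ)⁻¹ * a * β) * ((β : Γ)⁻¹ * β') = (α : Γ)⁻¹ * a * β' := by group
      have t1 := hθ ((α : Γ)⁻¹ * α') ((α' : Γ)⁻¹ * a * β') (mem _ _) (mem' _ _)
        (by rw [p1]; exact mem' _ _) n1 n2 (by rw [p1]; exact n3)
      have t2 := hθ ((α : Γ)⁻¹ * a * β) ((β : Γ)⁻¹ * β') (mem' _ _) (mem _ _)
        (by rw [p2]; exact mem' _ _) n4 n5 (by rw [p2]; exact n3)
      rw [p1] at t1
      rw [p2] at t2
      rw [e1, e2, mul_assoc (θ₀ α) _ (θ _), ← t1, t2]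
      simp [mul_assoc]
    obtain ⟨x, hx⟩ := hne
    obtain ⟨i, -⟩ := hcov' x
    refine ⟨θ₀ i.1.1 * θ ((i.1.1 : Γ)⁻¹ * a * i.1.2) * (θ₀ i.1.2)⁻¹, fun α β x h h' => ?_⟩
    exact hconst i ⟨(α, β), x, h, h'⟩
  choose! φ hφ using key
  refine ⟨φ, ?_, ?_⟩
  · intro a b ha hb hab
    obtain ⟨x, -⟩ := hne
    obtain ⟨α, hα, hxα⟩ := hcov x
    obtain ⟨β, hβ, hxβ⟩ := hcov (a⁻¹ • x)
    obtain ⟨δ, hδ, hxδ⟩ := hcov ((a * b)⁻¹ • x)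
    have hxβ' : (a * β)⁻¹ • x ∈ U := by simpa [smul_smul] using hxβ
    have hxδ' : (a * b * δ)⁻¹ • x ∈ U := by simpa [smul_smul, mul_assoc] using hxδ
    have e1 := hφ a ha ⟨α, hα⟩ ⟨β, hβ⟩ x hxα hxβ'
    have e2 := hφ (a * b) hab ⟨α, hα⟩ ⟨δ, hδ⟩ x hxα hxδ'
    have e3 := hφ b hb ⟨β, hβ⟩ ⟨δ, hδ⟩ (a⁻¹ • x) hxβ
      (by simpa [smul_smul, mul_assoc] using hxδ)
    have p : (α⁻¹ * a * β) * (β⁻¹ * b * δ) = α⁻¹ * (a * b) * δ := by group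
    have m := fun c (hc : c ∈ E) γ γ' (hγ : γ ∈ Γ₀) (hγ' : γ' ∈ Γ₀) =>
      hE γ⁻¹ c γ' (Γ₀.inv_mem hγ) hc hγ'
    have t := hθ (α⁻¹ * a * β) (β⁻¹ * b * δ) (m _ ha _ _ hα hβ) (m _ hb _ _ hβ hδ)
      (by rw [p]; exact m _ hab _ _ hα hδ)
      (by simpa [mul_assoc] using IsNear.of_mem hxα hxβ')
      (by simpa [mul_assoc] using IsNear.of_mem (γ := a * β) (δ := a * b * δ) hxβ' hxδ')
      (by rw [p]; simpa [mul_assoc] using IsNear.of_mem hxα hxδ')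
    rw [p] at t
    rw [e1, e2, e3]
    simp only at t ⊢
    rw [t]
    simp [mul_assoc]
  · rintro a ha ⟨x, hx, hx'⟩
    have := hφ a ha 1 1 x (by simpa using hx) (by simpa using hx')
    simpa using this

end Macbeath

section Filtration

variable {Γ : Type*} [Group Γ]

/-- A filtration of a group by sets, each of which can be reduced to the previous one by the
first term of the filtration. -/
structure GroupFiltration (E : ℕ → Set Γ) : Prop where
  one_mem : 1 ∈ E 0
  inv_mem : ∀ i, ∀ a ∈ E i, a⁻¹ ∈ E i
  mul_mem : ∀ i j, ∀ a ∈ E i, ∀ b ∈ E j, a * b ∈ E (i + j)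
  mono : Monotone E
  exhaust : ∀ a, ∃ i, a ∈ E i
  reduce : ∀ k, ∃ c : Γ → Γ, (∀ a ∈ E (k + 2), c a ∈ E (k + 1) ∧ (c a)⁻¹ * a ∈ E 1) ∧
    ∀ a ∈ E (k + 2), ∀ b ∈ E (k + 2), a⁻¹ * b ∈ E 1 → (c a)⁻¹ * c b ∈ E 1

variable {E : ℕ → Set Γ}

/-- The subgroup at the bottom of a filtration. -/
def GroupFiltration.base (hE : GroupFiltration E) : Subgroup Γ where
  carrier := E 0
  one_mem' := hE.one_mem
  mul_mem' ha hb := hE.mul_mem 0 0 _ ha _ hb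
  inv_mem' ha := hE.inv_mem 0 _ ha

/-- The first term of a filtration generates. -/
theorem GroupFiltration.eq_top (hE : GroupFiltration E) (P : Subgroup Γ) (hP : ∀ a ∈ E 1, a ∈ P) :
    P = ⊤ := by
  have : ∀ k, ∀ a ∈ E (k + 1), a ∈ P := by
    intro k
    induction k with
    | zero => exact hP
    | succ k ih =>
      intro a ha
      obtain ⟨c, hc, -⟩ := hE.reduce k
      have := P.mul_mem (ih _ (hc a ha).1) (hP _ (hc a ha).2)
      simpa using this
  refine eq_top_iff.2 fun a _ => ?_
  obtain ⟨i, hi⟩ := hE.exhaust a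
  exact this i a (hE.mono (Nat.le_succ i) hi)

/-- A map multiplicative on the second term of a filtration extends to a homomorphism. -/
theorem GroupFiltration.exists_hom (hE : GroupFiltration E) {Q : Type*} [Group Q] (φ : Γ → Q)
    (hφ : ∀ a b, a ∈ E 2 → b ∈ E 2 → a * b ∈ E 2 → φ (a * b) = φ a * φ b) :
    ∃ s : Γ →* Q, ∀ a ∈ E 2, s a = φ a := by
  choose c hc hc' using hE.reduce
  have m12 : ∀ a ∈ E 1, a ∈ E 2 := fun a ha => hE.mono (by norm_num) ha
  let s : ℕ → Γ → Q := fun k => Nat.rec φ (fun k f a => f (c k a) * φ ((c k a)⁻¹ * a)) k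
  have hs : ∀ k a, s (k + 1) a = s k (c k a) * φ ((c k a)⁻¹ * a) := fun k a => rfl
  have mul' : ∀ a b d : Γ, a⁻¹ * b ∈ E 1 → b⁻¹ * d ∈ E 1 →
      φ (a⁻¹ * d) = φ (a⁻¹ * b) * φ (b⁻¹ * d) := by
    intro a b d h h'
    have e : (a⁻¹ * b) * (b⁻¹ * d) = a⁻¹ * d := by group
    rw [← e]
    exact hφ _ _ (m12 _ h) (m12 _ h') (hE.mul_mem 1 1 _ h _ h')
  have inv : ∀ k, ∀ a ∈ E (k + 1), ∀ b ∈ E (k + 1), a⁻¹ * b ∈ E 1 →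
      s k b = s k a * φ (a⁻¹ * b) := by
    intro k
    induction k with
    | zero =>
      intro a ha b hb hab
      show φ b = φ a * φ (a⁻¹ * b)
      have := mul' 1 a b (by simpa using ha) hab
      simpa using this
    | succ k ih =>
      intro a ha b hb hab
      rw [hs, hs, ih _ (hc k a ha).1 _ (hc k b hb).1 (hc' k a ha b hb hab), mul_assoc, mul_assoc,
        ← mul' _ _ _ (hc' k a ha b hb hab) (hc k b hb).2, ← mul' _ _ _ (hc k a ha).2 hab]
  have stab : ∀ k, ∀ a ∈ E (k + 1), s (k + 1) a = s k a := by
    intro k a ha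
    have ha' : a ∈ E (k + 2) := hE.mono (Nat.le_succ _) ha
    rw [hs, ← inv k _ (hc k a ha').1 a ha (hc k a ha').2]
  have stab' : ∀ k j, ∀ a ∈ E (k + 1), s (k + j) a = s k a := by
    intro k j a ha
    induction j with
    | zero => rfl
    | succ j ih => rw [← add_assoc, stab (k + j) a (hE.mono (by omega) ha), ih]
  choose n hn using hE.exhaust
  have hn' : ∀ a k, a ∈ E (k + 1) → s (n a) a = s k a := by
    intro a k ha
    rw [← stab' k (n a) a ha, ← stab' (n a) k a (hE.mono (Nat.le_succ _) (hn a)), add_comm]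
  have φ1 : φ 1 = 1 := by
    have h1 : (1 : Γ) ∈ E 2 := hE.mono (Nat.zero_le _) hE.one_mem
    have := hφ 1 1 h1 h1 (by simpa using h1)
    simpa using this
  have onE1 : ∀ a ∈ E 1, s (n a) a = φ a := fun a ha => hn' a 0 ha
  have step : ∀ a b, b ∈ E 1 → s (n (a * b)) (a * b) = s (n a) a * s (n b) b := by
    intro a b hb
    have h1 : a ∈ E (n a + 1 + 1) := hE.mono (by omega) (hn a)
    have h2 : a * b ∈ E (n a + 1 + 1) := hE.mono (by omega) (hE.mul_mem _ _ a (hn a) b hb)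
    rw [hn' _ _ h2, hn' _ _ h1, onE1 b hb, inv _ a h1 (a * b) h2 (by simpa using hb)]
    simp
  let P : Subgroup Γ :=
    { carrier := {b | ∀ a, s (n (a * b)) (a * b) = s (n a) a * s (n b) b}
      one_mem' := by
        intro a
        exact step a 1 (hE.mono (Nat.zero_le _) hE.one_mem)
      mul_mem' := by
        intro b b' hb hb' a
        have h1 := hb' (a * b)
        have h2 := hb a
        have h3 := hb' b
        rw [← mul_assoc, h1, h2, h3, mul_assoc]
      inv_mem' := by
        intro b hb a
        have h1 := hb (a * b⁻¹)
        have h2 := hb b⁻¹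
        have h3 := onE1 1 (hE.mono (Nat.zero_le _) hE.one_mem)
        rw [φ1] at h3
        rw [inv_mul_cancel, h3] at h2
        rw [inv_mul_cancel_right] at h1
        rw [eq_comm, mul_eq_one_iff_eq_inv] at h2
        rw [h1, h2]
        simp }
  have hP : P = ⊤ := hE.eq_top P (fun b hb a => step a b hb)
  refine ⟨MonoidHom.mk' (fun a => s (n a) a) (fun a b => ?_), fun a ha => ?_⟩
  · have : b ∈ P := by rw [hP]; trivial
    exact this a
  · show s (n a) a = φ a
    rw [hn' a 1 ha]
    show φ (c 0 a) * φ ((c 0 a)⁻¹ * a) = φ a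
    have h := hc 0 a ha
    have := hφ (c 0 a) ((c 0 a)⁻¹ * a) (m12 _ h.1) (m12 _ h.2) (by simpa using ha)
    rw [← this]
    simp

end Filtration

/-- The near elements of the second term of a filtration generate the group and the partial
multiplication on them presents it. -/
theorem GroupFiltration.local_presentation {Γ X : Type*} [Group Γ] [TopologicalSpace X]
    [MulAction Γ X] [ContractibleSpace X] [ContinuousConstSMul Γ X] {E : ℕ → Set Γ}
    (hE : GroupFiltration E) {U : Set X} (hU : IsOpen U) (hpre : IsPreconnected U)
    (hne : U.Nonempty) (hcov : ∀ x, ∃ α ∈ E 0, α⁻¹ • x ∈ U) :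
    Subgroup.closure {γ | γ ∈ E 2 ∧ IsNear U γ} = ⊤ ∧
    ∀ (Q : Type*) [Group Q] (θ : Γ → Q),
      (∀ a b, a ∈ {γ | γ ∈ E 2 ∧ IsNear U γ} → b ∈ {γ | γ ∈ E 2 ∧ IsNear U γ} →
        a * b ∈ {γ | γ ∈ E 2 ∧ IsNear U γ} → θ (a * b) = θ a * θ b) →
      ∃ s : Γ →* Q, ∀ a ∈ {γ | γ ∈ E 2 ∧ IsNear U γ}, s a = θ a := by
  have m02 : ∀ a ∈ E 0, a ∈ E 2 := fun a ha => hE.mono (by norm_num) ha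
  have m12 : ∀ a ∈ E 1, a ∈ E 2 := fun a ha => hE.mono (by norm_num) ha
  constructor
  · set N := Subgroup.closure {γ | γ ∈ E 2 ∧ IsNear U γ} with hN
    have h0 : ∀ a ∈ E 0, a ∈ N := by
      have hc := eq_of_cover_of_preconnected (ι := hE.base)
        (fun δ => {x : X | (δ : Γ)⁻¹ • x ∈ U})
        (fun δ => isOpen_translate hU _) (fun δ => by
          obtain ⟨x, hx⟩ := hne
          exact ⟨(δ : Γ) • x, by simpa using hx⟩)
        (fun x => by
          obtain ⟨α, h, hx⟩ := hcov x
          exact ⟨⟨α, h⟩, hx⟩)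
        (fun δ => ((δ : Γ) : Γ ⧸ N)) (by
          intro i j x hi hj
          rw [QuotientGroup.eq]
          exact Subgroup.subset_closure ⟨m02 _ (hE.base.mul_mem (hE.base.inv_mem i.2) j.2),
            IsNear.of_mem hi hj⟩)
      intro a ha
      have := hc 1 ⟨a, ha⟩
      rw [QuotientGroup.eq] at this
      simpa using this
    refine hE.eq_top N fun a ha => ?_
    obtain ⟨x, hx⟩ := hne
    obtain ⟨β, hβ, hx'⟩ := hcov (a • x)
    have h1 : β⁻¹ * a ∈ N := Subgroup.subset_closure
      ⟨hE.mul_mem 0 2 _ (hE.inv_mem 0 _ hβ) _ (m12 a ha),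
        IsNear.of_mem hx' (δ := a) (by simpa using hx)⟩
    have := N.mul_mem (h0 β hβ) h1
    simpa using this
  · intro Q _ θ hθ
    obtain ⟨φ, hφ, hφ'⟩ := exists_extension_of_near hE.base (E 2) m02
      (fun a b c ha hb hc => by
        have := hE.mul_mem 2 0 _ (hE.mul_mem 0 2 a ha b hb) c hc
        simpa using this) hU hpre hne hcov θ
      (fun a b ha hb hab h1 h2 h3 => hθ a b ⟨ha, h1⟩ ⟨hb, h2⟩ ⟨hab, h3⟩)
    obtain ⟨s, hs⟩ := hE.exists_hom φ hφ
    exact ⟨s, fun a ha => by rw [hs a ha.1, hφ' a ha.1 ha.2]⟩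

section Heisenberg

variable {g : ℕ} {R : Type} [CommRing R]

/-- The standard complex structure on coordinate vectors. -/
def jvec (v : Fin g ⊕ Fin g → R) : Fin g ⊕ Fin g → R :=
  Sum.elim (fun i => - v (Sum.inr i)) (fun i => v (Sum.inl i))

theorem jvec_eq (v : Fin g ⊕ Fin g → R) : jvec v = Matrix.J (Fin g) R *ᵥ v := by
  rw [Matrix.J, Matrix.fromBlocks_mulVec]
  ext (i | i) <;> simp [jvec, Matrix.neg_mulVec]

theorem jvec_add (v w : Fin g ⊕ Fin g → R) : jvec (v + w) = jvec v + jvec w := by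
  ext (i | i) <;> simp [jvec]
  ring

theorem jvec_neg (v : Fin g ⊕ Fin g → R) : jvec (-v) = - jvec v := by
  ext (i | i) <;> simp [jvec]

theorem jvec_zero : jvec (0 : Fin g ⊕ Fin g → R) = 0 := by
  ext (i | i) <;> simp [jvec]

theorem jvec_dotProduct_self (v : Fin g ⊕ Fin g → R) : jvec v ⬝ᵥ v = 0 := by
  simp only [dotProduct, Fintype.sum_sum_type, jvec, Sum.elim_inl, Sum.elim_inr,
    ← Finset.sum_add_distrib]
  exact Finset.sum_eq_zero fun i _ => by ring

theorem sform_jvec (v x : Fin g ⊕ Fin g → R) : sform g R (jvec v) x = - (v ⬝ᵥ x) := by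
  simp only [sform_apply, dotProduct, Fintype.sum_sum_type, jvec, Sum.elim_inl, Sum.elim_inr,
    ← Finset.sum_add_distrib, ← Finset.sum_neg_distrib]
  exact Finset.sum_congr rfl fun i _ => by ring

/-- The Heisenberg group of unipotent symplectic matrices. -/
def xMat (v : Fin g ⊕ Fin g → R) (t : R) :
    Matrix (Fin (g + 1) ⊕ Fin (g + 1)) (Fin (g + 1) ⊕ Fin (g + 1)) R :=
  Matrix.of (glue (glue 1 t (jvec v)) (glue 0 1 0) fun m => glue 0 (v m) (Pi.single m 1))

@[simp] theorem xMat_inl (v : Fin g ⊕ Fin g → R) (t : R) :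
    xMat v t (Sum.inl 0) = glue 1 t (jvec v) := rfl
@[simp] theorem xMat_inr (v : Fin g ⊕ Fin g → R) (t : R) :
    xMat v t (Sum.inr 0) = glue 0 1 0 := rfl
@[simp] theorem xMat_idxSucc (v : Fin g ⊕ Fin g → R) (t : R) (m) :
    xMat v t (idxSucc m) = glue 0 (v m) (Pi.single m 1) := by
  rcases m with m | m <;> rfl

/-- The block matrix with two scalar entries and one symplectic block. -/
def extMat (p' p : R) (M : Matrix (Fin g ⊕ Fin g) (Fin g ⊕ Fin g) R) :
    Matrix (Fin (g + 1) ⊕ Fin (g + 1)) (Fin (g + 1) ⊕ Fin (g + 1)) R :=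
  Matrix.of (glue (glue p' 0 0) (glue 0 p 0) fun m => glue 0 0 (M m))

@[simp] theorem extMat_inl (p' p : R) (M : Matrix (Fin g ⊕ Fin g) (Fin g ⊕ Fin g) R) :
    extMat p' p M (Sum.inl 0) = glue p' 0 0 := rfl
@[simp] theorem extMat_inr (p' p : R) (M : Matrix (Fin g ⊕ Fin g) (Fin g ⊕ Fin g) R) :
    extMat p' p M (Sum.inr 0) = glue 0 p 0 := rfl
@[simp] theorem extMat_idxSucc (p' p : R) (M : Matrix (Fin g ⊕ Fin g) (Fin g ⊕ Fin g) R) (m) :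
    extMat p' p M (idxSucc m) = glue 0 0 (M m) := by
  rcases m with m | m <;> rfl

theorem embMat_eq_extMat (M : Matrix (Fin g ⊕ Fin g) (Fin g ⊕ Fin g) R) :
    embMat M = extMat 1 1 M := rfl

theorem xMat_mem (v : Fin g ⊕ Fin g → R) (t : R) : xMat v t ∈ Sp (g + 1) R := by
  rw [mem_Sp_iff_row]
  refine idx_cases ?_ ?_ fun m => ?_ <;> refine idx_cases ?_ ?_ fun n => ?_ <;>
    simp [single_inl_zero, single_inr_zero, single_idxSucc, sform_glue, sform_jvec,
      (sform_isAlt (g := g) (R := R)).self_eq_zero]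
  rw [← sform_isAlt.neg, sform_jvec]
  simp

theorem xMat_mul (v v' : Fin g ⊕ Fin g → R) (t t' : R) :
    xMat v t * xMat v' t' = xMat (v + v') (t + t' + jvec v ⬝ᵥ v') := by
  ext a b
  revert a b
  refine idx_cases ?_ ?_ fun m => ?_ <;> refine idx_cases ?_ ?_ fun n => ?_ <;>
    simp [-Fintype.sum_sum_type, Matrix.mul_apply, sum_idx, jvec_add, dotProduct,
      Pi.single_apply]
  all_goals ring

theorem xMat_zero : xMat (0 : Fin g ⊕ Fin g → R) 0 = 1 := by
  ext a b
  revert a b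
  refine idx_cases ?_ ?_ fun m => ?_ <;> refine idx_cases ?_ ?_ fun n => ?_ <;>
    simp [Matrix.one_apply, jvec_zero, Pi.single_apply, eq_comm]

theorem xMat_mul_neg (v : Fin g ⊕ Fin g → R) (t : R) : xMat v t * xMat (-v) (-t) = 1 := by
  rw [xMat_mul, dotProduct_neg, jvec_dotProduct_self]
  simp [xMat_zero]

theorem xMat_neg_mul (v : Fin g ⊕ Fin g → R) (t : R) : xMat (-v) (-t) * xMat v t = 1 := by
  simpa using xMat_mul_neg (-v) (-t)

theorem extMat_mul (p' p q' q : R) (M N : Matrix (Fin g ⊕ Fin g) (Fin g ⊕ Fin g) R) :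
    extMat p' p M * extMat q' q N = extMat (p' * q') (p * q) (M * N) := by
  ext a b
  revert a b
  refine idx_cases ?_ ?_ fun m => ?_ <;> refine idx_cases ?_ ?_ fun n => ?_ <;>
    simp [-Fintype.sum_sum_type, Matrix.mul_apply, sum_idx]

theorem extMat_mem {p' p : R} (hp : p' * p = 1)
    {M : Matrix (Fin g ⊕ Fin g) (Fin g ⊕ Fin g) R} :
    extMat p' p M ∈ Sp (g + 1) R ↔ M ∈ Sp g R := by
  have hp' : p * p' = 1 := by rw [mul_comm, hp]
  rw [mem_Sp_iff_row, mem_Sp_iff_row]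
  constructor
  · intro h a b
    have := h (idxSucc a) (idxSucc b)
    simpa [sform_glue, single_idxSucc] using this
  · intro h
    refine idx_cases ?_ ?_ fun m => ?_ <;> refine idx_cases ?_ ?_ fun n => ?_ <;>
      simp [single_inl_zero, single_inr_zero, single_idxSucc, sform_glue, hp, hp', h]

/-- Conjugating a unipotent by a block matrix. -/
theorem embMat_mul_xMat {M : Matrix (Fin g ⊕ Fin g) (Fin g ⊕ Fin g) R} (hM : M ∈ Sp g R)
    (v : Fin g ⊕ Fin g → R) (t : R) : embMat M * xMat v t = xMat (M *ᵥ v) t * embMat M := by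
  have key : jvec (M *ᵥ v) ᵥ* M = jvec v := by
    rw [jvec_eq, jvec_eq, ← Matrix.mulVec_transpose, Matrix.mulVec_mulVec, Matrix.mulVec_mulVec,
      SymplecticGroup.mem_iff'.1 hM]
  ext a b
  revert a b
  refine idx_cases ?_ ?_ fun m => ?_ <;> refine idx_cases ?_ ?_ fun n => ?_ <;>
    simp [-Fintype.sum_sum_type, Matrix.mul_apply, sum_idx, Pi.single_apply]
  · exact (congrFun key n).symm
  · rfl

variable [StarRing R]

theorem xMat_conj_entries (v : Fin g ⊕ Fin g → R) (t p' p : R)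
    (M : Matrix (Fin g ⊕ Fin g) (Fin g ⊕ Fin g) R) :
    (xMat v t * extMat p' p M * (xMat v t)ᴴ) (Sum.inr 0) (Sum.inr 0) = p ∧
    (xMat v t * extMat p' p M * (xMat v t)ᴴ) (Sum.inl 0) (Sum.inr 0) = t * p ∧
    ∀ m, (xMat v t * extMat p' p M * (xMat v t)ᴴ) (idxSucc m) (Sum.inr 0) = v m * p := by
  refine ⟨?_, ?_, fun m => ?_⟩ <;>
    simp [-Fintype.sum_sum_type, Matrix.mul_apply, sum_idx]

theorem xMat_neg_conj_col
    {h : Matrix (Fin (g + 1) ⊕ Fin (g + 1)) (Fin (g + 1) ⊕ Fin (g + 1)) R}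
    {v : Fin g ⊕ Fin g → R} {t p : R} (h1 : h (Sum.inr 0) (Sum.inr 0) = p)
    (h2 : h (Sum.inl 0) (Sum.inr 0) = t * p) (h3 : ∀ m, h (idxSucc m) (Sum.inr 0) = v m * p) :
    ∀ a, (xMat (-v) (-t) * h * (xMat (-v) (-t))ᴴ) a (Sum.inr 0) =
      (glue 0 p 0 : Fin (g + 1) ⊕ Fin (g + 1) → R) a := by
  have hj : ∑ m, jvec v m * (v m * p) = 0 := by
    have := jvec_dotProduct_self v
    rw [dotProduct] at this
    simp only [← mul_assoc, ← Finset.sum_mul, this, zero_mul]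
  refine idx_cases ?_ ?_ fun m => ?_ <;>
    simp [-Fintype.sum_sum_type, Matrix.mul_apply, sum_idx, h1, h2, h3, jvec_neg, hj,
      Pi.single_apply]

/-- A hermitian symplectic matrix with a scalar column has block form. -/
theorem eq_extMat_of_col {h : Matrix (Fin (g + 1) ⊕ Fin (g + 1)) (Fin (g + 1) ⊕ Fin (g + 1)) R}
    (hh : hᴴ = h) (hS : h ∈ Sp (g + 1) R) {p p' : R} (hp : p' * p = 1)
    (hcol : ∀ a, h a (Sum.inr 0) = (glue 0 p 0 : Fin (g + 1) ⊕ Fin (g + 1) → R) a) :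
    h = extMat p' p (h.submatrix idxSucc idxSucc) := by
  have hst : ∀ a b, star (h a b) = h b a := fun a b => by
    conv_rhs => rw [← hh]
    rfl
  have hpp : star p = p := by simpa [hcol] using hst (Sum.inr 0) (Sum.inr 0)
  have hrow : h (Sum.inr 0) = glue 0 p 0 := by
    refine glue_ext ?_ ?_ fun m => ?_ <;> rw [← hst, hcol] <;> simp [hpp]
  have hdec : ∀ a, h a = glue (h a (Sum.inl 0)) (h a (Sum.inr 0)) fun n => h a (idxSucc n) :=
    fun a => glue_ext rfl rfl fun n => by simp
  have hR := mem_Sp_iff_row.1 hS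
  have hz : ∀ a, h a (Sum.inl 0) * p = sform (g + 1) R (h a) (h (Sum.inr 0)) := by
    intro a
    rw [hrow, hdec a, sform_glue]
    simp
  have hu : ∀ x : R, x = x * p * p' := fun x => by rw [mul_assoc, mul_comm p, hp, mul_one]
  have he : ∀ a, h a (Sum.inl 0) = (glue p' 0 0 : Fin (g + 1) ⊕ Fin (g + 1) → R) a := by
    refine idx_cases ?_ ?_ fun m => ?_ <;> rw [hu (h _ _), hz, hR] <;>
      simp [single_inl_zero, single_inr_zero, single_idxSucc, sform_glue]
  ext a b
  revert a b
  refine idx_cases ?_ ?_ fun m => ?_ <;> refine idx_cases ?_ ?_ fun n => ?_ <;>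
    simp [hrow, hcol, he]
  rw [← hst, he]
  simp

end Heisenberg

section Siegel

variable {g : ℕ} {W : Type}

/-- The real algebra of complex-valued functions that are real on `T`. -/
def realAlg (T : Set W) : Subalgebra ℝ (W → ℂ) where
  carrier := {x | ∀ w ∈ T, (x w).im = 0}
  mul_mem' := fun {x y} hx hy w hw => by
    have h1 := hx w hw
    have h2 := hy w hw
    simp [Complex.mul_im, h1, h2]
  add_mem' := fun {x y} hx hy w hw => by
    have h1 := hx w hw
    have h2 := hy w hw
    simp [h1, h2]
  algebraMap_mem' := fun r w _ => by simp

theorem mem_realAlg {T : Set W} {x : W → ℂ} : x ∈ realAlg T ↔ ∀ w ∈ T, (x w).im = 0 := Iff.rfl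

theorem star_mem_realAlg {T : Set W} {x : W → ℂ} (hx : x ∈ realAlg T) : star x ∈ realAlg T := by
  intro w hw
  simp [hx w hw]

theorem ofReal_mem_realAlg (T : Set W) (p : W → ℝ) : (fun w => (p w : ℂ)) ∈ realAlg T := by
  intro w _
  simp

/-- The value at `w` of the hermitian form of a matrix of functions. -/
def qform {ι : Type} [Fintype ι] (h : Matrix ι ι (W → ℂ)) (w : W) (x : ι → ℂ) : ℝ :=
  (x ⬝ᵥ (h.map (Pi.evalRingHom _ w) *ᵥ star x)).re

theorem qform_conj {ι : Type} [Fintype ι] (c h : Matrix ι ι (W → ℂ)) (w : W) (x : ι → ℂ) :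
    qform (c * h * cᴴ) w x = qform h w (x ᵥ* c.map (Pi.evalRingHom _ w)) := by
  have h1 : (cᴴ).map (Pi.evalRingHom (fun _ : W => ℂ) w) = (c.map (Pi.evalRingHom _ w))ᴴ := rfl
  rw [qform, qform, Matrix.map_mul, Matrix.map_mul, h1, ← Matrix.mulVec_mulVec,
    ← Matrix.mulVec_mulVec, Matrix.dotProduct_mulVec, Matrix.star_vecMul]

theorem dotProduct_star_re {ι : Type} [Fintype ι] (x : ι → ℂ) :
    (x ⬝ᵥ star x).re = ∑ i, ‖x i‖ ^ 2 := by
  simp only [dotProduct, Complex.re_sum]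
  refine Finset.sum_congr rfl fun i _ => ?_
  have := Complex.mul_conj (x i)
  rw [Pi.star_apply, ← starRingEnd_apply, this, Complex.ofReal_re, Complex.normSq_eq_norm_sq]

theorem qform_eq_sum {ι : Type} [Fintype ι] (h : Matrix ι ι (W → ℂ)) (w : W) (x : ι → ℂ) :
    qform h w x = ∑ a, ∑ b, (x a * h a b w * star (x b)).re := by
  simp only [qform, dotProduct, Matrix.mulVec, Matrix.map_apply, Finset.mul_sum, Complex.re_sum,
    Pi.star_apply, Pi.evalRingHom_apply, mul_assoc]

/-- The points of the symmetric space: symplectic positive hermitian matrices, real on `T`. -/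
structure IsSiegel (T : Set W) (h : Matrix (Fin g ⊕ Fin g) (Fin g ⊕ Fin g) (W → ℂ)) : Prop where
  symp : h ∈ Sp g (W → ℂ)
  herm : hᴴ = h
  pos : ∀ w x, x ≠ 0 → 0 < qform h w x
  real : ∀ i j, h i j ∈ realAlg T

variable {T : Set W}

theorem conjTranspose_mem {R : Type} [CommRing R] [StarRing R]
    {c : Matrix (Fin g ⊕ Fin g) (Fin g ⊕ Fin g) R} (hc : c ∈ Sp g R) : cᴴ ∈ Sp g R := by
  have h1 := SpAux.map_mem (starRingEnd R) hc
  exact SymplecticGroup.transpose_mem h1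

theorem mul_mem_realAlg {ι κ μ : Type} [Fintype κ] {a : Matrix ι κ (W → ℂ)} {b : Matrix κ μ (W → ℂ)}
    (ha : ∀ i j, a i j ∈ realAlg T) (hb : ∀ i j, b i j ∈ realAlg T) (i j) :
    (a * b) i j ∈ realAlg T := by
  rw [Matrix.mul_apply]
  exact sum_mem fun k _ => mul_mem (ha i k) (hb k j)

theorem IsSiegel.conj {h c : Matrix (Fin g ⊕ Fin g) (Fin g ⊕ Fin g) (W → ℂ)} (hh : IsSiegel T h)
    (hc : c ∈ Sp g (W → ℂ)) (hcr : ∀ i j, c i j ∈ realAlg T) : IsSiegel T (c * h * cᴴ) where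
  symp := mul_mem (mul_mem hc hh.symp) (conjTranspose_mem hc)
  herm := by
    simp only [Matrix.conjTranspose_mul, Matrix.conjTranspose_conjTranspose, hh.herm,
      Matrix.mul_assoc]
  pos := fun w x hx => by
    rw [qform_conj]
    refine hh.pos w _ fun h0 => hx ?_
    have h1 := SpAux.map_mem (Pi.evalRingHom (fun _ : W => ℂ) w) hc
    have hu := SymplecticGroup.symplectic_det h1
    have hu' : IsUnit (c.map (Pi.evalRingHom (fun _ : W => ℂ) w)) :=
      (Matrix.isUnit_iff_isUnit_det _).2 hu
    exact Matrix.vecMul_injective_of_isUnit hu' (h0.trans (Matrix.zero_vecMul _).symm)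
  real := mul_mem_realAlg (mul_mem_realAlg hcr hh.real) fun i j => star_mem_realAlg (hcr j i)

theorem IsSiegel.one : IsSiegel T (1 : Matrix (Fin g ⊕ Fin g) (Fin g ⊕ Fin g) (W → ℂ)) where
  symp := one_mem _
  herm := Matrix.conjTranspose_one
  pos := fun w x hx => by
    have h1 : (1 : Matrix (Fin g ⊕ Fin g) (Fin g ⊕ Fin g) (W → ℂ)).map
      (Pi.evalRingHom (fun _ : W => ℂ) w) = 1 := Matrix.map_one _ (map_zero _) (map_one _)
    rw [qform, h1, Matrix.one_mulVec, dotProduct_star_re]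
    obtain ⟨i, hi⟩ := Function.ne_iff.1 hx
    exact Finset.sum_pos' (fun _ _ => by positivity) ⟨i, Finset.mem_univ i, by
      have : 0 < ‖x i‖ := norm_pos_iff.2 hi
      positivity⟩
  real := fun i j => by
    rw [Matrix.one_apply]
    split_ifs
    · exact one_mem _
    · exact zero_mem _

theorem re_mul_ofReal_mul_star (x : ℂ) (p : ℝ) : (x * (p : ℂ) * star x).re = p * ‖x‖ ^ 2 := by
  have := Complex.mul_conj x
  have h : x * (p : ℂ) * star x = ((p * Complex.normSq x : ℝ) : ℂ) := by
    rw [Complex.ofReal_mul, ← this, starRingEnd_apply]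
    ring
  rw [h, Complex.ofReal_re, Complex.normSq_eq_norm_sq]

theorem qform_extMat (p' p : W → ℝ) (h : Matrix (Fin g ⊕ Fin g) (Fin g ⊕ Fin g) (W → ℂ)) (w : W)
    (x y : ℂ) (v : Fin g ⊕ Fin g → ℂ) :
    qform (extMat (fun w => (p' w : ℂ)) (fun w => (p w : ℂ)) h) w (glue x y v) =
      p' w * ‖x‖ ^ 2 + p w * ‖y‖ ^ 2 + qform h w v := by
  rw [qform_eq_sum, qform_eq_sum, ← re_mul_ofReal_mul_star x, ← re_mul_ofReal_mul_star y]
  simp [-Fintype.sum_sum_type, sum_idx]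

theorem glue_surj {α : Type} (x : Fin (g + 1) ⊕ Fin (g + 1) → α) :
    glue (x (Sum.inl 0)) (x (Sum.inr 0)) (fun m => x (idxSucc m)) = x :=
  glue_ext rfl rfl fun m => by simp

theorem glue_eq_zero {x y : ℂ} {v : Fin g ⊕ Fin g → ℂ} :
    glue x y v = 0 ↔ x = 0 ∧ y = 0 ∧ v = 0 := by
  constructor
  · intro h
    refine ⟨congrFun h (Sum.inl 0), congrFun h (Sum.inr 0), funext fun m => ?_⟩
    simpa using congrFun h (idxSucc m)
  · rintro ⟨rfl, rfl, rfl⟩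
    exact glue_ext rfl rfl fun m => by simp

/-- The block matrix attached to a positive scalar. -/
def posExt (p : W → ℝ) (h : Matrix (Fin g ⊕ Fin g) (Fin g ⊕ Fin g) (W → ℂ)) :
    Matrix (Fin (g + 1) ⊕ Fin (g + 1)) (Fin (g + 1) ⊕ Fin (g + 1)) (W → ℂ) :=
  extMat (fun w => (((p w)⁻¹ : ℝ) : ℂ)) (fun w => (p w : ℂ)) h

theorem posExt_mul {p : W → ℝ} (hp : ∀ w, 0 < p w) :
    (fun w => (((p w)⁻¹ : ℝ) : ℂ)) * (fun w => (p w : ℂ)) = 1 := by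
  funext w
  simp only [Pi.mul_apply, Pi.one_apply, ← Complex.ofReal_mul, inv_mul_cancel₀ (hp w).ne',
    Complex.ofReal_one]

theorem qform_posExt (p : W → ℝ) (h : Matrix (Fin g ⊕ Fin g) (Fin g ⊕ Fin g) (W → ℂ)) (w : W)
    (x y : ℂ) (v : Fin g ⊕ Fin g → ℂ) : qform (posExt p h) w (glue x y v) =
      (p w)⁻¹ * ‖x‖ ^ 2 + p w * ‖y‖ ^ 2 + qform h w v := qform_extMat _ _ _ _ _ _ _

theorem qform_zero {ι : Type} [Fintype ι] (h : Matrix ι ι (W → ℂ)) (w : W) :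
    qform h w 0 = 0 := by
  simp [qform]

theorem isSiegel_posExt {p : W → ℝ} (hp : ∀ w, 0 < p w)
    {h : Matrix (Fin g ⊕ Fin g) (Fin g ⊕ Fin g) (W → ℂ)} :
    IsSiegel T (posExt p h) ↔ IsSiegel T h := by
  constructor
  · intro H
    refine ⟨(extMat_mem (posExt_mul hp)).1 H.symp, ?_, fun w x hx => ?_, fun i j => ?_⟩
    · ext i j w
      have := congrFun (congrFun (congrFun H.herm (idxSucc i)) (idxSucc j)) w
      simpa [posExt] using this
    · have := H.pos w (glue 0 0 x) (by simp [glue_eq_zero, hx])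
      rw [qform_posExt] at this
      simpa using this
    · have := H.real (idxSucc i) (idxSucc j)
      simpa [posExt] using this
  · intro H
    refine ⟨(extMat_mem (posExt_mul hp)).2 H.symp, ?_, fun w x hx => ?_, ?_⟩
    · ext a b w
      revert a b
      refine idx_cases ?_ ?_ fun m => ?_ <;> refine idx_cases ?_ ?_ fun n => ?_ <;>
        simp [posExt]
      exact congrFun (congrFun (congrFun H.herm m) n) w
    · rw [← glue_surj x] at hx ⊢
      rw [qform_posExt]
      rw [Ne, glue_eq_zero] at hx
      have hpw := hp w
      have hnn : 0 ≤ qform h w (fun m => x (idxSucc m)) := by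
        by_cases h0 : (fun m => x (idxSucc m)) = 0
        · rw [h0, qform_zero]
        · exact (H.pos w _ h0).le
      by_cases h1 : x (Sum.inl 0) = 0
      · by_cases h2 : x (Sum.inr 0) = 0
        · have := H.pos w _ (fun h3 => hx ⟨h1, h2, h3⟩)
          positivity
        · have : 0 < ‖x (Sum.inr 0)‖ := norm_pos_iff.2 h2
          positivity
      · have : 0 < ‖x (Sum.inl 0)‖ := norm_pos_iff.2 h1
        positivity
    · refine idx_cases ?_ ?_ fun m => ?_ <;> refine idx_cases ?_ ?_ fun n => ?_ <;>
        simp only [posExt, extMat_inl, extMat_inr, extMat_idxSucc, glue_inl, glue_inr,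
          glue_idxSucc]
      all_goals first
        | exact ofReal_mem_realAlg T _
        | exact H.real _ _

theorem xMat_mem_realAlg {v : Fin g ⊕ Fin g → W → ℂ} {t : W → ℂ} (hv : ∀ m, v m ∈ realAlg T)
    (ht : t ∈ realAlg T) : ∀ a b, xMat v t a b ∈ realAlg T := by
  have hj : ∀ m, jvec v m ∈ realAlg T := by
    rintro (i | i)
    · exact neg_mem (hv _)
    · exact hv _
  refine idx_cases ?_ ?_ fun m => ?_ <;> refine idx_cases ?_ ?_ fun n => ?_ <;>
    simp only [xMat_inl, xMat_inr, xMat_idxSucc, glue_inl, glue_inr, glue_idxSucc]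
  all_goals first
    | exact hv _
    | exact hj _
    | exact ht
    | exact zero_mem _
    | exact one_mem _
    | skip
  rw [Pi.single_apply]
  split_ifs
  · exact one_mem _
  · exact zero_mem _

/-- The point with given horospherical coordinates. -/
def horo (v : Fin g ⊕ Fin g → W → ℂ) (t : W → ℂ) (p : W → ℝ)
    (h : Matrix (Fin g ⊕ Fin g) (Fin g ⊕ Fin g) (W → ℂ)) :
    Matrix (Fin (g + 1) ⊕ Fin (g + 1)) (Fin (g + 1) ⊕ Fin (g + 1)) (W → ℂ) :=
  xMat v t * posExt p h * (xMat v t)ᴴ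

theorem isSiegel_horo {v : Fin g ⊕ Fin g → W → ℂ} {t : W → ℂ} {p : W → ℝ} (hp : ∀ w, 0 < p w)
    (hv : ∀ m, v m ∈ realAlg T) (ht : t ∈ realAlg T)
    {h : Matrix (Fin g ⊕ Fin g) (Fin g ⊕ Fin g) (W → ℂ)} (hh : IsSiegel T h) :
    IsSiegel T (horo v t p h) :=
  ((isSiegel_posExt hp).2 hh).conj (xMat_mem v t) (xMat_mem_realAlg hv ht)

section Coordinates

variable (h : Matrix (Fin (g + 1) ⊕ Fin (g + 1)) (Fin (g + 1) ⊕ Fin (g + 1)) (W → ℂ))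

/-- The height coordinate. -/
def coordP (w : W) : ℝ := (h (Sum.inr 0) (Sum.inr 0) w).re

/-- The linear unipotent coordinate. -/
def coordV (m : Fin g ⊕ Fin g) : W → ℂ :=
  h (idxSucc m) (Sum.inr 0) * fun w => (((coordP h w)⁻¹ : ℝ) : ℂ)

/-- The central unipotent coordinate. -/
def coordT : W → ℂ := h (Sum.inl 0) (Sum.inr 0) * fun w => (((coordP h w)⁻¹ : ℝ) : ℂ)

/-- The symmetric space coordinate of smaller rank. -/
def coordH : Matrix (Fin g ⊕ Fin g) (Fin g ⊕ Fin g) (W → ℂ) :=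
  (xMat (-coordV h) (-coordT h) * h * (xMat (-coordV h) (-coordT h))ᴴ).submatrix idxSucc idxSucc

end Coordinates

theorem coord_horo {v : Fin g ⊕ Fin g → W → ℂ} {t : W → ℂ} {p : W → ℝ} (hp : ∀ w, 0 < p w)
    {h : Matrix (Fin g ⊕ Fin g) (Fin g ⊕ Fin g) (W → ℂ)} :
    coordV (horo v t p h) = v ∧ coordT (horo v t p h) = t ∧ coordP (horo v t p h) = p ∧
      coordH (horo v t p h) = h := by
  obtain ⟨h1, h2, h3⟩ := xMat_conj_entries v t (fun w => (((p w)⁻¹ : ℝ) : ℂ))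
    (fun w => (p w : ℂ)) h
  have hP : coordP (horo v t p h) = p := by
    funext w
    have := congrFun h1 w
    simp only [coordP, horo, posExt, this, Complex.ofReal_re]
  have hp' : ∀ w, (p w : ℂ) ≠ 0 := fun w => Complex.ofReal_ne_zero.2 (hp w).ne'
  have hV : coordV (horo v t p h) = v := by
    funext m w
    have := congrFun (h3 m) w
    simp only [coordV, hP, Pi.mul_apply]
    rw [horo, posExt, this, Pi.mul_apply, Complex.ofReal_inv, mul_inv_cancel_right₀ (hp' w)]
  have hT : coordT (horo v t p h) = t := by
    funext w
    have := congrFun h2 w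
    simp only [coordT, hP, Pi.mul_apply]
    rw [horo, posExt, this, Pi.mul_apply, Complex.ofReal_inv, mul_inv_cancel_right₀ (hp' w)]
  refine ⟨hV, hT, hP, ?_⟩
  have e : xMat (-v) (-t) * horo v t p h * (xMat (-v) (-t))ᴴ = posExt p h := by
    have h4 := xMat_neg_mul v t
    have h5 : (xMat v t)ᴴ * (xMat (-v) (-t))ᴴ = 1 := by
      rw [← Matrix.conjTranspose_mul, h4, Matrix.conjTranspose_one]
    calc _ = (xMat (-v) (-t) * xMat v t) * posExt p h * ((xMat v t)ᴴ * (xMat (-v) (-t))ᴴ) := by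
          simp only [horo, Matrix.mul_assoc]
      _ = _ := by rw [h4, h5, Matrix.one_mul, Matrix.mul_one]
  rw [coordH, hV, hT, e]
  ext i j
  simp [posExt]

theorem IsSiegel.coord {h : Matrix (Fin (g + 1) ⊕ Fin (g + 1)) (Fin (g + 1) ⊕ Fin (g + 1)) (W → ℂ)}
    (hh : IsSiegel T h) : (∀ w, 0 < coordP h w) ∧ (∀ m, coordV h m ∈ realAlg T) ∧
      coordT h ∈ realAlg T ∧ IsSiegel T (coordH h) ∧
      horo (coordV h) (coordT h) (coordP h) (coordH h) = h := by
  have hP : h (Sum.inr 0) (Sum.inr 0) = fun w => (coordP h w : ℂ) := by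
    funext w
    refine Complex.ext rfl ?_
    have := congrFun (congrFun (congrFun hh.herm (Sum.inr 0)) (Sum.inr 0)) w
    have := congrArg Complex.im this
    simp at this
    simp
    linarith
  have hpos : ∀ w, 0 < coordP h w := by
    intro w
    have := hh.pos w (glue 0 1 0) (by simp [glue_eq_zero])
    rw [qform_eq_sum] at this
    simpa [-Fintype.sum_sum_type, sum_idx, coordP] using this
  have hv : ∀ m, coordV h m ∈ realAlg T := fun m =>
    mul_mem (hh.real _ _) (ofReal_mem_realAlg T _)
  have ht : coordT h ∈ realAlg T := mul_mem (hh.real _ _) (ofReal_mem_realAlg T _)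
  have hne : ∀ w, (coordP h w : ℂ) ≠ 0 := fun w => Complex.ofReal_ne_zero.2 (hpos w).ne'
  have hv' : ∀ m, h (idxSucc m) (Sum.inr 0) = coordV h m * fun w => (coordP h w : ℂ) := by
    intro m
    funext w
    simp [coordV, hne w]
  have ht' : h (Sum.inl 0) (Sum.inr 0) = coordT h * fun w => (coordP h w : ℂ) := by
    funext w
    simp [coordT, hne w]
  have hvn : ∀ m, (-coordV h) m ∈ realAlg T := fun m => neg_mem (hv m)
  have hconj := hh.conj (xMat_mem (-coordV h) (-coordT h)) (xMat_mem_realAlg hvn (neg_mem ht))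
  have hcol := xMat_neg_conj_col hP ht' hv'
  have hext := eq_extMat_of_col hconj.herm hconj.symp (posExt_mul hpos) hcol
  change _ = posExt (coordP h) (coordH h) at hext
  refine ⟨hpos, hv, ht, (isSiegel_posExt hpos).1 (hext ▸ hconj), ?_⟩
  have h4 := xMat_mul_neg (coordV h) (coordT h)
  have h5 : (xMat (-coordV h) (-coordT h))ᴴ * (xMat (coordV h) (coordT h))ᴴ = 1 := by
    rw [← Matrix.conjTranspose_mul, h4, Matrix.conjTranspose_one]
  rw [horo, ← hext]
  calc _ = (xMat (coordV h) (coordT h) * xMat (-coordV h) (-coordT h)) * h *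
        ((xMat (-coordV h) (-coordT h))ᴴ * (xMat (coordV h) (coordT h))ᴴ) := by
        simp only [Matrix.mul_assoc]
    _ = _ := by rw [h4, h5, Matrix.one_mul, Matrix.mul_one]

end Siegel

section SiegelTop

variable {g : ℕ} {W : Type} {T : Set W}

/-- The symmetric space of the symplectic group over a product of copies of `ℝ` and `ℂ`. -/
abbrev SiegelSpace (T : Set W) (g : ℕ) :=
  {h : Matrix (Fin g ⊕ Fin g) (Fin g ⊕ Fin g) (W → ℂ) // IsSiegel T h}

/-- The first height of a point, with the convention `1` in rank zero. -/
def topP : ∀ {g : ℕ}, Matrix (Fin g ⊕ Fin g) (Fin g ⊕ Fin g) (W → ℂ) → W → ℝ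
  | 0, _ => 1
  | _ + 1, h => coordP h

theorem topP_pos : ∀ {g : ℕ} {h : Matrix (Fin g ⊕ Fin g) (Fin g ⊕ Fin g) (W → ℂ)},
    IsSiegel T h → ∀ w, 0 < topP h w
  | 0, _, _, _ => one_pos
  | _ + 1, _, hh, w => hh.coord.1 w

theorem continuous_coordP : Continuous
    (coordP : Matrix (Fin (g + 1) ⊕ Fin (g + 1)) (Fin (g + 1) ⊕ Fin (g + 1)) (W → ℂ) → W → ℝ) := by
  unfold coordP
  fun_prop

theorem continuous_topP : ∀ {g : ℕ}, Continuous
    (topP : Matrix (Fin g ⊕ Fin g) (Fin g ⊕ Fin g) (W → ℂ) → W → ℝ)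
  | 0 => continuous_const
  | _ + 1 => continuous_coordP

theorem continuous_xMat {X : Type*} [TopologicalSpace X] {v : X → Fin g ⊕ Fin g → W → ℂ}
    {t : X → W → ℂ} (hv : Continuous v) (ht : Continuous t) :
    Continuous fun x => xMat (v x) (t x) := by
  have hv' : ∀ m, Continuous fun x => v x m := fun m => (continuous_apply m).comp hv
  refine continuous_matrix ?_
  refine idx_cases ?_ ?_ fun m => ?_ <;> refine idx_cases ?_ ?_ fun n => ?_ <;>
    simp only [xMat_inl, xMat_inr, xMat_idxSucc, glue_inl, glue_inr, glue_idxSucc]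
  all_goals first
    | exact continuous_const
    | exact ht
    | exact hv' _
    | skip
  rcases n with i | i
  · exact (hv' _).neg
  · exact hv' _

theorem continuous_posExt {X : Type*} [TopologicalSpace X] {p : X → W → ℝ}
    {h : X → Matrix (Fin g ⊕ Fin g) (Fin g ⊕ Fin g) (W → ℂ)} (hp : Continuous p)
    (hpos : ∀ x w, 0 < p x w) (hh : Continuous h) : Continuous fun x => posExt (p x) (h x) := by
  have hp' : ∀ w, Continuous fun x => p x w := fun w => (continuous_apply w).comp hp
  refine continuous_matrix ?_
  refine idx_cases ?_ ?_ fun m => ?_ <;> refine idx_cases ?_ ?_ fun n => ?_ <;>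
    simp only [posExt, extMat_inl, extMat_inr, extMat_idxSucc, glue_inl, glue_inr,
      glue_idxSucc]
  all_goals first
    | exact continuous_const
    | exact continuous_pi fun w => Complex.continuous_ofReal.comp (hp' w)
    | exact continuous_pi fun w => Complex.continuous_ofReal.comp
        ((hp' w).inv₀ fun x => (hpos x w).ne')
    | exact hh.matrix_elem _ _

/-- The domain of the horospherical coordinates. -/
def horoDom (T : Set W) (g : ℕ) : Set ((Fin g ⊕ Fin g → W → ℂ) × (W → ℂ) × (W → ℝ)) :=
  {x | (∀ m, x.1 m ∈ realAlg T) ∧ x.2.1 ∈ realAlg T ∧ ∀ w, 0 < x.2.2 w}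

/-- A bounded part of the domain of the horospherical coordinates. -/
def horoBox (W : Type) (g : ℕ) (C : ℝ) :
    Set ((Fin g ⊕ Fin g → W → ℂ) × (W → ℂ) × (W → ℝ)) :=
  {x | (∀ m w, ‖x.1 m w‖ < C) ∧ (∀ w, ‖x.2.1 w‖ < C) ∧ (∀ w, x.2.2 w < C) ∧
    ∀ w w', x.2.2 w < C * x.2.2 w'}

theorem convex_horoDom : Convex ℝ (horoDom T g) := by
  rintro x ⟨h1, h2, h3⟩ y ⟨h4, h5, h6⟩ a b ha hb hab
  refine ⟨fun m => ?_, ?_, fun w => ?_⟩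
  · exact add_mem ((realAlg T).smul_mem (h1 m) a) ((realAlg T).smul_mem (h4 m) b)
  · exact add_mem ((realAlg T).smul_mem h2 a) ((realAlg T).smul_mem h5 b)
  · exact (convex_Ioi (0 : ℝ)) (h3 w) (h6 w) ha hb hab

theorem convex_horoBox (C : ℝ) : Convex ℝ (horoBox W g C) := by
  rintro x ⟨h1, h2, h3, h3'⟩ y ⟨h4, h5, h6, h6'⟩ a b ha hb hab
  have key : ∀ z z' : ℂ, ‖z‖ < C → ‖z'‖ < C → ‖a • z + b • z'‖ < C := fun z z' hz hz' => by
    have := (convex_ball (0 : ℂ) C) (by simpa using hz) (by simpa using hz') ha hb hab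
    simpa using this
  refine ⟨fun m w => key _ _ (h1 m w) (h4 m w), fun w => key _ _ (h2 w) (h5 w), fun w => ?_,
    fun w w' => ?_⟩
  · exact (convex_Iio C) (h3 w) (h6 w) ha hb hab
  · have := (convex_Iio (0 : ℝ)) (x := x.2.2 w - C * x.2.2 w') (y := y.2.2 w - C * y.2.2 w')
      (by simpa using h3' w w') (by simpa using h6' w w') ha hb hab
    simp only [Set.mem_Iio, smul_eq_mul] at this
    simp only [Prod.snd_add, Prod.smul_snd, Pi.add_apply, Pi.smul_apply, smul_eq_mul]
    linarith

theorem isOpen_horoBox [Finite W] (C : ℝ) : IsOpen (horoBox W g C) := by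
  have e : horoBox W g C = (⋂ m, ⋂ w, {x | ‖x.1 m w‖ < C}) ∩ ((⋂ w, {x | ‖x.2.1 w‖ < C}) ∩
      ((⋂ w, {x | x.2.2 w < C}) ∩ ⋂ w, ⋂ w', {x | x.2.2 w < C * x.2.2 w'})) := by
    ext x
    simp [horoBox]
  rw [e]
  refine (isOpen_iInter_of_finite fun m => isOpen_iInter_of_finite fun w => ?_).inter
    ((isOpen_iInter_of_finite fun w => ?_).inter ((isOpen_iInter_of_finite fun w => ?_).inter
    (isOpen_iInter_of_finite fun w => isOpen_iInter_of_finite fun w' => ?_)))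
  all_goals exact isOpen_lt (by fun_prop) (by fun_prop)

/-- Horospherical coordinates on the symmetric space. -/
def horoHomeo (T : Set W) (g : ℕ) :
    SiegelSpace T (g + 1) ≃ₜ horoDom T g × SiegelSpace T g where
  toFun h := (⟨(coordV h.1, coordT h.1, fun w => coordP h.1 w / topP (coordH h.1) w),
    h.2.coord.2.1, h.2.coord.2.2.1, fun w => div_pos (h.2.coord.1 w)
      (topP_pos h.2.coord.2.2.2.1 w)⟩, ⟨coordH h.1, h.2.coord.2.2.2.1⟩)
  invFun x := ⟨horo x.1.1.1 x.1.1.2.1 (fun w => x.1.1.2.2 w * topP x.2.1 w) x.2.1,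
    isSiegel_horo (fun w => mul_pos (x.1.2.2.2 w) (topP_pos x.2.2 w)) x.1.2.1 x.1.2.2.1 x.2.2⟩
  left_inv h := by
    refine Subtype.ext ?_
    have e : (fun w => coordP h.1 w / topP (coordH h.1) w * topP (coordH h.1) w) = coordP h.1 :=
      funext fun w => div_mul_cancel₀ _ (topP_pos h.2.coord.2.2.2.1 w).ne'
    show horo (coordV h.1) (coordT h.1) _ (coordH h.1) = h.1
    rw [e]
    exact h.2.coord.2.2.2.2
  right_inv x := by
    obtain ⟨h1, h2, h3, h4⟩ := coord_horo (v := x.1.1.1) (t := x.1.1.2.1)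
      (p := fun w => x.1.1.2.2 w * topP x.2.1 w) (h := x.2.1)
      (fun w => mul_pos (x.1.2.2.2 w) (topP_pos x.2.2 w))
    refine Prod.ext (Subtype.ext (Prod.ext h1 (Prod.ext h2 (funext fun w => ?_))))
      (Subtype.ext h4)
    simp only [h3, h4]
    exact mul_div_cancel_right₀ _ (topP_pos x.2.2 w).ne'
  continuous_toFun := by
    have hP : Continuous fun h : SiegelSpace T (g + 1) => coordP h.1 :=
      continuous_coordP.comp continuous_subtype_val
    have hP' : Continuous fun h : SiegelSpace T (g + 1) =>
        (fun w => (((coordP h.1 w)⁻¹ : ℝ) : ℂ)) := by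
      refine continuous_pi fun w => Complex.continuous_ofReal.comp ?_
      exact ((continuous_apply w).comp hP).inv₀ fun h => (h.2.coord.1 w).ne'
    have hV : Continuous fun h : SiegelSpace T (g + 1) => coordV h.1 :=
      continuous_pi fun m => (continuous_subtype_val.matrix_elem _ _).mul hP'
    have hT : Continuous fun h : SiegelSpace T (g + 1) => coordT h.1 :=
      (continuous_subtype_val.matrix_elem _ _).mul hP'
    have hx := continuous_xMat hV.neg hT.neg
    have hH : Continuous fun h : SiegelSpace T (g + 1) => coordH h.1 :=
      ((hx.matrix_mul continuous_subtype_val).matrix_mul hx.matrix_conjTranspose).matrix_submatrix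
        _ _
    have hr : Continuous fun h : SiegelSpace T (g + 1) =>
        fun w => coordP h.1 w / topP (coordH h.1) w :=
      continuous_pi fun w => ((continuous_apply w).comp hP).div
        ((continuous_apply w).comp (continuous_topP.comp hH))
        fun h => (topP_pos h.2.coord.2.2.2.1 w).ne'
    exact ((hV.prodMk (hT.prodMk hr)).subtype_mk _).prodMk (hH.subtype_mk _)
  continuous_invFun := by
    have hh : Continuous fun x : horoDom T g × SiegelSpace T g => x.2.1 :=
      continuous_subtype_val.comp continuous_snd
    have h1 : Continuous fun x : horoDom T g × SiegelSpace T g => x.1.1 :=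
      continuous_subtype_val.comp continuous_fst
    have hp : Continuous fun x : horoDom T g × SiegelSpace T g =>
        fun w => x.1.1.2.2 w * topP x.2.1 w :=
      (continuous_snd.comp (continuous_snd.comp h1)).mul (continuous_topP.comp hh)
    have hx := continuous_xMat (continuous_fst.comp h1) (continuous_fst.comp (continuous_snd.comp h1))
    refine Continuous.subtype_mk ?_ _
    exact (hx.matrix_mul (continuous_posExt hp
      (fun x w => mul_pos (x.1.2.2.2 w) (topP_pos x.2.2 w)) hh)).matrix_mul
      hx.matrix_conjTranspose

theorem contractibleSpace_siegelSpace (T : Set W) : ∀ g : ℕ, ContractibleSpace (SiegelSpace T g)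
  | 0 => by
    have : Unique (SiegelSpace T 0) :=
      { default := ⟨1, IsSiegel.one⟩
        uniq := fun x => Subtype.ext (Subsingleton.elim _ _) }
    infer_instance
  | g + 1 => by
    have := contractibleSpace_siegelSpace T g
    have : ContractibleSpace (horoDom T g) :=
      (convex_horoDom (T := T) (g := g)).contractibleSpace
        ⟨(0, 0, 1), fun m => zero_mem _, zero_mem _, fun w => one_pos⟩
    exact (horoHomeo T g).contractibleSpace

/-- Siegel domains in the symmetric space. -/
def siegelDom (T : Set W) (C : ℝ) : ∀ g : ℕ, Set (SiegelSpace T g)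
  | 0 => Set.univ
  | g + 1 => {h | ((horoHomeo T g h).1 : (Fin g ⊕ Fin g → W → ℂ) × (W → ℂ) × (W → ℝ)) ∈
      horoBox W g C ∧ (horoHomeo T g h).2 ∈ siegelDom T C g}

theorem isOpen_siegelDom [Finite W] (C : ℝ) : ∀ g : ℕ, IsOpen (siegelDom T C g)
  | 0 => isOpen_univ
  | g + 1 => ((isOpen_horoBox C).preimage (continuous_subtype_val.comp
      (continuous_fst.comp (horoHomeo T g).continuous))).inter
      ((isOpen_siegelDom C g).preimage (continuous_snd.comp (horoHomeo T g).continuous))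

theorem isPreconnected_siegelDom (C : ℝ) : ∀ g : ℕ, IsPreconnected (siegelDom T C g)
  | 0 => by
    have := contractibleSpace_siegelSpace T 0
    exact isPreconnected_univ
  | g + 1 => by
    have h1 : IsPreconnected (Subtype.val ⁻¹' horoBox W g C : Set (horoDom T g)) := by
      rw [← Topology.IsInducing.subtypeVal.isPreconnected_image, Subtype.image_preimage_coe]
      exact (convex_horoDom.inter (convex_horoBox C)).isPreconnected
    have h2 := h1.prod (isPreconnected_siegelDom C g)
    have h3 := h2.image _ (horoHomeo T g).symm.continuous.continuousOn
    rw [Homeomorph.image_symm] at h3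
    exact h3

theorem siegelDom_mono {C C' : ℝ} (hC : C ≤ C') :
    ∀ g : ℕ, siegelDom T C g ⊆ siegelDom T C' g
  | 0 => subset_rfl
  | g + 1 => by
    rintro h ⟨⟨h1, h2, h3, h4⟩, h5⟩
    refine ⟨⟨fun m w => (h1 m w).trans_le hC, fun w => (h2 w).trans_le hC,
      fun w => (h3 w).trans_le hC, fun w w' => (h4 w w').trans_le ?_⟩, siegelDom_mono hC g h5⟩
    exact mul_le_mul_of_nonneg_right hC ((horoHomeo T g h).1.2.2.2 w').le

theorem exists_mem_siegelDom [Finite W] : ∀ {g : ℕ} (h : SiegelSpace T g),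
    ∃ C, h ∈ siegelDom T C g
  | 0, _ => ⟨0, trivial⟩
  | g + 1, h => by
    obtain ⟨C₀, h₀⟩ := exists_mem_siegelDom (horoHomeo T g h).2
    set x := (horoHomeo T g h).1 with hx
    obtain ⟨C₁, h₁⟩ := (Set.finite_range fun p : (Fin g ⊕ Fin g) × W => ‖x.1.1 p.1 p.2‖).bddAbove
    obtain ⟨C₂, h₂⟩ := (Set.finite_range fun w : W => ‖x.1.2.1 w‖).bddAbove
    obtain ⟨C₃, h₃⟩ := (Set.finite_range fun w : W => x.1.2.2 w).bddAbove
    obtain ⟨C₄, h₄⟩ := (Set.finite_range fun p : W × W => x.1.2.2 p.1 / x.1.2.2 p.2).bddAbove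
    rw [mem_upperBounds, Set.forall_mem_range] at h₁ h₂ h₃ h₄
    refine ⟨max C₀ (max (max C₁ C₂) (max C₃ C₄) + 1), ⟨fun m w => ?_, fun w => ?_, fun w => ?_,
      fun w w' => ?_⟩, siegelDom_mono (le_max_left _ _) g h₀⟩
    · refine lt_of_le_of_lt (h₁ (m, w)) (lt_max_of_lt_right ?_)
      exact lt_of_le_of_lt ((le_max_left _ _).trans (le_max_left _ _)) (lt_add_one _)
    · refine lt_of_le_of_lt (h₂ w) (lt_max_of_lt_right ?_)
      exact lt_of_le_of_lt ((le_max_right _ _).trans (le_max_left _ _)) (lt_add_one _)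
    · refine lt_of_le_of_lt (h₃ w) (lt_max_of_lt_right ?_)
      exact lt_of_le_of_lt ((le_max_left _ _).trans (le_max_right _ _)) (lt_add_one _)
    · rw [← div_lt_iff₀ (x.2.2.2 w')]
      refine lt_of_le_of_lt (h₄ (w, w')) (lt_max_of_lt_right ?_)
      exact lt_of_le_of_lt ((le_max_right _ _).trans (le_max_right _ _)) (lt_add_one _)

end SiegelTop

section Arch

open NumberField

variable {g : ℕ} (K : Type) [Field K]

/-- The diagonal embedding of a number field into the product of `ℂ` over infinite places. -/
def archHom : K →+* (InfinitePlace K → ℂ) := RingHom.pi fun w => w.embedding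

/-- The set of real places. -/
def realPlaces : Set (InfinitePlace K) := {w | w.IsReal}

variable {K}

theorem norm_archHom (x : K) (w : InfinitePlace K) : ‖archHom K x w‖ = w x :=
  w.norm_embedding_eq x

theorem archHom_mem_realAlg (x : K) : archHom K x ∈ realAlg (realPlaces K) := by
  intro w hw
  show (w.embedding x).im = 0
  rw [← InfinitePlace.embedding_of_isReal_apply hw, Complex.ofReal_im]

theorem exists_one_le_archHom [NumberField K] {x : K} (hx : IsIntegral ℤ x) (h0 : x ≠ 0) :
    ∃ w, 1 ≤ ‖archHom K x w‖ := by
  by_contra! h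
  simp only [norm_archHom] at h
  obtain ⟨w⟩ : Nonempty (InfinitePlace K) := inferInstance
  have := InfinitePlace.one_le_of_lt_one (w := w) (a := (⟨x, hx⟩ : 𝓞 K))
    (fun h => h0 (congrArg Subtype.val h)) fun z _ => h z
  exact (h w).not_ge this

theorem finite_of_archHom_le [NumberField K] (B : ℝ) :
    {x : K | IsIntegral ℤ x ∧ ∀ w, ‖archHom K x w‖ ≤ B}.Finite := by
  refine (NumberField.Embeddings.finite_of_norm_le K ℂ B).subset fun x hx => ⟨hx.1, fun φ => ?_⟩
  rw [← InfinitePlace.apply φ x, ← norm_archHom]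
  exact hx.2 _

/-- The image of a matrix under the diagonal embedding. -/
def archMat {ι κ : Type} (c : Matrix ι κ K) : Matrix ι κ (InfinitePlace K → ℂ) := c.map (archHom K)

theorem archMat_mul {ι κ μ : Type} [Fintype κ] (c : Matrix ι κ K) (d : Matrix κ μ K) :
    archMat (c * d) = archMat c * archMat d := Matrix.map_mul

theorem archMat_one {ι : Type} [DecidableEq ι] : archMat (1 : Matrix ι ι K) = 1 :=
  Matrix.map_one _ (map_zero _) (map_one _)

theorem archMat_mem {c : Matrix (Fin g ⊕ Fin g) (Fin g ⊕ Fin g) K} (hc : c ∈ Sp g K) :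
    archMat c ∈ Sp g (InfinitePlace K → ℂ) := SpAux.map_mem _ hc

/-- The symmetric space of the symplectic group over a number field. -/
abbrev SymSpace (g : ℕ) (K : Type) [Field K] := SiegelSpace (realPlaces K) g

instance : SMul (Sp g K) (SymSpace g K) where
  smul c h := ⟨archMat c.1 * h.1 * (archMat c.1)ᴴ,
    h.2.conj (archMat_mem c.2) fun _ _ => archHom_mem_realAlg _⟩

theorem Sp_smul_val (c : Sp g K) (h : SymSpace g K) :
    (c • h).1 = archMat c.1 * h.1 * (archMat c.1)ᴴ := rfl

instance : MulAction (Sp g K) (SymSpace g K) where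
  one_smul h := Subtype.ext (by
    rw [Sp_smul_val, OneMemClass.coe_one, archMat_one, Matrix.conjTranspose_one, Matrix.one_mul,
      Matrix.mul_one])
  mul_smul c d h := Subtype.ext (by
    simp only [Sp_smul_val, Submonoid.coe_mul, archMat_mul, Matrix.conjTranspose_mul,
      Matrix.mul_assoc])

instance : ContinuousConstSMul (Sp g K) (SymSpace g K) where
  continuous_const_smul c := by
    refine Continuous.subtype_mk ?_ _
    exact (continuous_const.matrix_mul continuous_subtype_val).matrix_mul continuous_const

/-- A matrix over `K` becomes a matrix over the subring `O` after multiplication by `m`. -/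
def HasDenom (O : Subring K) (m : K) {ι κ : Type} (c : Matrix ι κ K) : Prop :=
  ∀ i j, m * c i j ∈ O

theorem HasDenom.mul {O : Subring K} {m m' : K} {ι κ μ : Type} [Fintype κ] {c : Matrix ι κ K}
    {d : Matrix κ μ K} (hc : HasDenom O m c) (hd : HasDenom O m' d) :
    HasDenom O (m * m') (c * d) := by
  intro i j
  rw [Matrix.mul_apply, Finset.mul_sum]
  refine sum_mem fun k _ => ?_
  rw [mul_mul_mul_comm]
  exact mul_mem (hc i k) (hd k j)

theorem HasDenom.of_dvd {O : Subring K} {m m' : K} {ι κ : Type} {c : Matrix ι κ K}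
    (hc : HasDenom O m c) (hm : ∃ a ∈ O, m' = a * m) : HasDenom O m' c := by
  obtain ⟨a, ha, rfl⟩ := hm
  intro i j
  rw [mul_assoc]
  exact mul_mem ha (hc i j)

theorem HasDenom.inv {O : Subring K} {m : K} {c : Sp g K} (hc : HasDenom O m c.1) :
    HasDenom O m (c⁻¹).1 := by
  rw [SymplecticGroup.coe_inv]
  have hJ : HasDenom O 1 (Matrix.J (Fin g) K) := by
    rintro (i | i) (j | j) <;> simp only [Matrix.J, Matrix.fromBlocks_apply₁₁,
      Matrix.fromBlocks_apply₁₂, Matrix.fromBlocks_apply₂₁, Matrix.fromBlocks_apply₂₂, one_mul,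
      Matrix.zero_apply, Matrix.neg_apply, Matrix.one_apply] <;> try split_ifs
    all_goals first | exact zero_mem _ | exact neg_mem (one_mem _) | exact one_mem _ |
      simp
  have hJ' : HasDenom O 1 (-Matrix.J (Fin g) K) := fun i j => by
    rw [Matrix.neg_apply, mul_neg]
    exact neg_mem (hJ i j)
  have ht : HasDenom O m (c.1)ᵀ := fun i j => hc j i
  simpa using (hJ'.mul ht).mul hJ

theorem hasDenom_one {O : Subring K} {ι : Type} [DecidableEq ι] : HasDenom O 1 (1 : Matrix ι ι K) := by
  intro i j
  rw [one_mul, Matrix.one_apply]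
  split_ifs
  · exact one_mem _
  · exact zero_mem _

variable (K) in
/-- The ring of algebraic integers as a subring. -/
def intRing : Subring K := (integralClosure ℤ K).toSubring

theorem mem_intRing {x : K} : x ∈ intRing K ↔ IsIntegral ℤ x := Iff.rfl

theorem natCast_mem_intRing (m : ℕ) : (m : K) ∈ intRing K := natCast_mem _ m

end Arch

section Iwasawa

variable {g : ℕ} {W : Type}

/-- A bounded triangular decomposition of a hermitian matrix. -/
structure HermReduced {ι : Type} [Fintype ι] [DecidableEq ι] (ord : ι → ℕ) (M : ℝ)
    (h : Matrix ι ι (W → ℂ)) (n n' : Matrix ι ι (W → ℂ)) (a : ι → W → ℝ) : Prop where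
  eq : h = n * diagonal (fun i w => (a i w : ℂ)) * nᴴ
  inv : n * n' = 1
  tri : ∀ i j, ord i < ord j → n i j = 0
  tri' : ∀ i j, ord i < ord j → n' i j = 0
  bd : ∀ i j w, ‖n i j w‖ ≤ M
  bd' : ∀ i j w, ‖n' i j w‖ ≤ M
  pos : ∀ i w, 0 < a i w
  mono : ∀ i j w, ord i ≤ ord j → a i w ≤ M * a j w
  bal : ∀ i w w', a i w ≤ M * a i w'

theorem exists_le_norm_of_le_sum {κ : Type} [Fintype κ] {f : κ → ℂ} {δ : ℝ} (hδ : 0 < δ)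
    (hf : δ ≤ ‖∑ k, f k‖) : ∃ k, δ ≤ Fintype.card κ * ‖f k‖ := by
  by_contra! H
  have h1 : ‖∑ k, f k‖ ≤ ∑ k, ‖f k‖ := norm_sum_le _ _
  rcases isEmpty_or_nonempty κ with hκ | hκ
  · simp at hf
    linarith
  have h2 : ∑ k : κ, Fintype.card κ * ‖f k‖ < ∑ _k : κ, δ :=
    Finset.sum_lt_sum_of_nonempty Finset.univ_nonempty fun k _ => H k
  rw [← Finset.mul_sum, Finset.sum_const, Finset.card_univ, nsmul_eq_mul] at h2
  have h3 : (0 : ℝ) < Fintype.card κ := by exact_mod_cast Fintype.card_pos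
  have := lt_of_mul_lt_mul_left h2 h3.le
  linarith

theorem triple_mul_apply {ι : Type} [Fintype ι] (n d m : Matrix ι ι (W → ℂ)) (k l : ι) (w : W) :
    (n * d * m) k l w = ∑ p : ι × ι, n k p.1 w * d p.1 p.2 w * m p.2 l w := by
  rw [Fintype.sum_prod_type_right, Matrix.mul_apply, Finset.sum_apply]
  refine Finset.sum_congr rfl fun j _ => ?_
  rw [Matrix.mul_apply, Pi.mul_apply, Finset.sum_apply, Finset.sum_mul]
  rfl

section Finiteness

variable {ι : Type} [Fintype ι] [DecidableEq ι] {ord : ι → ℕ} {M : ℝ}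
  {h h' n n' m m' c : Matrix ι ι (W → ℂ)} {a b : ι → W → ℝ}

/-- Entries of a matrix relating two reduced forms, relative to the triangular bases. -/
theorem HermReduced.norm_sq_le (H : HermReduced ord M h n n' a) (H' : HermReduced ord M h' m m' b)
    (hc : c * h * cᴴ = h') (i j : ι) (w : W) :
    ‖(m' * c * n) i j w‖ ^ 2 * a j w ≤ b i w := by
  set d := m' * c * n with hd
  have h1 : m' * m = 1 := mul_eq_one_comm.1 H'.inv
  have h2 : d * diagonal (fun i w => (a i w : ℂ)) * dᴴ = diagonal (fun i w => (b i w : ℂ)) := by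
    have e1 : d * diagonal (fun i w => (a i w : ℂ)) * dᴴ = m' * (c * h * cᴴ) * m'ᴴ := by
      rw [hd, H.eq]
      simp only [Matrix.conjTranspose_mul, Matrix.mul_assoc]
    have e2 : mᴴ * m'ᴴ = 1 := by rw [← Matrix.conjTranspose_mul, h1, Matrix.conjTranspose_one]
    rw [e1, hc, H'.eq]
    calc m' * (m * diagonal (fun i w => (b i w : ℂ)) * mᴴ) * m'ᴴ
        = (m' * m) * diagonal (fun i w => (b i w : ℂ)) * (mᴴ * m'ᴴ) := by
          simp only [Matrix.mul_assoc]
      _ = _ := by rw [h1, e2, Matrix.one_mul, Matrix.mul_one]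
  have h3 := congrArg Complex.re (congrFun (congrFun (congrFun h2 i) i) w)
  rw [Matrix.mul_apply, Matrix.diagonal_apply_eq, Finset.sum_apply, Complex.re_sum,
    Complex.ofReal_re] at h3
  have h4 : ∀ k, ((d * diagonal (fun i w => (a i w : ℂ))) i k * dᴴ k i) w
      = ((‖d i k w‖ ^ 2 * a k w : ℝ) : ℂ) := by
    intro k
    rw [Matrix.mul_diagonal, Matrix.conjTranspose_apply, Complex.ofReal_mul,
      ← Complex.normSq_eq_norm_sq, ← Complex.mul_conj]
    simp only [Pi.mul_apply, Pi.star_apply, starRingEnd_apply]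
    ring
  rw [← h3]
  simp only [h4, Complex.ofReal_re]
  exact Finset.single_le_sum (f := fun k => ‖d i k w‖ ^ 2 * a k w)
    (fun k _ => mul_nonneg (sq_nonneg _) (H.pos k w).le) (Finset.mem_univ j)

/-- A nonvanishing entry with norm bounded below controls the ratio of the heights. -/
theorem HermReduced.exists_le (H : HermReduced ord M h n n' a) (H' : HermReduced ord M h' m m' b)
    (hM : 1 ≤ M) (hc : c * h * cᴴ = h') {δ : ℝ} (hδ : 0 < δ) {k l : ι} {w₀ : W}
    (hkl : δ ≤ ‖c k l w₀‖) (w : W) :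
    δ ^ 2 * a l w ≤ (Fintype.card (ι × ι) * (M * M)) ^ 2 * M ^ 4 * b k w := by
  have h1 : m * m' = 1 := H'.inv
  have h2 : c = m * (m' * c * n) * n' := by
    calc c = (m * m') * c * (n * n') := by rw [h1, H.inv, Matrix.one_mul, Matrix.mul_one]
      _ = _ := by simp only [Matrix.mul_assoc]
  set d := m' * c * n with hd
  rw [h2, triple_mul_apply] at hkl
  obtain ⟨⟨i, j⟩, hp⟩ := exists_le_norm_of_le_sum hδ hkl
  simp only [norm_mul] at hp
  set N : ℝ := (Fintype.card (ι × ι) : ℝ) with hN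
  have hN0 : 0 ≤ N := Nat.cast_nonneg _
  have hM0 : 0 ≤ M := by linarith
  have hik : ord i ≤ ord k := by
    by_contra! hlt
    rw [H'.tri k i hlt] at hp
    simp at hp
    linarith
  have hlj : ord l ≤ ord j := by
    by_contra! hlt
    rw [H.tri' j l hlt] at hp
    simp at hp
    linarith
  have hd0 := H.norm_sq_le H' hc i j w₀
  rw [← hd] at hd0
  have h3 : δ ≤ N * (M * M) * ‖d i j w₀‖ := by
    refine hp.trans ?_
    have : ‖m k i w₀‖ * ‖d i j w₀‖ * ‖n' j l w₀‖ ≤ M * ‖d i j w₀‖ * M :=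
      mul_le_mul (mul_le_mul_of_nonneg_right (H'.bd _ _ _) (norm_nonneg _)) (H.bd' _ _ _)
        (norm_nonneg _) (mul_nonneg hM0 (norm_nonneg _))
    calc N * (‖m k i w₀‖ * ‖d i j w₀‖ * ‖n' j l w₀‖) ≤ N * (M * ‖d i j w₀‖ * M) :=
          mul_le_mul_of_nonneg_left this hN0
      _ = _ := by ring
  have h4 : δ ^ 2 ≤ (N * (M * M)) ^ 2 * ‖d i j w₀‖ ^ 2 := by
    rw [← mul_pow]
    exact pow_le_pow_left₀ hδ.le h3 2
  have e1 : a l w ≤ M ^ 2 * a j w₀ := by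
    calc a l w ≤ M * a l w₀ := H.bal _ _ _
      _ ≤ M * (M * a j w₀) := mul_le_mul_of_nonneg_left (H.mono _ _ _ hlj) hM0
      _ = _ := by ring
  have e2 : b i w₀ ≤ M ^ 2 * b k w := by
    calc b i w₀ ≤ M * b k w₀ := H'.mono _ _ _ hik
      _ ≤ M * (M * b k w) := mul_le_mul_of_nonneg_left (H'.bal _ _ _) hM0
      _ = _ := by ring
  have hM2 : 0 ≤ M ^ 2 := sq_nonneg _
  calc δ ^ 2 * a l w ≤ ((N * (M * M)) ^ 2 * ‖d i j w₀‖ ^ 2) * (M ^ 2 * a j w₀) :=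
        mul_le_mul h4 e1 (H.pos _ _).le (mul_nonneg (sq_nonneg _) (sq_nonneg _))
    _ = (N * (M * M)) ^ 2 * M ^ 2 * (‖d i j w₀‖ ^ 2 * a j w₀) := by ring
    _ ≤ (N * (M * M)) ^ 2 * M ^ 2 * (M ^ 2 * b k w) :=
        mul_le_mul_of_nonneg_left (hd0.trans e2) (mul_nonneg (sq_nonneg _) hM2)
    _ = _ := by ring

/-- Matrices relating two reduced forms are bounded when the nonzero entries of their inverses
are bounded below at some place. -/
theorem HermReduced.norm_le (H : HermReduced ord M h n n' a) (H' : HermReduced ord M h' m m' b)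
    (hM : 1 ≤ M) (hc : c * h * cᴴ = h') {c' : Matrix ι ι (W → ℂ)} (hcc : c * c' = 1) {δ : ℝ}
    (hδ : 0 < δ) (hlow : ∀ k l, c' k l ≠ 0 → ∃ w, δ ≤ ‖c' k l w‖) (k l : ι) (w : W) :
    ‖c k l w‖ ≤ Fintype.card (ι × ι) * (M * M) *
      ((Fintype.card (ι × ι) * (M * M)) * M ^ 3 / δ) := by
  set N : ℝ := (Fintype.card (ι × ι) : ℝ) with hN
  have hN0 : 0 ≤ N := Nat.cast_nonneg _
  have hM0 : 0 ≤ M := by linarith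
  have h1 : m * m' = 1 := H'.inv
  have h1' : m' * m = 1 := mul_eq_one_comm.1 h1
  have h1n : n' * n = 1 := mul_eq_one_comm.1 H.inv
  have hcc' : c' * c = 1 := mul_eq_one_comm.1 hcc
  have h2 : c = m * (m' * c * n) * n' := by
    calc c = (m * m') * c * (n * n') := by rw [h1, H.inv, Matrix.one_mul, Matrix.mul_one]
      _ = _ := by simp only [Matrix.mul_assoc]
  have hc' : c' * h' * c'ᴴ = h := by
    have e2 : cᴴ * c'ᴴ = 1 := by rw [← Matrix.conjTranspose_mul, hcc', Matrix.conjTranspose_one]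
    calc c' * h' * c'ᴴ = (c' * c) * h * (cᴴ * c'ᴴ) := by
          rw [← hc]
          simp only [Matrix.mul_assoc]
      _ = h := by rw [hcc', e2, Matrix.one_mul, Matrix.mul_one]
  set d := m' * c * n with hd
  set B : ℝ := N * (M * M) * M ^ 3 / δ with hB
  have hB0 : 0 ≤ B := div_nonneg (mul_nonneg (mul_nonneg hN0 (mul_nonneg hM0 hM0))
    (pow_nonneg hM0 3)) hδ.le
  have key : ∀ i j, ‖d i j w‖ ≤ B := by
    intro i j
    by_cases hd0 : d i j = 0
    · simp [hd0, hB0]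
    have hdd : d * (n' * c' * m) = 1 := by
      calc d * (n' * c' * m) = m' * (c * ((n * n') * (c' * m))) := by
            simp only [hd, Matrix.mul_assoc]
        _ = m' * ((c * c') * m) := by rw [H.inv, Matrix.one_mul, Matrix.mul_assoc]
        _ = 1 := by rw [hcc, Matrix.one_mul, h1']
    have hdiag : (n' * c' * m) * diagonal (fun i w => (b i w : ℂ)) =
        diagonal (fun i w => (a i w : ℂ)) * dᴴ := by
      have e3 : mᴴ * m'ᴴ = 1 := by rw [← Matrix.conjTranspose_mul, h1', Matrix.conjTranspose_one]
      have e4 : c' * m * diagonal (fun i w => (b i w : ℂ)) * mᴴ =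
          n * diagonal (fun i w => (a i w : ℂ)) * nᴴ * cᴴ := by
        rw [← H.eq]
        calc c' * m * diagonal (fun i w => (b i w : ℂ)) * mᴴ = c' * h' := by
              rw [H'.eq]
              simp only [Matrix.mul_assoc]
          _ = c' * c * (h * cᴴ) := by
              rw [← hc]
              simp only [Matrix.mul_assoc]
          _ = h * cᴴ := by rw [hcc', Matrix.one_mul]
      calc (n' * c' * m) * diagonal (fun i w => (b i w : ℂ))
          = n' * (c' * m * diagonal (fun i w => (b i w : ℂ)) * mᴴ) * m'ᴴ := by
            simp only [Matrix.mul_assoc]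
            rw [e3, Matrix.mul_one]
        _ = (n' * n) * diagonal (fun i w => (a i w : ℂ)) * (nᴴ * cᴴ * m'ᴴ) := by
            rw [e4]
            simp only [Matrix.mul_assoc]
        _ = _ := by
            rw [h1n, Matrix.one_mul, hd]
            simp only [Matrix.conjTranspose_mul, Matrix.mul_assoc]
    have hne : (n' * c' * m) j i ≠ 0 := by
      intro h0
      apply hd0
      have e5 := congrFun (congrFun hdiag j) i
      rw [Matrix.mul_diagonal, Matrix.diagonal_mul, h0, zero_mul, Matrix.conjTranspose_apply] at e5
      funext w
      have e6 := (congrFun e5 w).symm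
      simp only [Pi.mul_apply, Pi.zero_apply, Pi.star_apply, mul_eq_zero, star_eq_zero,
        Complex.ofReal_eq_zero, (H.pos j w).ne', false_or] at e6
      exact e6
    obtain ⟨w₁, hw₁⟩ := Function.ne_iff.1 hne
    rw [triple_mul_apply] at hw₁
    obtain ⟨⟨r, s⟩, -, hrs⟩ := Finset.exists_ne_zero_of_sum_ne_zero hw₁
    simp only [ne_eq, mul_eq_zero, not_or] at hrs
    obtain ⟨⟨hr, hcrs⟩, hs⟩ := hrs
    have hrj : ord r ≤ ord j := by
      by_contra! hlt
      exact hr (by rw [H.tri' j r hlt]; rfl)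
    have his : ord i ≤ ord s := by
      by_contra! hlt
      exact hs (by rw [H'.tri s i hlt]; rfl)
    obtain ⟨w₀, hw₀⟩ := hlow r s fun h0 => hcrs (by rw [h0]; rfl)
    have e7 := H'.exists_le H hM hc' hδ hw₀ w
    have e8 := H.norm_sq_le H' hc i j w
    rw [← hd] at e8
    have e9 := H'.mono i s w his
    have e10 := H.mono r j w hrj
    have haj := H.pos j w
    have e11 : δ ^ 2 * ‖d i j w‖ ^ 2 * a j w ≤ (N * (M * M)) ^ 2 * M ^ 6 * a j w := by
      calc δ ^ 2 * ‖d i j w‖ ^ 2 * a j w = δ ^ 2 * (‖d i j w‖ ^ 2 * a j w) := by ring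
        _ ≤ δ ^ 2 * (M * b s w) := mul_le_mul_of_nonneg_left (e8.trans e9) (sq_nonneg _)
        _ = M * (δ ^ 2 * b s w) := by ring
        _ ≤ M * ((N * (M * M)) ^ 2 * M ^ 4 * (M * a j w)) := by
            refine mul_le_mul_of_nonneg_left (e7.trans ?_) hM0
            exact mul_le_mul_of_nonneg_left e10 (by positivity)
        _ = _ := by ring
    have e12 := le_of_mul_le_mul_right e11 haj
    have e13 : (δ * ‖d i j w‖) ^ 2 ≤ (N * (M * M) * M ^ 3) ^ 2 := by
      calc (δ * ‖d i j w‖) ^ 2 = δ ^ 2 * ‖d i j w‖ ^ 2 := by ring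
        _ ≤ _ := e12
        _ = _ := by ring
    have e14 := abs_le_of_sq_le_sq' e13 (by positivity)
    rw [hB, le_div_iff₀ hδ, mul_comm]
    exact e14.2
  rw [h2, triple_mul_apply]
  refine (norm_sum_le _ _).trans ?_
  have : ∀ p ∈ (Finset.univ : Finset (ι × ι)),
      ‖m k p.1 w * d p.1 p.2 w * n' p.2 l w‖ ≤ M * B * M := by
    intro p _
    rw [norm_mul, norm_mul]
    exact mul_le_mul (mul_le_mul (H'.bd _ _ _) (key _ _) (norm_nonneg _) hM0) (H.bd' _ _ _)
      (norm_nonneg _) (mul_nonneg hM0 hB0)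
  refine (Finset.sum_le_card_nsmul _ _ _ this).trans (le_of_eq ?_)
  rw [Finset.card_univ, nsmul_eq_mul, ← hN]
  ring

end Finiteness

end Iwasawa

section ReducedSiegel

variable {g : ℕ} {W : Type} {T : Set W}

/-- The order of the standard basis vectors along the chain of heights. -/
def spOrd (g : ℕ) : Fin g ⊕ Fin g → ℕ := Sum.elim (fun i => 2 * g - 1 - i) (fun i => i)

theorem spOrd_idxSucc (m : Fin g ⊕ Fin g) : spOrd (g + 1) (idxSucc m) = spOrd g m + 1 := by
  rcases m with i | i
  · simp only [spOrd, idxSucc, Sum.map_inl, Sum.elim_inl, Fin.val_succ]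
    omega
  · simp [spOrd, idxSucc]

theorem spOrd_inr_zero : spOrd (g + 1) (Sum.inr 0) = 0 := by simp [spOrd]

theorem spOrd_inl_zero : spOrd (g + 1) (Sum.inl 0) = 2 * g + 1 := by
  simp [spOrd]
  omega

theorem spOrd_lt (m : Fin g ⊕ Fin g) : spOrd g m < 2 * g := by
  rcases m with i | i
  · simp only [spOrd, Sum.elim_inl]
    omega
  · simp only [spOrd, Sum.elim_inr]
    omega

theorem embMat_conjTranspose {R : Type} [CommRing R] [StarRing R]
    (n : Matrix (Fin g ⊕ Fin g) (Fin g ⊕ Fin g) R) : (embMat n)ᴴ = embMat nᴴ := by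
  ext a b
  revert a b
  refine idx_cases ?_ ?_ fun m => ?_ <;> refine idx_cases ?_ ?_ fun n => ?_ <;> simp

theorem diagonal_glue (p : W → ℝ) (a : Fin g ⊕ Fin g → W → ℝ) :
    diagonal (fun i w => ((glue p⁻¹ p a i w : ℝ) : ℂ)) =
      posExt p (diagonal fun i w => (a i w : ℂ)) := by
  ext i j w
  revert i j
  refine idx_cases ?_ ?_ fun m => ?_ <;> refine idx_cases ?_ ?_ fun n => ?_ <;>
    simp [posExt, Matrix.diagonal_apply, apply_ite]

theorem norm_mul_entry_le {ι : Type} [Fintype ι] {a b : Matrix ι ι (W → ℂ)} {A B : ℝ} (hA : 0 ≤ A)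
    (ha : ∀ i j w, ‖a i j w‖ ≤ A) (hb : ∀ i j w, ‖b i j w‖ ≤ B) (i j : ι) (w : W) :
    ‖(a * b) i j w‖ ≤ Fintype.card ι * (A * B) := by
  rw [Matrix.mul_apply, Finset.sum_apply]
  refine (norm_sum_le _ _).trans ?_
  refine (Finset.sum_le_card_nsmul _ _ (A * B) fun k _ => ?_).trans (le_of_eq ?_)
  · rw [Pi.mul_apply, norm_mul]
    exact mul_le_mul (ha _ _ _) (hb _ _ _) (norm_nonneg _) hA
  · rw [Finset.card_univ, nsmul_eq_mul]

theorem tri_mul {ι : Type} [Fintype ι] {R : Type} [CommRing R] {ord : ι → ℕ} {a b : Matrix ι ι R}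
    (ha : ∀ i j, ord i < ord j → a i j = 0) (hb : ∀ i j, ord i < ord j → b i j = 0) (i j : ι)
    (hij : ord i < ord j) : (a * b) i j = 0 := by
  rw [Matrix.mul_apply]
  refine Finset.sum_eq_zero fun k _ => ?_
  rcases lt_or_ge (ord i) (ord k) with h | h
  · rw [ha i k h, zero_mul]
  · rw [hb k j (h.trans_lt hij), mul_zero]

theorem norm_xMat_le {v : Fin g ⊕ Fin g → W → ℂ} {t : W → ℂ} {A : ℝ} (hA : 1 ≤ A)
    (hv : ∀ m w, ‖v m w‖ ≤ A) (ht : ∀ w, ‖t w‖ ≤ A) (i j) (w : W) : ‖xMat v t i j w‖ ≤ A := by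
  have hA0 : 0 ≤ A := by linarith
  revert i j
  refine idx_cases ?_ ?_ fun m => ?_ <;> refine idx_cases ?_ ?_ fun n => ?_ <;>
    simp [hA, hA0, hv, ht]
  · rcases n with i | i <;> simp [jvec, hv]
  · by_cases h : m = n
    · subst h; simp [hA]
    · rw [Pi.single_eq_of_ne' h]; simp [hA0]

theorem tri_xMat {R : Type} [CommRing R] (v : Fin g ⊕ Fin g → R) (t : R) (i j)
    (hij : spOrd (g + 1) i < spOrd (g + 1) j) : xMat v t i j = 0 := by
  revert i j
  refine idx_cases ?_ ?_ fun m => ?_ <;> refine idx_cases ?_ ?_ fun n => ?_ <;>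
    intro hij <;> simp only [spOrd_inl_zero, spOrd_inr_zero, spOrd_idxSucc] at hij <;>
    simp only [xMat_inl, xMat_inr, xMat_idxSucc, glue_inl, glue_inr, glue_idxSucc]
  all_goals first
    | omega
    | rfl
    | skip
  · have := spOrd_lt n
    omega
  · rw [Pi.single_eq_of_ne]
    rintro rfl
    omega

theorem norm_embMat_le {n : Matrix (Fin g ⊕ Fin g) (Fin g ⊕ Fin g) (W → ℂ)} {A : ℝ} (hA : 1 ≤ A)
    (hn : ∀ i j w, ‖n i j w‖ ≤ A) (i j) (w : W) : ‖embMat n i j w‖ ≤ A := by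
  have hA0 : 0 ≤ A := by linarith
  revert i j
  refine idx_cases ?_ ?_ fun m => ?_ <;> refine idx_cases ?_ ?_ fun n => ?_ <;>
    simp [hA, hA0, hn]

theorem tri_embMat {R : Type} [CommRing R] {n : Matrix (Fin g ⊕ Fin g) (Fin g ⊕ Fin g) R}
    (hn : ∀ i j, spOrd g i < spOrd g j → n i j = 0) (i j)
    (hij : spOrd (g + 1) i < spOrd (g + 1) j) : embMat n i j = 0 := by
  revert i j
  refine idx_cases ?_ ?_ fun m => ?_ <;> refine idx_cases ?_ ?_ fun n => ?_ <;>
    intro hij <;> simp only [spOrd_inl_zero, spOrd_inr_zero, spOrd_idxSucc] at hij <;>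
    simp only [embMat_inl, embMat_inr, embMat_idxSucc, glue_inl, glue_inr, glue_idxSucc]
  all_goals first
    | omega
    | rfl
    | skip
  exact hn _ _ (by omega)

/-- Uniform triangular decompositions over a Siegel domain. -/
theorem exists_hermReduced (C : ℝ) : ∀ g : ℕ, ∃ M : ℝ, 1 ≤ M ∧ ∀ h ∈ siegelDom T C g,
    ∃ n n' a, HermReduced (spOrd g) M h.1 n n' a ∧ (∀ i w, topP h.1 w * a i w ≤ M) ∧
      (∀ i w, topP h.1 w ≤ M * a i w) ∧ (∀ w, topP h.1 w ≤ M) ∧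
      ∀ w w', topP h.1 w ≤ M * topP h.1 w'
  | 0 => by
    refine ⟨1, le_rfl, fun h _ => ⟨1, 1, 0, ⟨Subsingleton.elim _ _, one_mul 1, isEmptyElim,
      isEmptyElim, isEmptyElim, isEmptyElim, isEmptyElim, isEmptyElim, isEmptyElim⟩,
      isEmptyElim, isEmptyElim, fun w => le_rfl, fun w w' => ?_⟩⟩
    simp [topP]
  | g + 1 => by
    obtain ⟨M, hM, H⟩ := exists_hermReduced C g
    set D : ℝ := max C 1 with hD
    have hD1 : 1 ≤ D := le_max_right _ _
    have hDC : C ≤ D := le_max_left _ _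
    set N : ℝ := (Fintype.card (Fin (g + 1) ⊕ Fin (g + 1)) : ℝ) with hN
    have hN1 : 1 ≤ N := by
      rw [hN]
      exact_mod_cast Fintype.card_pos
    set B : ℝ := N * (D * M) ^ 2 with hB
    have hDM : 1 ≤ D * M := one_le_mul_of_one_le_of_one_le hD1 hM
    have hsq : D * M ≤ (D * M) ^ 2 := le_self_pow₀ hDM two_ne_zero
    have hB1 : (D * M) ^ 2 ≤ B := le_mul_of_one_le_left (sq_nonneg _) hN1
    have hB2 : D * M ≤ B := hsq.trans hB1
    have hMB : M ≤ B := (le_mul_of_one_le_left (by linarith) hD1).trans hB2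
    have h1B : 1 ≤ B := hM.trans hMB
    refine ⟨B, h1B, ?_⟩
    rintro h ⟨⟨hv, ht, hr, hr'⟩, hh⟩
    obtain ⟨n, n', a, R, ha1, ha2, ha3, ha4⟩ := H _ hh
    obtain ⟨hP, hV, hT, hS, hhoro⟩ := h.2.coord
    have ev : ((horoHomeo T g h).1 : (Fin g ⊕ Fin g → W → ℂ) × (W → ℂ) × (W → ℝ)) =
      (coordV h.1, coordT h.1, fun w => coordP h.1 w / topP (coordH h.1) w) := rfl
    have eh : (horoHomeo T g h).2.1 = coordH h.1 := rfl
    rw [ev] at hv ht hr hr'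
    rw [eh] at R ha1 ha2 ha3 ha4
    simp only at hv ht hr hr'
    set v := coordV h.1
    set t := coordT h.1
    set p := coordP h.1
    set q := topP (coordH h.1) with hq
    have hq0 : ∀ w, 0 < q w := topP_pos hS
    have hpq : ∀ w, p w ≤ D * q w := fun w => by
      have := (hr w).le.trans hDC
      rwa [div_le_iff₀ (hq0 w)] at this
    have hM0 : 0 ≤ M := by linarith
    have hD0 : 0 ≤ D := by linarith
    have hpDM : ∀ w, p w ≤ D * M := fun w =>
      (hpq w).trans (mul_le_mul_of_nonneg_left (ha3 w) hD0)
    have hpp : ∀ w, p w * p w ≤ B := fun w => by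
      refine le_trans ?_ hB1
      rw [sq]
      exact mul_le_mul (hpDM w) (hpDM w) (hP w).le (by linarith)
    have htop : topP h.1 = p := rfl
    have hpa : ∀ i w, p w * a i w ≤ B := fun i w => by
      refine le_trans ?_ hB2
      calc p w * a i w ≤ D * q w * a i w :=
            mul_le_mul_of_nonneg_right (hpq w) (R.pos i w).le
        _ = D * (q w * a i w) := mul_assoc _ _ _
        _ ≤ D * M := mul_le_mul_of_nonneg_left (ha1 i w) hD0
    have hpa' : ∀ i w, p w ≤ B * a i w := fun i w => by
      calc p w ≤ D * q w := hpq w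
        _ ≤ D * (M * a i w) := mul_le_mul_of_nonneg_left (ha2 i w) hD0
        _ = D * M * a i w := (mul_assoc _ _ _).symm
        _ ≤ B * a i w := mul_le_mul_of_nonneg_right hB2 (R.pos i w).le
    have hpinv : ∀ w, p w ≤ B * (p w)⁻¹ := fun w => by
      rw [← div_eq_mul_inv, le_div_iff₀ (hP w)]
      exact hpp w
    have hbal : ∀ w w', p w ≤ B * p w' := fun w w' => by
      have h1 := hr' w w'
      rw [div_lt_iff₀ (hq0 w)] at h1
      have h2 : 0 < p w' / q w' := div_pos (hP w') (hq0 w')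
      have h3 : 0 ≤ C := by
        by_contra! hneg
        have := mul_neg_of_neg_of_pos hneg h2
        have h5 := mul_neg_of_neg_of_pos this (hq0 w)
        linarith [hP w]
      calc p w ≤ C * (p w' / q w') * q w := h1.le
        _ ≤ C * (p w' / q w') * (M * q w') := mul_le_mul_of_nonneg_left (ha4 w w')
            (mul_nonneg h3 h2.le)
        _ = C * M * p w' := by
            have := (hq0 w').ne'
            field_simp
        _ ≤ B * p w' := mul_le_mul_of_nonneg_right
            ((mul_le_mul_of_nonneg_right hDC hM0).trans hB2) (hP w').le
    have hxv : ∀ i j w, ‖xMat v t i j w‖ ≤ D :=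
      norm_xMat_le hD1 (fun m w => (hv m w).le.trans hDC) fun w => (ht w).le.trans hDC
    have hxv' : ∀ i j w, ‖xMat (-v) (-t) i j w‖ ≤ D :=
      norm_xMat_le hD1 (fun m w => by simpa using (hv m w).le.trans hDC)
        fun w => by simpa using (ht w).le.trans hDC
    have hbound : N * (D * M) ≤ B := mul_le_mul_of_nonneg_left hsq (by linarith)
    refine ⟨xMat v t * embMat n, embMat n' * xMat (-v) (-t), glue p⁻¹ p a,
      ⟨?_, ?_, tri_mul (tri_xMat v t) (tri_embMat R.tri),
        tri_mul (tri_embMat R.tri') (tri_xMat _ _), ?_, ?_, ?_, ?_, ?_⟩, ?_, ?_, ?_, ?_⟩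
    · have e : posExt p (coordH h.1) =
          embMat n * posExt p (diagonal fun i w => (a i w : ℂ)) * (embMat n)ᴴ := by
        rw [embMat_conjTranspose, embMat_eq_extMat, embMat_eq_extMat, posExt, posExt, extMat_mul,
          extMat_mul, ← R.eq]
        simp
      conv_lhs => rw [← hhoro, horo, e]
      rw [diagonal_glue, Matrix.conjTranspose_mul]
      simp only [Matrix.mul_assoc]
    · calc xMat v t * embMat n * (embMat n' * xMat (-v) (-t))
          = xMat v t * (embMat n * embMat n') * xMat (-v) (-t) := by simp only [Matrix.mul_assoc]
        _ = 1 := by rw [← embMat_mul, R.inv, embMat_one, Matrix.mul_one, xMat_mul_neg]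
    · exact fun i j w => (norm_mul_entry_le hD0 hxv (norm_embMat_le hM R.bd) i j w).trans hbound
    · exact fun i j w => (norm_mul_entry_le hM0 (norm_embMat_le hM R.bd') hxv' i j w).trans
        (by rw [mul_comm M D]; exact hbound)
    · refine idx_cases (fun w => inv_pos.2 (hP w)) (fun w => hP w) fun m w => ?_
      rw [glue_idxSucc]
      exact R.pos m w
    · have hself : ∀ x : ℝ, 0 ≤ x → x ≤ B * x := fun x hx => le_mul_of_one_le_left hx h1B
      refine idx_cases ?_ ?_ fun m => ?_ <;> refine idx_cases ?_ ?_ fun n => ?_ <;>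
        intro w hij <;>
        simp only [spOrd_inl_zero, spOrd_inr_zero, spOrd_idxSucc] at hij <;>
        simp only [glue_inl, glue_inr, glue_idxSucc, Pi.inv_apply]
      · exact hself _ (inv_pos.2 (hP w)).le
      · omega
      · have := spOrd_lt n
        omega
      · exact hpinv w
      · exact hself _ (hP w).le
      · exact hpa' n w
      · rw [← div_eq_mul_inv, le_div_iff₀ (hP w), mul_comm]
        exact hpa m w
      · omega
      · exact (R.mono m n w (by omega)).trans (mul_le_mul_of_nonneg_right hMB (R.pos n w).le)
    · refine idx_cases (fun w w' => ?_) (fun w w' => hbal w w') fun m w w' => ?_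
      · simp only [glue_inl, Pi.inv_apply]
        rw [← div_eq_mul_inv, le_div_iff₀ (hP w'), inv_mul_le_iff₀ (hP w), mul_comm]
        exact hbal w' w
      · simp only [glue_idxSucc]
        exact (R.bal m w w').trans (mul_le_mul_of_nonneg_right hMB (R.pos m w').le)
    · rw [htop]
      refine idx_cases (fun w => ?_) (fun w => hpp w) fun m w => ?_
      · simp only [glue_inl, Pi.inv_apply, mul_inv_cancel₀ (hP w).ne']
        exact h1B
      · simp only [glue_idxSucc]
        exact hpa m w
    · rw [htop]
      refine idx_cases (fun w => hpinv w) (fun w => ?_) fun m w => ?_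
      · exact le_mul_of_one_le_left (hP w).le h1B
      · simp only [glue_idxSucc]
        exact hpa' m w
    · exact fun w => (hpDM w).trans hB2
    · exact hbal

end ReducedSiegel

section SiegelFinite

open NumberField

variable {g : ℕ} {K : Type} [Field K] [NumberField K]

/-- Only finitely many elements with a given denominator move a Siegel domain to a point of
itself. -/
theorem finite_siegelDom_near (C : ℝ) (g : ℕ) (m : ℕ) (hm : m ≠ 0) :
    {c : Sp g K | HasDenom (intRing K) m c.1 ∧
      ∃ h ∈ siegelDom (realPlaces K) C g, c • h ∈ siegelDom (realPlaces K) C g}.Finite := by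
  obtain ⟨M, hM, H⟩ := exists_hermReduced (T := realPlaces K) C g
  have hm0 : (0 : ℝ) < m := by positivity
  have hmK : (m : K) ≠ 0 := by exact_mod_cast hm
  have hmn : ∀ w, ‖archHom K (m : K) w‖ = m := fun w => by
    rw [map_natCast]
    simp
  set N : ℝ := (Fintype.card ((Fin g ⊕ Fin g) × (Fin g ⊕ Fin g)) : ℝ)
  set B : ℝ := N * (M * M) * (N * (M * M) * M ^ 3 / (m : ℝ)⁻¹)
  have hfin := finite_of_archHom_le (K := K) (m * B)
  have hfin2 : {x : K | (m : K) * x ∈ {x : K | IsIntegral ℤ x ∧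
      ∀ w, ‖archHom K x w‖ ≤ m * B}}.Finite :=
    hfin.preimage (mul_right_injective₀ hmK).injOn
  have hfin3 : {c : Matrix (Fin g ⊕ Fin g) (Fin g ⊕ Fin g) K | ∀ i j, c i j ∈
      {x : K | (m : K) * x ∈ {x : K | IsIntegral ℤ x ∧ ∀ w, ‖archHom K x w‖ ≤ m * B}}}.Finite := by
    have := Set.Finite.pi' fun _ : Fin g ⊕ Fin g => Set.Finite.pi' fun _ : Fin g ⊕ Fin g => hfin2
    exact this
  refine (hfin3.preimage (f := Subtype.val) Subtype.val_injective.injOn).subset ?_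
  rintro c ⟨hc, h, hh, hch⟩ i j
  refine ⟨hc i j, fun w => ?_⟩
  obtain ⟨n, n', a, R, -⟩ := H h hh
  obtain ⟨n₂, n₂', a₂, R₂, -⟩ := H _ hch
  have hcc : archMat c.1 * archMat (c⁻¹).1 = 1 := by
    rw [← archMat_mul, ← Submonoid.coe_mul, mul_inv_cancel, OneMemClass.coe_one, archMat_one]
  have key := R.norm_le R₂ hM (c := archMat c.1) rfl hcc (δ := (m : ℝ)⁻¹) (inv_pos.2 hm0)
    (fun k l hkl => ?_) i j w
  · rw [map_mul, Pi.mul_apply, norm_mul, hmn]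
    exact mul_le_mul_of_nonneg_left key hm0.le
  · have h0 : (m : K) * (c⁻¹).1 k l ≠ 0 := by
      refine mul_ne_zero hmK fun h0 => hkl ?_
      show archHom K _ = 0
      rw [h0, map_zero]
    obtain ⟨w, hw⟩ := exists_one_le_archHom (hc.inv k l) h0
    refine ⟨w, ?_⟩
    rw [map_mul, Pi.mul_apply, norm_mul, hmn] at hw
    rw [inv_le_iff_one_le_mul₀' hm0]
    exact hw

end SiegelFinite

section Minkowski

open NumberField NumberField.InfinitePlace

variable {K : Type} [Field K] [NumberField K]

variable (K) in
/-- There are nonzero integers in every box of large enough volume. -/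
theorem exists_integer_mem_box : ∃ B : ℝ, 1 ≤ B ∧ ∀ f : InfinitePlace K → ℝ, (∀ w, 0 < f w) →
    B ≤ ∏ w, f w ^ mult w → ∃ a : K, IsIntegral ℤ a ∧ a ≠ 0 ∧ ∀ w : InfinitePlace K, w a < f w := by
  set M := mixedEmbedding.minkowskiBound K ↑(1 : (FractionalIdeal (nonZeroDivisors (𝓞 K)) K)ˣ)
  have hM : M < ⊤ := mixedEmbedding.minkowskiBound_lt_top K _
  refine ⟨M.toReal + 1, by simp, fun f hf hB => ?_⟩
  lift f to InfinitePlace K → NNReal using fun w => (hf w).le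
  obtain ⟨a, h0, ha⟩ := mixedEmbedding.exists_ne_zero_mem_ringOfIntegers_lt K (f := f) (by
    rw [mixedEmbedding.convexBodyLT_volume]
    have h1 : M < ((∏ w, f w ^ mult w : NNReal) : ENNReal) := by
      rw [← ENNReal.ofReal_toReal hM.ne, ← ENNReal.ofReal_coe_nnreal]
      refine (ENNReal.ofReal_lt_ofReal_iff_of_nonneg ENNReal.toReal_nonneg).2 ?_
      push_cast
      push_cast at hB
      linarith
    refine h1.trans_le ?_
    refine le_mul_of_one_le_left zero_le ?_
    exact_mod_cast mixedEmbedding.one_le_convexBodyLTFactor K)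
  exact ⟨a, a.2, fun h => h0 (RingOfIntegers.coe_eq_zero_iff.1 h), ha⟩

/-- A positive function on the infinite places which is constant up to a bounded factor. -/
def IsBalanced (B : ℝ) (q : InfinitePlace K → ℝ) : Prop := ∀ w w', q w ≤ B * q w'

theorem prod_mult_pos {q : InfinitePlace K → ℝ} (hq : ∀ w, 0 < q w) :
    0 < ∏ w, q w ^ mult w := Finset.prod_pos fun w _ => pow_pos (hq w) _

theorem prod_mult_mono {q r : InfinitePlace K → ℝ} (hq : ∀ w, 0 ≤ q w) (h : ∀ w, q w ≤ r w) :
    ∏ w, q w ^ mult w ≤ ∏ w, r w ^ mult w :=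
  Finset.prod_le_prod (fun w _ => pow_nonneg (hq w) _) fun w _ => pow_le_pow_left₀ (hq w) (h w) _

theorem prod_mult_mul (q r : InfinitePlace K → ℝ) :
    ∏ w, (q w * r w) ^ mult w = (∏ w, q w ^ mult w) * ∏ w, r w ^ mult w := by
  simp only [mul_pow, Finset.prod_mul_distrib]

theorem prod_mult_sq (q : InfinitePlace K → ℝ) :
    ∏ w, (q w ^ 2) ^ mult w = (∏ w, q w ^ mult w) ^ 2 := by
  rw [← Finset.prod_pow]
  exact Finset.prod_congr rfl fun w _ => by rw [← pow_mul, ← pow_mul, mul_comm]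

theorem prod_mult_const (c : ℝ) :
    ∏ w : InfinitePlace K, c ^ mult w = c ^ Module.finrank ℚ K := by
  rw [Finset.prod_pow_eq_pow_sum, sum_mult_eq]

/-- If all `q w` are at most one, each is at least the product. -/
theorem prod_mult_le {q : InfinitePlace K → ℝ} (hq : ∀ w, 0 < q w) (h1 : ∀ w, q w ≤ 1)
    (w : InfinitePlace K) : ∏ v, q v ^ mult v ≤ q w := by
  classical
  rw [← Finset.mul_prod_erase _ _ (Finset.mem_univ w)]
  calc _ ≤ q w ^ mult w * 1 := by
        refine mul_le_mul_of_nonneg_left ?_ (pow_pos (hq w) _).le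
        exact Finset.prod_le_one (fun v _ => (pow_pos (hq v) _).le)
          fun v _ => pow_le_one₀ (hq v).le (h1 v)
    _ ≤ q w := by
        rw [mul_one]
        exact pow_le_of_le_one (hq w).le (h1 w) mult_pos.ne'

variable (K) in
/-- Every positive function on the infinite places becomes balanced after multiplication by the
square of a nonzero integer of bounded norm. -/
theorem exists_balance : ∃ B : ℝ, 1 ≤ B ∧ ∀ q : InfinitePlace K → ℝ, (∀ w, 0 < q w) →
    ∃ a : K, IsIntegral ℤ a ∧ a ≠ 0 ∧ IsBalanced B (fun w => w a ^ 2 * q w) ∧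
      (∏ w : InfinitePlace K, (w a ^ 2) ^ mult w) ≤ B := by
  obtain ⟨B, hB, H⟩ := exists_integer_mem_box K
  have hB0 : 0 < B := by linarith
  refine ⟨B ^ 2, one_le_pow₀ hB, fun q hq => ?_⟩
  set P := ∏ w, q w ^ mult w with hP
  have hP0 : 0 < P := prod_mult_pos hq
  have hn : Module.finrank ℚ K ≠ 0 := Module.finrank_pos.ne'
  -- the bound `L` for the balanced function
  obtain ⟨L, hL0, hL⟩ : ∃ L : ℝ, 0 < L ∧ L ^ Module.finrank ℚ K = B ^ 2 * P :=
    ⟨(B ^ 2 * P) ^ ((Module.finrank ℚ K : ℝ)⁻¹), by positivity,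
      Real.rpow_inv_natCast_pow (by positivity) hn⟩
  have hf : ∏ w, (Real.sqrt (L / q w)) ^ mult w = B := by
    refine (sq_eq_sq₀ (prod_mult_pos fun w => Real.sqrt_pos.2 (div_pos hL0 (hq w))).le hB0.le).1 ?_
    rw [← prod_mult_sq]
    simp only [Real.sq_sqrt (div_pos hL0 (hq _)).le, div_pow, Finset.prod_div_distrib]
    rw [prod_mult_const, hL, ← hP, mul_div_cancel_right₀ _ hP0.ne']
  obtain ⟨a, ha, h0, hlt⟩ := H (fun w => Real.sqrt (L / q w))
    (fun w => Real.sqrt_pos.2 (div_pos hL0 (hq w))) hf.ge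
  have hpos : ∀ w : InfinitePlace K, 0 < w a := fun w => InfinitePlace.pos_iff.2 h0
  have hlt' : ∀ w : InfinitePlace K, w a ^ 2 ≤ L / q w := fun w => by
    rw [← Real.sq_sqrt (div_pos hL0 (hq w)).le]
    exact pow_le_pow_left₀ (hpos w).le (hlt w).le 2
  have hle : ∀ w : InfinitePlace K, w a ^ 2 * q w / L ≤ 1 := fun w => by
    rw [div_le_one hL0]
    exact (le_div_iff₀ (hq w)).1 (hlt' w)
  refine ⟨a, ha, h0, fun w w' => ?_, ?_⟩
  · have h1 := prod_mult_le (q := fun w : InfinitePlace K => w a ^ 2 * q w / L)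
      (fun w => by have := hpos w; have := hq w; positivity) hle w'
    simp only [div_pow, Finset.prod_div_distrib, prod_mult_const, hL, prod_mult_mul, ← hP] at h1
    rw [mul_div_mul_right _ _ hP0.ne', prod_mult_sq, prod_eq_abs_norm] at h1
    have h2 : 1 ≤ |(Algebra.norm ℚ a : ℚ)| := by
      have hz := Algebra.isIntegral_norm ℚ ha
      obtain ⟨z, hz⟩ := IsIntegrallyClosed.isIntegral_iff.1 hz
      rw [← hz]
      have : z ≠ 0 := by
        rintro rfl
        rw [map_zero] at hz
        exact h0 (Algebra.norm_eq_zero_iff.1 hz.symm)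
      simpa using (by exact_mod_cast Int.one_le_abs this : (1 : ℚ) ≤ |(z : ℚ)|)
    have h3 : (1 : ℝ) ≤ ((|(Algebra.norm ℚ a : ℚ)| : ℚ) : ℝ) := by exact_mod_cast h2
    have h4 : 1 / B ^ 2 ≤ w' a ^ 2 * q w' / L :=
      (div_le_div_of_nonneg_right (one_le_pow₀ h3) (by positivity)).trans h1
    rw [div_le_div_iff₀ (by positivity) hL0, one_mul] at h4
    calc w a ^ 2 * q w ≤ L := (div_le_one hL0).1 (hle w)
      _ ≤ _ := by rw [mul_comm]; exact h4
  · rw [prod_mult_sq, ← hf]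
    refine pow_le_pow_left₀ (prod_mult_pos hpos).le ?_ 2
    exact prod_mult_mono (fun w => (hpos w).le) fun w => (hlt w).le

/-- The ideals generated by the entries of vectors which cannot be shrunk much by scalars contain
a common positive integer. -/
theorem exists_mem_span_of_minimal (B : ℝ) : ∃ m : ℕ, m ≠ 0 ∧ ∀ {ι : Type} [Finite ι] (y : ι → 𝓞 K),
    y ≠ 0 → (∀ t : K, t ≠ 0 → (∀ i, IsIntegral ℤ (t * y i)) →
      1 ≤ B * ∏ w : InfinitePlace K, (w t ^ 2) ^ mult w) →
    (m : 𝓞 K) ∈ Ideal.span (Set.range y) := by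
  set c : ℝ := (4 / Real.pi) ^ nrComplexPlaces K *
        (Module.finrank ℚ K).factorial / (Module.finrank ℚ K) ^ (Module.finrank ℚ K) *
        Real.sqrt |discr K|
  obtain ⟨N, hN⟩ := exists_nat_ge (B * c ^ 2)
  refine ⟨N.factorial, N.factorial_ne_zero, fun {ι} _ y hy H => ?_⟩
  set J := Ideal.span (Set.range y) with hJdef
  have hJ : J ≠ ⊥ := by
    intro h
    refine hy (funext fun i => ?_)
    have : y i ∈ J := Ideal.subset_span ⟨i, rfl⟩
    rwa [h, Ideal.mem_bot] at this
  have hJ' : (J : FractionalIdeal (nonZeroDivisors (𝓞 K)) K) ≠ 0 :=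
    FractionalIdeal.coeIdeal_ne_zero.2 hJ
  obtain ⟨t, htm, ht0, htn⟩ := exists_ne_zero_mem_ideal_of_norm_le_mul_sqrt_discr K
    (Units.mk0 _ hJ')⁻¹
  rw [Units.val_inv_eq_inv_val, Units.val_mk0] at htm htn
  have hint : ∀ i, IsIntegral ℤ (t * y i) := fun i => by
    have h1 := FractionalIdeal.mul_mem_mul htm
      (FractionalIdeal.mem_coeIdeal_of_mem (nonZeroDivisors (𝓞 K))
        (Ideal.subset_span ⟨i, rfl⟩ : y i ∈ J) : algebraMap (𝓞 K) K (y i) ∈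
          (J : FractionalIdeal (nonZeroDivisors (𝓞 K)) K))
    rw [inv_mul_cancel₀ hJ'] at h1
    obtain ⟨x, hx⟩ := (FractionalIdeal.mem_one_iff _).1 h1
    rw [RingOfIntegers.coe_eq_algebraMap, ← hx]
    exact x.2
  have h1 := H t ht0 hint
  rw [prod_mult_sq, prod_eq_abs_norm] at h1
  have hpos : 0 < Ideal.absNorm J := Nat.pos_of_ne_zero fun h => hJ (Ideal.absNorm_eq_zero_iff.1 h)
  rw [map_inv₀, FractionalIdeal.coeIdeal_absNorm] at htn
  push_cast at htn
  have hposR : (0 : ℝ) < Ideal.absNorm J := by exact_mod_cast hpos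
  have htn' : |(Algebra.norm ℚ t : ℝ)| ≤ c / Ideal.absNorm J := by
    refine htn.trans (le_of_eq ?_)
    simp only [c]
    ring
  have hB : 0 ≤ B := by
    by_contra h
    push Not at h
    have : B * ((|(Algebra.norm ℚ t : ℚ)| : ℚ) : ℝ) ^ 2 ≤ 0 :=
      mul_nonpos_of_nonpos_of_nonneg h.le (by positivity)
    linarith
  have hle : Ideal.absNorm J ≤ N := by
    have h2 : (1 : ℝ) ≤ B * (c / Ideal.absNorm J) ^ 2 := by
      refine h1.trans (mul_le_mul_of_nonneg_left (pow_le_pow_left₀ (by positivity) ?_ 2) hB)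
      push_cast
      exact htn'
    have h3 : ((Ideal.absNorm J : ℝ)) ^ 2 ≤ B * c ^ 2 := by
      rw [div_pow, ← mul_div_assoc, le_div_iff₀ (by positivity), one_mul] at h2
      exact h2
    have h4 : (1 : ℝ) ≤ Ideal.absNorm J := by exact_mod_cast hpos
    have h5 : (Ideal.absNorm J : ℝ) ≤ N := by nlinarith
    exact_mod_cast h5
  obtain ⟨k, hk⟩ := Nat.dvd_factorial hpos hle
  rw [hk]
  push_cast
  exact Ideal.mul_mem_right _ _ (Ideal.absNorm_mem J)

end Minkowski

section Frame

variable {g : ℕ} {A K : Type} [CommRing A] [Field K] [Algebra A K]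

/-- Splitting off a plane from a lattice and choosing a basis of the complement gives a symplectic
matrix. -/
theorem exists_Sp_of_dual [IsDedekindDomain A] [IsFractionRing A K]
    {Λ : Submodule A (Fin (g + 1) ⊕ Fin (g + 1) → K)}
    (hspan : Submodule.span K (Λ : Set (Fin (g + 1) ⊕ Fin (g + 1) → K)) = ⊤)
    (hΛ : IsUnimod (sform (g + 1) K) Λ) {x z : Fin (g + 1) ⊕ Fin (g + 1) → K}
    (hzx : sform (g + 1) K z x = 1)
    (hdec : ∀ y ∈ Λ, sform (g + 1) K z y • x + sform (g + 1) K y x • z ∈ Λ) :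
    ∃ c ∈ Sp (g + 1) K, c (Sum.inr 0) = x ∧ c (Sum.inl 0) = z ∧ ∀ m, c (idxSucc m) ∈ Λ := by
  set ω := sform (g + 1) K
  have hω : ω.IsAlt := sform_isAlt
  have hxz : ω x z = -1 := by rw [← hω.neg, hzx]
  obtain ⟨n, e, f, hB⟩ := (hΛ.orthPair hω hzx hdec).exists_basis hω
  have hB' : IsSymplBasis ω ((⊤ : Submodule K (Fin (g + 1) ⊕ Fin (g + 1) → K)).orthPair ω x z) e f := by
    refine ⟨hB.toIsSympl, fun i => ⟨trivial, (hB.mem_e i).2⟩, fun i => ⟨trivial, (hB.mem_f i).2⟩, ?_⟩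
    let P : (Fin (g + 1) ⊕ Fin (g + 1) → K) →ₗ[K] (Fin (g + 1) ⊕ Fin (g + 1) → K) :=
      (ω z).smulRight x + (ω.flip x).smulRight z
    let L : (Fin (g + 1) ⊕ Fin (g + 1) → K) →ₗ[K] (Fin (g + 1) ⊕ Fin (g + 1) → K) :=
      ∑ i, ((ω.flip (f i)).smulRight (e i) + (ω (e i)).smulRight (f i))
    have hLapp : ∀ v, L v = ∑ i, (ω v (f i) • e i + ω (e i) v • f i) := fun v => by
      simp [L, LinearMap.sum_apply]
    have hP : ∀ v, P v = ω z v • x + ω v x • z := fun v => rfl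
    have hLx : L x = 0 := by
      rw [hLapp]
      refine Finset.sum_eq_zero fun i _ => ?_
      rw [(hB.mem_f i).2.1, ← hω.neg, (hB.mem_e i).2.1]
      simp
    have hLz : L z = 0 := by
      rw [hLapp]
      refine Finset.sum_eq_zero fun i _ => ?_
      rw [(hB.mem_f i).2.2, ← hω.neg, (hB.mem_e i).2.2]
      simp
    have key : (LinearMap.id : _ →ₗ[K] (Fin (g + 1) ⊕ Fin (g + 1) → K)) = P + L := by
      refine LinearMap.ext_on hspan fun v hv => ?_
      have h1 : v - P v ∈ Λ.orthPair ω x z := by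
        refine ⟨sub_mem hv (hdec v hv), ?_, ?_⟩
        · simp [hP, hω.self_eq_zero, hxz, ← hω.neg x v]
        · simp [hP, hω.self_eq_zero, hzx]
      have h2 := hB.expand _ h1
      rw [← hLapp, map_sub, hP v, map_add, map_smul, map_smul, hLx, hLz, smul_zero, smul_zero,
        add_zero, sub_zero, ← hP] at h2
      rw [LinearMap.id_apply, LinearMap.add_apply, ← h2]
      abel
    intro v hv
    have h1 := LinearMap.congr_fun key v
    rw [LinearMap.add_apply, hLapp, hP, hv.2.2, ← hω.neg, hv.2.1] at h1
    simpa using h1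
  have hcons := IsUnimod.basis_cons hω (e₀ := z) (f₀ := x)
    (Submodule.mem_top (R := K)) Submodule.mem_top hzx
    (fun _ _ => Submodule.mem_top) hB'
  obtain rfl : n = g := by
    have := hcons.card_eq (by simp)
    omega
  refine ⟨(colMat _ _)ᵀ, SymplecticGroup.transpose_mem (colMat_mem hcons.ee hcons.ff hcons.ef),
    rfl, rfl, ?_⟩
  rintro (i | i)
  · exact (hB.mem_e i).1
  · exact (hB.mem_f i).1

/-- A nonzero integral vector is a row of a symplectic matrix, with denominators in the ideal
generated by its entries. -/
theorem exists_Sp_row [IsDedekindDomain A] [IsFractionRing A K]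
    {y : Fin (g + 1) ⊕ Fin (g + 1) → A} (hy : y ≠ 0) {m : A} (hm : m ∈ Ideal.span (Set.range y)) :
    ∃ c ∈ Sp (g + 1) K, (∀ a, c (Sum.inr 0) a = algebraMap A K (y a)) ∧
      ∀ a b, algebraMap A K m * c a b ∈ (algebraMap A K).range := by
  have hinj : Function.Injective (algebraMap A K) := IsFractionRing.injective A K
  have hΛ : IsUnimod (sform (g + 1) K) (stdLattice (g + 1) A K) := isUnimod_stdLattice
  obtain ⟨z, hz1, hz2, hz3⟩ := hΛ.exists_dual_vector sform_isAlt (map_mem_stdLattice y) (by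
    intro h
    refine hy (funext fun i => hinj ?_)
    rw [Pi.zero_apply, map_zero]
    exact congrFun h i)
  obtain ⟨c, hc, hx, hzc, hr⟩ := exists_Sp_of_dual span_stdLattice hΛ hz1 hz2
  have hmz : m • z ∈ stdLattice (g + 1) A K := by
    induction hm using Submodule.span_induction with
    | mem a ha =>
      obtain ⟨i, rfl⟩ := ha
      rw [← algebraMap_smul K]
      rcases i with i | i
      · have := hz3 _ (single_mem_stdLattice (Sum.inr i))
        rwa [sform_swap, sform_single_inr, neg_smul, Submodule.neg_mem_iff] at this
      · have := hz3 _ (single_mem_stdLattice (Sum.inl i))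
        rwa [sform_swap, sform_single_inl, neg_neg] at this
    | zero => rw [zero_smul]; exact zero_mem _
    | add a b _ _ ha hb => rw [add_smul]; exact add_mem ha hb
    | smul a b _ hb => rw [smul_eq_mul, mul_smul]; exact Submodule.smul_mem _ _ hb
  refine ⟨c, hc, fun a => congrFun hx a, ?_⟩
  refine idx_cases (fun b => ?_) (fun b => ?_) fun a b => ?_
  · have := mem_stdLattice.1 hmz b
    rwa [Pi.smul_apply, Algebra.smul_def, ← hzc] at this
  · rw [hx]
    exact ⟨m * y b, map_mul _ _ _⟩
  · exact mul_mem ⟨m, rfl⟩ (mem_stdLattice.1 (hr a) b)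

end Frame

section NearMin

open NumberField NumberField.InfinitePlace

theorem qform_smul {W ι : Type} [Fintype ι] (h : Matrix ι ι (W → ℂ)) (w : W) (c : ℂ) (x : ι → ℂ) :
    qform h w (c • x) = ‖c‖ ^ 2 * qform h w x := by
  have h1 : c * star c = ((‖c‖ ^ 2 : ℝ) : ℂ) := by
    rw [← starRingEnd_apply, Complex.mul_conj, Complex.normSq_eq_norm_sq]
  rw [qform, star_smul, Matrix.mulVec_smul, dotProduct_smul, smul_dotProduct, smul_smul,
    mul_comm (star c), h1, smul_eq_mul, Complex.re_ofReal_mul, qform]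

theorem exists_le_qform {W ι : Type} [Fintype ι] [Finite W] {h : Matrix ι ι (W → ℂ)}
    (hpos : ∀ w x, x ≠ 0 → 0 < qform h w x) :
    ∃ ε > 0, ∀ w x, ε * ‖x‖ ^ 2 ≤ qform h w x := by
  have H : ∀ w, ∃ ε > 0, ∀ x, ε * ‖x‖ ^ 2 ≤ qform h w x := by
    intro w
    have hcont : Continuous fun x : ι → ℂ => qform h w x := by
      simp only [qform_eq_sum]
      fun_prop
    rcases (Metric.sphere (0 : ι → ℂ) 1).eq_empty_or_nonempty with he | hne
    · refine ⟨1, one_pos, fun x => ?_⟩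
      rcases eq_or_ne x 0 with rfl | hx
      · simp [qform_zero]
      · exfalso
        have : ((‖x‖ : ℂ)⁻¹ • x) ∈ Metric.sphere (0 : ι → ℂ) 1 := by
          rw [mem_sphere_zero_iff_norm, norm_smul, norm_inv, Complex.norm_real, norm_norm,
            inv_mul_cancel₀ (norm_ne_zero_iff.2 hx)]
        rw [he] at this
        exact this
    · obtain ⟨x₀, hx₀, hmin⟩ := (isCompact_sphere (0 : ι → ℂ) 1).exists_isMinOn hne
        hcont.continuousOn
      refine ⟨qform h w x₀, hpos w _ (by rintro rfl; simp at hx₀), fun x => ?_⟩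
      rcases eq_or_ne x 0 with rfl | hx
      · simp [qform_zero]
      · have hn : ‖x‖ ≠ 0 := norm_ne_zero_iff.2 hx
        have hs : ((‖x‖ : ℂ)⁻¹ • x) ∈ Metric.sphere (0 : ι → ℂ) 1 := by
          rw [mem_sphere_zero_iff_norm, norm_smul, norm_inv, Complex.norm_real, norm_norm,
            inv_mul_cancel₀ hn]
        have h1 : qform h w x₀ ≤ qform h w ((‖x‖ : ℂ)⁻¹ • x) := hmin hs
        rw [qform_smul, norm_inv, Complex.norm_real, norm_norm, inv_pow] at h1
        have hp : 0 < ‖x‖ ^ 2 := by positivity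
        rw [mul_comm]
        calc _ ≤ ‖x‖ ^ 2 * ((‖x‖ ^ 2)⁻¹ * qform h w x) := mul_le_mul_of_nonneg_left h1 hp.le
          _ = _ := by rw [← mul_assoc, mul_inv_cancel₀ hp.ne', one_mul]
  choose ε hε H using H
  rcases isEmpty_or_nonempty W with hW | hW
  · exact ⟨1, one_pos, fun w => isEmptyElim w⟩
  · obtain ⟨w₀, hw₀⟩ := Finite.exists_min ε
    exact ⟨ε w₀, hε w₀, fun w x =>
      (mul_le_mul_of_nonneg_right (hw₀ w) (by positivity)).trans (H w x)⟩

variable {K : Type} [Field K] {ι : Type} [Fintype ι]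

/-- The value of a family of hermitian forms on a vector over `K`. -/
def hval (h : Matrix ι ι (InfinitePlace K → ℂ)) (y : ι → K) (w : InfinitePlace K) : ℝ :=
  qform h w fun i => archHom K (y i) w

theorem hval_smul (h : Matrix ι ι (InfinitePlace K → ℂ)) (a : K) (y : ι → K)
    (w : InfinitePlace K) : hval h (a • y) w = w a ^ 2 * hval h y w := by
  rw [hval, hval, ← norm_archHom, ← qform_smul]
  congr 1
  funext i
  simp

theorem hval_conj (c h : Matrix ι ι (InfinitePlace K → ℂ)) (d : Matrix ι ι K) (hc : c = archMat d)
    (y : ι → K) : hval (c * h * cᴴ) y = hval h (y ᵥ* d) := by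
  subst hc
  funext w
  rw [hval, hval, qform_conj]
  congr 1
  funext i
  simp [Matrix.vecMul, dotProduct, archMat]

theorem hval_single [DecidableEq ι] (h : Matrix ι ι (InfinitePlace K → ℂ)) (a : ι)
    (w : InfinitePlace K) : hval h (Pi.single a 1) w = (h a a w).re := by
  have : (fun i => archHom K ((Pi.single a 1 : ι → K) i) w) = Pi.single a 1 := by
    funext i
    rcases eq_or_ne i a with rfl | hi
    · simp
    · simp [hi]
  rw [hval, this, qform]
  simp

variable [NumberField K]

theorem one_le_prod_of_isIntegral {a : K} (ha : IsIntegral ℤ a) (h0 : a ≠ 0) :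
    1 ≤ ∏ w : InfinitePlace K, w a ^ mult w := by
  rw [prod_eq_abs_norm]
  obtain ⟨z, hz⟩ := IsIntegrallyClosed.isIntegral_iff.1 (Algebra.isIntegral_norm ℚ ha)
  rw [← hz, eq_intCast]
  have hz0 : z ≠ 0 := by
    rintro rfl
    rw [map_zero] at hz
    exact h0 (Algebra.norm_eq_zero_iff.1 hz.symm)
  have : (1 : ℚ) ≤ |(z : ℚ)| := by exact_mod_cast Int.one_le_abs hz0
  exact_mod_cast this

/-- The product of all values of a family of hermitian forms. -/
def hnorm (h : Matrix ι ι (InfinitePlace K → ℂ)) (y : ι → K) : ℝ := ∏ w, hval h y w ^ mult w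

omit [NumberField K] in
theorem hval_pos {h : Matrix ι ι (InfinitePlace K → ℂ)}
    (hpos : ∀ w x, x ≠ 0 → 0 < qform h w x) {y : ι → K} (hy : y ≠ 0) (w : InfinitePlace K) :
    0 < hval h y w := by
  refine hpos w _ fun h0 => hy (funext fun i => ?_)
  have := congrFun h0 i
  have h1 : w (y i) = 0 := by
    rw [← norm_archHom, this, Pi.zero_apply, norm_zero]
  exact (map_eq_zero w).1 h1

theorem hnorm_smul (h : Matrix ι ι (InfinitePlace K → ℂ)) (a : K) (y : ι → K) :
    hnorm h (a • y) = (∏ w : InfinitePlace K, (w a ^ 2) ^ mult w) * hnorm h y := by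
  simp only [hnorm, hval_smul]
  exact prod_mult_mul _ _

theorem exists_le_hnorm {h : Matrix ι ι (InfinitePlace K → ℂ)}
    (hpos : ∀ w x, x ≠ 0 → 0 < qform h w x) :
    ∃ δ > 0, ∀ y : ι → K, (∀ i, IsIntegral ℤ (y i)) → y ≠ 0 → δ ≤ hnorm h y := by
  obtain ⟨ε, hε, H⟩ := exists_le_qform hpos
  refine ⟨ε ^ Module.finrank ℚ K, by positivity, fun y hy h0 => ?_⟩
  obtain ⟨i, hi⟩ : ∃ i, y i ≠ 0 := by
    by_contra! hall
    exact h0 (funext hall)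
  have h1 := one_le_prod_of_isIntegral (hy i) hi
  calc ε ^ Module.finrank ℚ K
      ≤ ε ^ Module.finrank ℚ K * (∏ w : InfinitePlace K, w (y i) ^ mult w) ^ 2 :=
        le_mul_of_one_le_right (by positivity) (one_le_pow₀ h1)
    _ = ∏ w : InfinitePlace K, (ε * w (y i) ^ 2) ^ mult w := by
        rw [prod_mult_mul (fun _ => ε), prod_mult_const, prod_mult_sq]
    _ ≤ hnorm h y := by
        refine prod_mult_mono (fun w => by positivity) fun w => ?_
        refine le_trans ?_ (H w _)
        refine mul_le_mul_of_nonneg_left (pow_le_pow_left₀ (by positivity) ?_ 2) hε.le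
        rw [← norm_archHom]
        exact norm_le_pi_norm (fun i => archHom K (y i) w) i

/-- A balanced vector which is minimal among integral vectors up to a bounded factor. -/
structure IsNearMin (B : ℝ) (h : Matrix ι ι (InfinitePlace K → ℂ)) (y : ι → K) : Prop where
  bal : IsBalanced B (hval h y)
  le : ∀ x : ι → K, (∀ i, IsIntegral ℤ (x i)) → x ≠ 0 → hnorm h y ≤ B * hnorm h x

variable (K) in
theorem exists_isNearMin : ∃ B : ℝ, 1 ≤ B ∧ ∀ (ι : Type) [Fintype ι] [Nonempty ι]
    (h : Matrix ι ι (InfinitePlace K → ℂ)), (∀ w x, x ≠ 0 → 0 < qform h w x) →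
    ∃ y : ι → K, (∀ i, IsIntegral ℤ (y i)) ∧ y ≠ 0 ∧ IsNearMin B h y := by
  obtain ⟨B, hB, H⟩ := exists_balance K
  refine ⟨B * 2, by linarith, fun ι _ hne h hpos => ?_⟩
  obtain ⟨δ, hδ, hle⟩ := exists_le_hnorm hpos
  set S : Set ℝ := hnorm h '' {y : ι → K | (∀ i, IsIntegral ℤ (y i)) ∧ y ≠ 0} with hS
  have hSne : S.Nonempty := ⟨_, fun _ => 1, ⟨fun _ => isIntegral_one, fun h0 =>
    one_ne_zero (congrFun h0 (Classical.arbitrary ι))⟩, rfl⟩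
  have hSbd : BddBelow S := ⟨δ, by rintro _ ⟨y, hy, rfl⟩; exact hle y hy.1 hy.2⟩
  have hinf : δ ≤ sInf S := le_csInf hSne (by rintro _ ⟨y, hy, rfl⟩; exact hle y hy.1 hy.2)
  obtain ⟨_, ⟨y, ⟨hyi, hy0⟩, rfl⟩, hlt⟩ := exists_lt_of_csInf_lt hSne
    (show sInf S < 2 * sInf S by linarith)
  obtain ⟨a, ha, ha0, hbal, hprod⟩ := H (hval h y) fun w => hval_pos hpos hy0 w
  refine ⟨a • y, fun i => ha.mul (hyi i), smul_ne_zero ha0 hy0, ?_, ?_⟩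
  · intro w w'
    rw [hval_smul, hval_smul]
    refine (hbal w w').trans ?_
    have := hval_pos hpos hy0 w'
    refine mul_le_mul_of_nonneg_right (by linarith) (by positivity)
  · intro x hx hx0
    rw [hnorm_smul]
    have h1 : sInf S ≤ hnorm h x := csInf_le hSbd ⟨x, ⟨hx, hx0⟩, rfl⟩
    have h2 : 0 ≤ hnorm h y := hδ.le.trans (hle y hyi hy0)
    calc _ ≤ B * hnorm h y := mul_le_mul_of_nonneg_right hprod h2
      _ ≤ B * (2 * hnorm h x) := mul_le_mul_of_nonneg_left (by linarith) (by linarith)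
      _ = _ := by ring

variable {g : ℕ}

/-- The bottom height of a point in the symmetric space is nearly minimal. -/
def IsReducedAt (B : ℝ) (h : SymSpace (g + 1) K) : Prop :=
  IsNearMin B h.1 (Pi.single (Sum.inr 0) 1)

omit [NumberField K] in
theorem coordP_eq_hval (h : Matrix (Fin (g + 1) ⊕ Fin (g + 1)) (Fin (g + 1) ⊕ Fin (g + 1))
    (InfinitePlace K → ℂ)) : coordP h = hval h (Pi.single (Sum.inr 0) 1) := by
  funext w
  rw [hval_single, coordP]

/-- A nearly minimal vector stays nearly minimal under matrices with bounded denominators. -/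
theorem IsNearMin.transfer [DecidableEq ι] {B : ℝ} (hB : 0 ≤ B)
    {h h' : Matrix ι ι (InfinitePlace K → ℂ)} {y y' : ι → K} (H : IsNearMin B h y) {m : ℕ}
    (hm : m ≠ 0) {d d' : Matrix ι ι K} (hd : d * d' = 1) (hm' : HasDenom (intRing K) m d)
    (hpos : ∀ w x, x ≠ 0 → 0 < qform h w x) (hy : y ≠ 0)
    (heq : hval h' y' = hval h y) (hh : ∀ x, hval h' x = hval h (x ᵥ* d)) :
    IsNearMin (B * ∏ w : InfinitePlace K, (w (m : K) ^ 2) ^ mult w) h' y' := by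
  have hmK : (m : K) ≠ 0 := Nat.cast_ne_zero.2 hm
  have hmi : IsIntegral ℤ (m : K) := natCast_mem_intRing m
  have h1 : 1 ≤ ∏ w : InfinitePlace K, (w (m : K) ^ 2) ^ mult w := by
    rw [prod_mult_sq]
    exact one_le_pow₀ (one_le_prod_of_isIntegral hmi hmK)
  constructor
  · intro w w'
    rw [heq]
    exact (H.bal w w').trans (mul_le_mul_of_nonneg_right (le_mul_of_one_le_right hB h1)
      (hval_pos hpos hy w').le)
  · intro x hx hx0
    have h2 := H.le ((m : K) • (x ᵥ* d)) (fun i => by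
      rw [← mem_intRing, Pi.smul_apply, Matrix.vecMul, dotProduct, smul_eq_mul, Finset.mul_sum]
      refine sum_mem fun j _ => ?_
      rw [mul_left_comm]
      exact mul_mem (hx j) (hm' j i)) (by
      refine smul_ne_zero hmK fun h0 => hx0 ?_
      have := congrArg (· ᵥ* d') h0
      simpa [Matrix.vecMul_vecMul, hd] using this)
    rw [hnorm_smul] at h2
    have h3 : hnorm h' x = hnorm h (x ᵥ* d) := by rw [hnorm, hnorm, hh]
    have h4 : hnorm h' y' = hnorm h y := by rw [hnorm, hnorm, heq]
    rw [h4, h3, mul_assoc]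
    exact h2

omit [NumberField K] in
theorem hval_smul_Sp (c : Sp g K) (h : SymSpace g K) (x : Fin g ⊕ Fin g → K) :
    hval (c • h).1 x = hval h.1 (x ᵥ* c.1) := hval_conj _ _ _ rfl x

/-- Elements with bounded denominators preserving the height preserve reducedness. -/
theorem IsReducedAt.smul {B : ℝ} (hB : 0 ≤ B) {h : SymSpace (g + 1) K} (H : IsReducedAt B h)
    {m : ℕ} (hm : m ≠ 0) {c : Sp (g + 1) K} (hc : HasDenom (intRing K) m c.1)
    (hP : coordP (c • h).1 = coordP h.1) :
    IsReducedAt (B * ∏ w : InfinitePlace K, (w (m : K) ^ 2) ^ mult w) (c • h) := by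
  refine H.transfer hB hm (d' := (c⁻¹).1) ?_ hc h.2.pos ?_ ?_ (hval_smul_Sp c h)
  · exact congrArg Subtype.val (mul_inv_cancel c)
  · exact fun h0 => one_ne_zero (α := K) (by simpa using congrFun h0 (Sum.inr 0))
  · rw [← coordP_eq_hval, ← coordP_eq_hval, hP]

variable (K) in
/-- Every point can be moved to a reduced point with bounded denominators. -/
theorem exists_isReducedAt : ∃ (B : ℝ) (m : ℕ), 1 ≤ B ∧ m ≠ 0 ∧ ∀ (g : ℕ) (h : SymSpace (g + 1) K),
    ∃ c : Sp (g + 1) K, HasDenom (intRing K) m c.1 ∧ IsReducedAt B (c • h) := by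
  obtain ⟨B, hB, H⟩ := exists_isNearMin K
  obtain ⟨m, hm, Hm⟩ := exists_mem_span_of_minimal (K := K) B
  have hmi : IsIntegral ℤ (m : K) := natCast_mem_intRing m
  have h1 : 1 ≤ ∏ w : InfinitePlace K, (w (m : K) ^ 2) ^ mult w := by
    rw [prod_mult_sq]
    exact one_le_pow₀ (one_le_prod_of_isIntegral hmi (Nat.cast_ne_zero.2 hm))
  refine ⟨B * ∏ w : InfinitePlace K, (w (m : K) ^ 2) ^ mult w, m,
    one_le_mul_of_one_le_of_one_le hB h1, hm, fun g h => ?_⟩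
  obtain ⟨y, hyi, hy0, hmin⟩ := H _ h.1 h.2.pos
  have hypos : 0 < hnorm h.1 y := prod_mult_pos (hval_pos h.2.pos hy0)
  have hy' : (fun i => (⟨y i, hyi i⟩ : 𝓞 K)) ≠ 0 := fun h0 =>
    hy0 (funext fun i => congrArg Subtype.val (congrFun h0 i))
  have hmem := Hm (fun i => (⟨y i, hyi i⟩ : 𝓞 K)) hy' fun t ht hti => by
    have h2 := hmin.le (t • y) hti (smul_ne_zero ht hy0)
    rw [hnorm_smul, ← mul_assoc] at h2
    exact (le_mul_iff_one_le_left hypos).1 h2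
  obtain ⟨c, hc, hrow, hden⟩ := exists_Sp_row (A := 𝓞 K) (K := K) hy' hmem
  have hden' : HasDenom (intRing K) m c := fun a b => by
    obtain ⟨x, hx⟩ := hden a b
    rw [map_natCast] at hx
    rw [← hx]
    exact x.2
  refine ⟨⟨c, hc⟩, hden', ?_⟩
  refine hmin.transfer (by linarith) hm (d := c) (d' := ((⟨c, hc⟩ : Sp (g + 1) K)⁻¹).1) ?_ hden'
    h.2.pos hy0 ?_ (hval_smul_Sp _ h)
  · exact congrArg Subtype.val (mul_inv_cancel (⟨c, hc⟩ : Sp (g + 1) K))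
  · rw [hval_smul_Sp]
    congr 1
    funext a
    rw [Matrix.single_one_vecMul]
    exact hrow a

end NearMin

section Cocompact

open NumberField InfinitePlace

variable {K : Type} [Field K] [NumberField K]

variable (K) in
/-- The ring of integers is cocompact. -/
theorem exists_integer_norm_add_le : ∃ C : ℝ, 0 ≤ C ∧ ∀ ξ ∈ realAlg (realPlaces K),
    ∃ r : K, IsIntegral ℤ r ∧ ∀ w, ‖archHom K r w + ξ w‖ ≤ C := by
  classical
  refine ⟨∑ i, ‖mixedEmbedding.latticeBasis K i‖, Finset.sum_nonneg fun _ _ => norm_nonneg _,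
    fun ξ hξ => ?_⟩
  set b := mixedEmbedding.latticeBasis K
  set x : mixedEmbedding.mixedSpace K := (fun w => (ξ w.1).re, fun w => ξ w.1) with hx
  obtain ⟨r, hr⟩ : ∃ r : 𝓞 K, mixedEmbedding K r = (ZSpan.floor b x : mixedEmbedding.mixedSpace K) := by
    have := (mixedEmbedding.mem_span_latticeBasis K).1 (ZSpan.floor b x).2
    obtain ⟨r, hr⟩ := this
    exact ⟨r, hr⟩
  have hn : ‖x - mixedEmbedding K r‖ ≤ ∑ i, ‖b i‖ := by
    rw [hr]
    exact ZSpan.norm_fract_le b x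
  refine ⟨-r, (RingOfIntegers.isIntegral_coe r).neg, fun w => ?_⟩
  have key : ∀ w, ‖ξ w - archHom K r w‖ ≤ ‖x - mixedEmbedding K (r : K)‖ := by
    intro w
    rcases w.isReal_or_isComplex with hw | hw
    · refine le_trans (le_of_eq ?_) ((norm_le_pi_norm _ ⟨w, hw⟩).trans (norm_fst_le _))
      rw [Prod.fst_sub, Pi.sub_apply, mixedEmbedding.mixedEmbedding_apply_isReal, ← Complex.norm_real,
        Complex.ofReal_sub, embedding_of_isReal_apply]
      have h1 : ((ξ w).re : ℂ) = ξ w :=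
        Complex.ext (Complex.ofReal_re _)
          (by rw [Complex.ofReal_im, mem_realAlg.1 hξ w hw])
      simp only [hx, h1]
      rfl
    · refine le_trans (le_of_eq ?_) ((norm_le_pi_norm _ ⟨w, hw⟩).trans (norm_snd_le _))
      rw [Prod.snd_sub, Pi.sub_apply, mixedEmbedding.mixedEmbedding_apply_isComplex]
      rfl
  rw [map_neg, Pi.neg_apply, neg_add_eq_sub]
  exact (key w).trans hn

variable (K) in
/-- Dirichlet's theorem on simultaneous approximation. -/
theorem exists_dirichlet {ε : ℝ} (hε : 0 < ε) : ∃ Q : ℕ, ∀ ξ ∈ realAlg (realPlaces K),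
    ∃ s : ℕ, s ≠ 0 ∧ s ≤ Q ∧ ∃ r : K, IsIntegral ℤ r ∧
      ∀ w, ‖(s : ℂ) * ξ w - archHom K r w‖ ≤ ε := by
  obtain ⟨C, hC, H⟩ := exists_integer_norm_add_le K
  obtain ⟨t, -, ht, hcov⟩ := finite_cover_balls_of_compact
    (isCompact_closedBall (0 : InfinitePlace K → ℂ) C) (half_pos hε)
  refine ⟨t.ncard, fun ξ hξ => ?_⟩
  have h1 : ∀ k : ℕ, ∃ r : K, IsIntegral ℤ r ∧ ∀ w, ‖archHom K r w + k * ξ w‖ ≤ C := by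
    intro k
    have hk : (k : InfinitePlace K → ℂ) * ξ ∈ realAlg (realPlaces K) :=
      mul_mem (natCast_mem _ k) hξ
    exact H _ hk
  choose r hr hr' using h1
  have h2 : ∀ k : ℕ, ∃ y ∈ t, dist (archHom K (r k) + (k : InfinitePlace K → ℂ) * ξ) y < ε / 2 := by
    intro k
    have : archHom K (r k) + (k : InfinitePlace K → ℂ) * ξ ∈ Metric.closedBall 0 C := by
      rw [mem_closedBall_zero_iff, pi_norm_le_iff_of_nonneg hC]
      exact hr' k
    obtain ⟨y, hy, hd⟩ := Set.mem_iUnion₂.1 (hcov this)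
    exact ⟨y, hy, hd⟩
  choose y hy hd using h2
  obtain ⟨i, hi, j, hj, hij, he⟩ := Finset.exists_ne_map_eq_of_card_lt_of_maps_to
    (s := Finset.range (t.ncard + 1)) (t := ht.toFinset)
    (by rw [Finset.card_range, Set.ncard_eq_toFinset_card t ht]; exact Nat.lt_succ_self _)
    (fun k _ => (ht.mem_toFinset.2 (hy k) : y k ∈ _))
  wlog hlt : i < j generalizing i j
  · exact this j hj i hi hij.symm he.symm (lt_of_le_of_ne (not_lt.1 hlt) hij.symm)
  refine ⟨j - i, by omega, ?_, r i - r j, (hr i).sub (hr j), fun w => ?_⟩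
  · have := Finset.mem_range.1 hj
    omega
  have h3 := dist_triangle_right (archHom K (r j) + (j : InfinitePlace K → ℂ) * ξ)
    (archHom K (r i) + (i : InfinitePlace K → ℂ) * ξ) (y j)
  have h4 := hd i
  rw [he] at h4
  have h5 := (dist_le_pi_dist (archHom K (r j) + (j : InfinitePlace K → ℂ) * ξ)
    (archHom K (r i) + (i : InfinitePlace K → ℂ) * ξ) w).trans
      (h3.trans (add_le_add (hd j).le h4.le))
  rw [add_halves, dist_eq_norm] at h5
  refine (le_of_eq (congrArg _ ?_)).trans h5
  rw [Nat.cast_sub hlt.le, map_sub, Pi.sub_apply, Pi.add_apply, Pi.add_apply, Pi.mul_apply,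
    Pi.mul_apply, Pi.natCast_apply, Pi.natCast_apply]
  ring

variable (K) in
/-- Near minimality of one vector bounds the quotient of the first two heights. -/
theorem exists_le_mul_of_dirichlet {B : ℝ} (hB : 1 ≤ B) :
    ∃ C : ℝ, ∀ p p' : InfinitePlace K → ℝ, (∀ w, 0 < p w) → (∀ w, 0 < p' w) → IsBalanced B p →
      IsBalanced B p' → ∀ ξ ∈ realAlg (realPlaces K),
      (∀ (s : ℕ) (r : K), s ≠ 0 → IsIntegral ℤ r → ∏ w, p w ^ mult w ≤
        B * ∏ w, (p w * ‖(s : ℂ) * ξ w - archHom K r w‖ ^ 2 + p' w * (s : ℝ) ^ 2) ^ mult w) →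
      ∀ w, p w ≤ C * p' w := by
  have hB0 : 0 < B := by linarith
  obtain ⟨Q, hQ⟩ := exists_dirichlet K (ε := (2 * B)⁻¹) (by positivity)
  set C : ℝ := 4 * B ^ 3 * ((Q : ℝ) ^ 2 + 1) with hCdef
  have hC : 0 < C := by positivity
  refine ⟨C, fun p p' hp hp' hb hb' ξ hξ H w => ?_⟩
  by_contra! hlt
  obtain ⟨s, hs, hsQ, r, hr, hle⟩ := hQ ξ hξ
  have hcmp : ∀ v, p' v * C ≤ B ^ 2 * p v := fun v => by
    have h1 := mul_le_mul_of_nonneg_right (hb' v w) hC.le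
    have h2 := mul_le_mul_of_nonneg_left hlt.le hB0.le
    have h3 := mul_le_mul_of_nonneg_left (hb w v) hB0.le
    nlinarith
  have hterm : ∀ v, p v * ‖(s : ℂ) * ξ v - archHom K r v‖ ^ 2 + p' v * (s : ℝ) ^ 2
      ≤ p v * (2 * B)⁻¹ := by
    intro v
    have h1 : ‖(s : ℂ) * ξ v - archHom K r v‖ ^ 2 ≤ (4 * B)⁻¹ := by
      refine (pow_le_pow_left₀ (norm_nonneg _) (hle v) 2).trans ?_
      rw [inv_pow]
      exact inv_anti₀ (by positivity) (by nlinarith)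
    have h2 : (s : ℝ) ^ 2 ≤ (Q : ℝ) ^ 2 := by gcongr
    have h3 : p' v * (s : ℝ) ^ 2 ≤ p v * (4 * B)⁻¹ := by
      have h4 : p' v * (4 * B ^ 3 * ((Q : ℝ) ^ 2 + 1)) ≤ B ^ 2 * p v := hcmp v
      rw [← div_eq_mul_inv, le_div_iff₀ (by positivity)]
      have h5 : B ^ 2 * (p' v * (4 * B * ((Q : ℝ) ^ 2 + 1))) ≤ B ^ 2 * p v := by nlinarith
      have h6 := le_of_mul_le_mul_left h5 (by positivity)
      have h7 : p' v * (s : ℝ) ^ 2 * (4 * B) ≤ p' v * ((Q : ℝ) ^ 2 + 1) * (4 * B) := by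
        have := (hp' v).le
        gcongr
        linarith
      linarith
    have h4 := mul_le_mul_of_nonneg_left h1 (hp v).le
    have h5 : (2 * B)⁻¹ = (4 * B)⁻¹ + (4 * B)⁻¹ := by
      field_simp
      norm_num
    rw [h5, mul_add]
    linarith
  have h1 := H s r hs hr
  have h2 : ∏ v, (p v * ‖(s : ℂ) * ξ v - archHom K r v‖ ^ 2 + p' v * (s : ℝ) ^ 2) ^ mult v ≤
      (∏ v, p v ^ mult v) * (2 * B)⁻¹ := by
    refine (prod_mult_mono (fun v => ?_) hterm).trans ?_
    · have := (hp v).le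
      have := (hp' v).le
      positivity
    · rw [prod_mult_mul]
      refine mul_le_mul_of_nonneg_left ?_ (prod_mult_pos hp).le
      refine prod_mult_le (q := fun _ => (2 * B)⁻¹) (fun _ => by positivity) (fun _ => ?_) w
      exact inv_le_one_of_one_le₀ (by linarith)
  have h3 := prod_mult_pos hp
  have h4 := h1.trans (mul_le_mul_of_nonneg_left h2 hB0.le)
  have h5 : B * ((∏ v, p v ^ mult v) * (2 * B)⁻¹) = (∏ v, p v ^ mult v) / 2 := by
    field_simp
  rw [h5] at h4
  linarith

end Cocompact

section Cover

open NumberField InfinitePlace SpAux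

variable {g : ℕ}

theorem glue_vecMul_xMat {R : Type} [CommRing R] (a b : R) (c v : Fin g ⊕ Fin g → R) (t : R) :
    glue a b c ᵥ* xMat v t = glue a (a * t + b + c ⬝ᵥ v) (a • jvec v + c) := by
  refine glue_ext ?_ ?_ fun m => ?_ <;>
    simp [-Fintype.sum_sum_type, Matrix.vecMul, dotProduct, sum_idx, Pi.single_apply]

theorem coord_xMat_conj {W : Type} {T : Set W}
    {h : Matrix (Fin (g + 1) ⊕ Fin (g + 1)) (Fin (g + 1) ⊕ Fin (g + 1)) (W → ℂ)}
    (hh : IsSiegel T h) (r : Fin g ⊕ Fin g → W → ℂ) (s : W → ℂ) :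
    coordV (xMat r s * h * (xMat r s)ᴴ) = r + coordV h ∧
    coordT (xMat r s * h * (xMat r s)ᴴ) = s + coordT h + jvec r ⬝ᵥ coordV h ∧
    coordP (xMat r s * h * (xMat r s)ᴴ) = coordP h ∧
    coordH (xMat r s * h * (xMat r s)ᴴ) = coordH h := by
  obtain ⟨hp, -, -, -, e⟩ := hh.coord
  have h1 : xMat r s * h * (xMat r s)ᴴ =
      horo (r + coordV h) (s + coordT h + jvec r ⬝ᵥ coordV h) (coordP h) (coordH h) := by
    conv_lhs => rw [← e]
    rw [horo, horo, ← xMat_mul, Matrix.conjTranspose_mul]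
    simp only [Matrix.mul_assoc]
  rw [h1]
  exact coord_horo hp

theorem coord_embMat_conj {W : Type} {T : Set W}
    {h : Matrix (Fin (g + 1) ⊕ Fin (g + 1)) (Fin (g + 1) ⊕ Fin (g + 1)) (W → ℂ)}
    (hh : IsSiegel T h) {c : Matrix (Fin g ⊕ Fin g) (Fin g ⊕ Fin g) (W → ℂ)}
    (hc : c ∈ Sp g (W → ℂ)) :
    coordP (embMat c * h * (embMat c)ᴴ) = coordP h ∧
    coordH (embMat c * h * (embMat c)ᴴ) = c * coordH h * cᴴ := by
  obtain ⟨hp, -, -, -, e⟩ := hh.coord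
  have h1 : embMat c * h * (embMat c)ᴴ =
      horo (c *ᵥ coordV h) (coordT h) (coordP h) (c * coordH h * cᴴ) := by
    have h2 : embMat c * posExt (coordP h) (coordH h) * (embMat c)ᴴ =
        posExt (coordP h) (c * coordH h * cᴴ) := by
      rw [embMat_conjTranspose, embMat_eq_extMat, embMat_eq_extMat, posExt, posExt, extMat_mul,
        extMat_mul]
      simp only [one_mul, mul_one]
    conv_lhs => rw [← e]
    rw [horo, horo, ← h2, ← Matrix.mul_assoc, ← Matrix.mul_assoc, embMat_mul_xMat hc,
      Matrix.mul_assoc _ _ (embMat c)ᴴ, ← Matrix.conjTranspose_mul, embMat_mul_xMat hc,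
      Matrix.conjTranspose_mul]
    simp only [Matrix.mul_assoc]
  rw [h1]
  obtain ⟨-, -, h3, h4⟩ := coord_horo (v := c *ᵥ coordV h) (t := coordT h)
    (h := c * coordH h * cᴴ) hp
  exact ⟨h3, h4⟩

variable {K : Type} [Field K]

theorem archMat_xMat (r : Fin g ⊕ Fin g → K) (s : K) :
    archMat (xMat r s) = xMat (fun m => archHom K (r m)) (archHom K s) := by
  ext1 a b
  revert a b
  refine idx_cases ?_ ?_ fun m => ?_ <;> refine idx_cases ?_ ?_ fun n => ?_ <;>
    simp [archMat, Pi.single_apply, apply_ite (archHom K)]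
  rcases n with n | n <;> simp [jvec]

theorem archMat_embMat (c : Matrix (Fin g ⊕ Fin g) (Fin g ⊕ Fin g) K) :
    archMat (embMat c) = embMat (archMat c) := by
  ext1 a b
  revert a b
  refine idx_cases ?_ ?_ fun m => ?_ <;> refine idx_cases ?_ ?_ fun n => ?_ <;>
    simp [archMat]

theorem hasDenom_xMat {O : Subring K} {r : Fin g ⊕ Fin g → K} {s : K} (hr : ∀ m, r m ∈ O)
    (hs : s ∈ O) : HasDenom O 1 (xMat r s) := by
  have hj : ∀ m, jvec r m ∈ O := by
    rintro (m | m)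
    · exact neg_mem (hr _)
    · exact hr _
  intro a b
  revert a b
  refine idx_cases ?_ ?_ fun m => ?_ <;> refine idx_cases ?_ ?_ fun n => ?_ <;>
    simp [hr, hs, hj, Pi.single_apply]
  split_ifs <;> simp

theorem HasDenom.embMat {O : Subring K} {m : K} (hm : m ∈ O)
    {c : Matrix (Fin g ⊕ Fin g) (Fin g ⊕ Fin g) K} (hc : HasDenom O m c) :
    HasDenom O m (embMat c) := by
  intro a b
  revert a b
  refine idx_cases ?_ ?_ fun k => ?_ <;> refine idx_cases ?_ ?_ fun n => ?_ <;>
    simp [hm, hc _ _]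

theorem hval_horo (h : SymSpace (g + 1) K) (a b : K) (c : Fin g ⊕ Fin g → K)
    (w : InfinitePlace K) : hval h.1 (glue a b c) w =
      (coordP h.1 w)⁻¹ * ‖archHom K a w‖ ^ 2 +
      coordP h.1 w * ‖archHom K a w * coordT h.1 w + archHom K b w +
        ∑ m, archHom K (c m) w * coordV h.1 m w‖ ^ 2 +
      qform (coordH h.1) w (archHom K a w • jvec (fun m => coordV h.1 m w) +
        fun m => archHom K (c m) w) := by
  have e := h.2.coord.2.2.2.2
  have h1 : (fun i => archHom K ((glue a b c : Fin (g + 1) ⊕ Fin (g + 1) → K) i) w) =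
      glue (archHom K a w) (archHom K b w) fun m => archHom K (c m) w :=
    glue_ext (by simp) (by simp) fun m => by simp
  have h2 : (xMat (coordV h.1) (coordT h.1)).map (Pi.evalRingHom (fun _ => ℂ) w) =
      xMat (fun m => coordV h.1 m w) (coordT h.1 w) := by
    ext1 a b
    revert a b
    refine idx_cases ?_ ?_ fun m => ?_ <;> refine idx_cases ?_ ?_ fun n => ?_ <;>
      simp [Pi.single_apply]
    rcases n with n | n <;> simp [jvec]
  conv_lhs => rw [← e, hval, horo, qform_conj, h1, h2, glue_vecMul_xMat, qform_posExt]
  rfl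

variable [NumberField K]

variable (K) in
/-- The height of a reduced point is bounded by the next height. -/
theorem exists_coordP_le {B M : ℝ} (hB : 1 ≤ B) (hM : 1 ≤ M) : ∃ C : ℝ, 0 ≤ C ∧
    ∀ (g : ℕ) (h : SymSpace (g + 1) K), IsReducedAt B h → IsBalanced M (topP (coordH h.1)) →
      ∀ w, coordP h.1 w ≤ C * topP (coordH h.1) w := by
  have hBM : 1 ≤ B * M := one_le_mul_of_one_le_of_one_le hB hM
  have hle : B ≤ B * M := le_mul_of_one_le_right (by linarith) hM
  have hle' : M ≤ B * M := le_mul_of_one_le_left (by linarith) hB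
  obtain ⟨C, H⟩ := exists_le_mul_of_dirichlet K hBM
  refine ⟨max 1 C, by positivity, fun g h hr hbal w => ?_⟩
  obtain ⟨hp, hv, ht, hh, -⟩ := h.2.coord
  have hb1 : IsBalanced B (coordP h.1) := by
    rw [coordP_eq_hval]
    exact hr.bal
  have hb : IsBalanced (B * M) (coordP h.1) := fun w w' =>
    (hb1 w w').trans (mul_le_mul_of_nonneg_right hle (hp w').le)
  have hmin : ∀ x : Fin (g + 1) ⊕ Fin (g + 1) → K, (∀ i, IsIntegral ℤ (x i)) → x ≠ 0 →
      ∏ w, coordP h.1 w ^ mult w ≤ (B * M) * ∏ w, hval h.1 x w ^ mult w := by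
    intro x hx h0
    have := hr.le x hx h0
    rw [hnorm, ← coordP_eq_hval] at this
    refine this.trans (mul_le_mul_of_nonneg_right hle ?_)
    exact (prod_mult_pos fun w => hval_pos h.2.pos h0 w).le
  rcases g with _ | g
  · have h1 := H (coordP h.1) (fun w => (coordP h.1 w)⁻¹) hp (fun w => inv_pos.2 (hp w)) hb
      (fun w w' => by
        have := hb w' w
        rw [← div_eq_mul_inv, le_div_iff₀ (hp w'), inv_mul_le_iff₀ (hp w), mul_comm]
        exact this) (coordT h.1) ht (fun s r hs hr => by
        refine (hmin (glue (s : K) (-r) 0) ?_ ?_).trans (le_of_eq ?_)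
        · exact idx_cases (natCast_mem_intRing s) hr.neg fun m => isEmptyElim m
        · intro h0
          have := congrFun h0 (Sum.inl 0)
          exact hs (by simpa using this)
        · congr 1
          refine Finset.prod_congr rfl fun w _ => ?_
          rw [hval_horo]
          simp [Subsingleton.elim _ (0 : Fin 0 ⊕ Fin 0 → ℂ), qform_zero, ← sub_eq_add_neg]
          ring) w
    have h2 := hp w
    rw [← div_eq_mul_inv, le_div_iff₀ h2] at h1
    show coordP h.1 w ≤ max 1 C * 1
    rw [mul_one]
    rcases le_total (coordP h.1 w) 1 with h3 | h3
    · exact h3.trans (le_max_left _ _)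
    · exact (by nlinarith : coordP h.1 w ≤ C).trans (le_max_right _ _)
  · have hq := hh.coord.1
    have h1 := H (coordP h.1) (coordP (coordH h.1)) hp hq hb
      (fun w w' => (hbal w w').trans (mul_le_mul_of_nonneg_right hle' (hq w').le))
      (coordV h.1 (Sum.inr 0)) (hv _) (fun s r hs hr => by
        refine (hmin (glue 0 (-r) (Pi.single (Sum.inr 0) (s : K))) ?_ ?_).trans (le_of_eq ?_)
        · refine idx_cases isIntegral_zero hr.neg fun m => ?_
          rw [glue_idxSucc, Pi.single_apply]
          split_ifs
          · exact natCast_mem_intRing s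
          · exact isIntegral_zero
        · intro h0
          have := congrFun h0 (idxSucc (Sum.inr 0))
          rw [glue_idxSucc] at this
          exact hs (by simpa using this)
        · congr 1
          refine Finset.prod_congr rfl fun w _ => ?_
          have e1 : (fun m => archHom K ((Pi.single (Sum.inr 0) (s : K) :
              Fin (g + 1) ⊕ Fin (g + 1) → K) m) w) = (s : ℂ) • Pi.single (Sum.inr 0) 1 := by
            funext m
            rw [Pi.single_apply, Pi.smul_apply, Pi.single_apply]
            split_ifs <;> simp
          have e2 : qform (coordH h.1) w (Pi.single (Sum.inr 0) 1) = coordP (coordH h.1) w := by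
            rw [coordP_eq_hval, hval]
            congr 1
            funext m
            rw [Pi.single_apply, Pi.single_apply]
            split_ifs <;> simp
          rw [hval_horo, e1]
          have e3 : ∀ m, archHom K ((Pi.single (Sum.inr 0) (s : K) :
              Fin (g + 1) ⊕ Fin (g + 1) → K) m) w = ((s : ℂ) • Pi.single (Sum.inr 0) 1 : _ → ℂ) m :=
            fun m => congrFun e1 m
          simp only [e3]
          simp [-Fintype.sum_sum_type, Pi.single_apply, qform_smul, ← e2, neg_add_eq_sub]
          ring) w
    refine h1.trans (mul_le_mul_of_nonneg_right (le_max_right _ _) (hq w).le)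

variable (K) in
/-- Reduction theory: the symmetric space is covered by translates of a Siegel domain under
elements with bounded denominators. -/
theorem exists_cover : ∀ g : ℕ, ∃ (C : ℝ) (m : ℕ), m ≠ 0 ∧ ∀ h : SymSpace g K,
    ∃ c : Sp g K, HasDenom (intRing K) m c.1 ∧ c • h ∈ siegelDom (realPlaces K) C g
  | 0 => ⟨0, 1, one_ne_zero, fun _ => ⟨1, by rw [Nat.cast_one]; exact hasDenom_one, trivial⟩⟩
  | g + 1 => by
    obtain ⟨C₀, m₀, hm₀, H₀⟩ := exists_cover g
    obtain ⟨B, m₁, hB, hm₁, H₁⟩ := exists_isReducedAt K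
    obtain ⟨M, hM, HM⟩ := exists_hermReduced (T := realPlaces K) C₀ g
    obtain ⟨Cc, hCc, Hc⟩ := exists_integer_norm_add_le K
    set B' := B * ∏ w : InfinitePlace K, (w (m₀ : K) ^ 2) ^ mult w with hB'
    have hB'1 : 1 ≤ B' := by
      refine one_le_mul_of_one_le_of_one_le hB ?_
      rw [prod_mult_sq]
      exact one_le_pow₀ (one_le_prod_of_isIntegral (natCast_mem_intRing m₀) (by exact_mod_cast hm₀))
    obtain ⟨C₁, hC₁, HC⟩ := exists_coordP_le K hB'1 hM
    have hB'0 : 0 < B' := by linarith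
    have hM0 : 0 < M := by linarith
    refine ⟨|C₀| + Cc + C₁ + B' * M + 1, m₀ * m₁, mul_ne_zero hm₀ hm₁, fun h => ?_⟩
    obtain ⟨c₁, hc₁, hr₁⟩ := H₁ g h
    set h₁ := c₁ • h
    obtain ⟨c₂, hc₂, hd₂⟩ := H₀ ⟨coordH h₁.1, h₁.2.coord.2.2.2.1⟩
    set d₂ := stabHom g K c₂ with hd₂def
    have hden₂ : HasDenom (intRing K) m₀ d₂.1 := hc₂.embMat (natCast_mem_intRing m₀)
    obtain ⟨hP₂, hH₂⟩ := coord_embMat_conj h₁.2 (archMat_mem c₂.2)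
    rw [← archMat_embMat] at hP₂ hH₂
    change coordP (d₂ • h₁).1 = _ at hP₂
    change coordH (d₂ • h₁).1 = _ at hH₂
    have hr₂ := hr₁.smul (by linarith) hm₀ hden₂ hP₂
    set h₂ := d₂ • h₁
    have hH₂' : c₂ • (⟨coordH h₁.1, h₁.2.coord.2.2.2.1⟩ : SymSpace g K) =
        ⟨coordH h₂.1, h₂.2.coord.2.2.2.1⟩ := Subtype.ext hH₂.symm
    rw [hH₂'] at hd₂
    have hbal : IsBalanced M (topP (coordH h₂.1)) := by
      obtain ⟨-, -, -, -, -, -, -, h4⟩ := HM _ hd₂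
      exact h4
    have hple := HC g h₂ hr₂ hbal
    choose r hr hr' using fun m => Hc _ (h₂.2.coord.2.1 m)
    have hJ : jvec (fun m => archHom K (r m)) ⬝ᵥ coordV h₂.1 ∈ realAlg (realPlaces K) := by
      refine sum_mem fun m _ => mul_mem ?_ (h₂.2.coord.2.1 m)
      rcases m with m | m
      · exact neg_mem (archHom_mem_realAlg _)
      · exact archHom_mem_realAlg _
    obtain ⟨s, hs, hs'⟩ := Hc _ (add_mem h₂.2.coord.2.2.1 hJ)
    set c₃ : Sp (g + 1) K := ⟨xMat r s, xMat_mem r s⟩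
    obtain ⟨hV₃, hT₃, hP₃, hH₃⟩ :=
      coord_xMat_conj h₂.2 (fun m => archHom K (r m)) (archHom K s)
    rw [← archMat_xMat] at hV₃ hT₃ hP₃ hH₃
    change coordV (c₃ • h₂).1 = _ at hV₃
    change coordT (c₃ • h₂).1 = _ at hT₃
    change coordP (c₃ • h₂).1 = _ at hP₃
    change coordH (c₃ • h₂).1 = _ at hH₃
    refine ⟨c₃ * (d₂ * c₁), ?_, ?_⟩
    · rw [Nat.cast_mul, ← one_mul ((m₀ : K) * m₁)]
      exact (hasDenom_xMat hr hs).mul (hden₂.mul hc₁)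
    · rw [mul_smul, mul_smul]
      have hb : IsBalanced B' (coordP h₂.1) := by
        rw [coordP_eq_hval]
        exact hr₂.bal
      have hpos := topP_pos h₂.2.coord.2.2.2.1
      have hC₀ := abs_nonneg C₀
      have hBM : 0 < B' * M := mul_pos hB'0 hM0
      refine ⟨⟨fun m w => ?_, fun w => ?_, fun w => ?_, fun w w' => ?_⟩, ?_⟩
      · show ‖coordV (c₃ • h₂).1 m w‖ < _
        rw [hV₃]
        have := hr' m w
        simp only [Pi.add_apply]
        linarith
      · show ‖coordT (c₃ • h₂).1 w‖ < _
        rw [hT₃, add_assoc]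
        have := hs' w
        simp only [Pi.add_apply] at this ⊢
        linarith
      · show coordP (c₃ • h₂).1 w / topP (coordH (c₃ • h₂).1) w < _
        rw [hP₃, hH₃]
        have := (div_le_iff₀ (hpos w)).2 (hple w)
        linarith
      · show coordP (c₃ • h₂).1 w / topP (coordH (c₃ • h₂).1) w <
          _ * (coordP (c₃ • h₂).1 w' / topP (coordH (c₃ • h₂).1) w')
        rw [hP₃, hH₃]
        have hq : 0 < coordP h₂.1 w' / topP (coordH h₂.1) w' :=
          div_pos (h₂.2.coord.1 w') (hpos w')
        have h5 : coordP h₂.1 w / topP (coordH h₂.1) w ≤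
            (B' * M) * (coordP h₂.1 w' / topP (coordH h₂.1) w') := by
          rw [div_le_iff₀ (hpos w)]
          calc coordP h₂.1 w ≤ B' * coordP h₂.1 w' := hb w w'
            _ = B' * (coordP h₂.1 w' / topP (coordH h₂.1) w') * topP (coordH h₂.1) w' := by
                rw [mul_assoc B', div_mul_cancel₀ _ (hpos w').ne']
            _ ≤ B' * (coordP h₂.1 w' / topP (coordH h₂.1) w') * (M * topP (coordH h₂.1) w) :=
                mul_le_mul_of_nonneg_left (hbal w' w) (by positivity)
            _ = _ := by ring
        nlinarith
      · have h6 : (horoHomeo (realPlaces K) g (c₃ • h₂)).2 =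
            ⟨coordH h₂.1, h₂.2.coord.2.2.2.1⟩ := Subtype.ext hH₃
        rw [h6]
        refine siegelDom_mono ?_ g hd₂
        have := le_abs_self C₀
        linarith

end Cover

section SelfDual

variable {g : ℕ} {A K : Type} [CommRing A] [IsDedekindDomain A] [Field K] [Algebra A K]
  [IsFractionRing A K]

/-- A full lattice over a Dedekind domain is equal to its bidual. -/
theorem mem_of_mem_bidual {N : Submodule A (Fin g ⊕ Fin g → K)} (hN : N.FG) {d d' : A}
    (hd : d ≠ 0) (hd' : d' ≠ 0) (hdN : ∀ x ∈ stdLattice g A K, d • x ∈ N)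
    (hNd : ∀ x ∈ N, d' • x ∈ stdLattice g A K) {x : Fin g ⊕ Fin g → K}
    (hx : ∀ y, (∀ z ∈ N, sform g K y z ∈ (algebraMap A K).range) →
      sform g K y x ∈ (algebraMap A K).range) : x ∈ N := by
  have hinj : Function.Injective (algebraMap A K) := IsFractionRing.injective A K
  have hdK : algebraMap A K d ≠ 0 := (map_ne_zero_iff _ hinj).2 hd
  have hdK' : algebraMap A K d' ≠ 0 := (map_ne_zero_iff _ hinj).2 hd'
  have : Module.Finite A N := Module.Finite.iff_fg.2 hN
  have : Module.IsTorsionFree A K := Module.isTorsionFree_iff_faithfulSMul.2 inferInstance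
  have : Module.FinitePresentation A N := Module.finitePresentation_of_finite A N
  have : Module.Projective A N := Module.Flat.projective_of_finitePresentation
  obtain ⟨n, f, hf⟩ := Module.Finite.exists_fin' A N
  obtain ⟨s, hs⟩ := Module.projective_lifting_property f LinearMap.id hf
  let lam : Fin n → Fin g ⊕ Fin g → K := fun i j =>
    (algebraMap A K d)⁻¹ * algebraMap A K (s ⟨d • Pi.single j 1, hdN _ (single_mem_stdLattice j)⟩ i)
  have hlam : ∀ i (z : N), lam i ⬝ᵥ z.1 = algebraMap A K (s z i) := by
    intro i z
    choose b hb using fun j => mem_stdLattice.1 (hNd z.1 z.2) j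
    have h1 : (d * d') • z = ∑ j, b j • (⟨d • Pi.single j 1, hdN _ (single_mem_stdLattice j)⟩ : N) := by
      refine Subtype.ext (funext fun k => ?_)
      rw [mul_smul, Submodule.coe_smul, Submodule.coe_smul, Submodule.coe_sum, Finset.sum_apply,
        Pi.smul_apply, ← hb k]
      simp [Pi.single_apply, Algebra.smul_def, mul_comm, -Fintype.sum_sum_type]
    have h2 := congrArg (fun y => algebraMap A K (s y i)) h1
    simp only [map_smul, map_sum, Finset.sum_apply, Pi.smul_apply, smul_eq_mul, map_mul] at h2
    refine mul_left_cancel₀ (mul_ne_zero hdK hdK') ?_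
    rw [h2, dotProduct, Finset.mul_sum]
    refine Finset.sum_congr rfl fun j _ => ?_
    rw [hb j, Pi.smul_apply, Algebra.smul_def]
    simp only [lam]
    field_simp
  have hsum : ∀ z : N, z.1 = ∑ i, algebraMap A K (s z i) • (f (Pi.single i 1)).1 := by
    intro z
    have h1 : f (s z) = z := LinearMap.congr_fun hs z
    have h2 : s z = ∑ i, s z i • (Pi.single i 1 : Fin n → A) := by
      funext k
      simp [Pi.single_apply]
    conv_lhs => rw [← h1, h2]
    simp only [map_sum, map_smul, Submodule.coe_sum, Submodule.coe_smul, algebraMap_smul]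
  have hid : ∀ y : Fin g ⊕ Fin g → K, y = ∑ i, (lam i ⬝ᵥ y) • (f (Pi.single i 1)).1 := by
    have h1 : (LinearMap.id : (Fin g ⊕ Fin g → K) →ₗ[K] (Fin g ⊕ Fin g → K)) =
        ∑ i, (dotProductBilin K K (lam i)).smulRight (f (Pi.single i 1)).1 := by
      refine (Pi.basisFun K (Fin g ⊕ Fin g)).ext fun j => ?_
      have h2 := hsum ⟨d • Pi.single j 1, hdN _ (single_mem_stdLattice j)⟩
      simp only [← hlam, dotProduct_smul] at h2
      rw [Pi.basisFun_apply]
      refine smul_right_injective _ hdK ?_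
      simp only [LinearMap.id_apply, algebraMap_smul]
      refine h2.trans ?_
      rw [LinearMap.sum_apply, Finset.smul_sum]
      refine Finset.sum_congr rfl fun i _ => ?_
      rw [LinearMap.smulRight_apply, smul_assoc]
      rfl
    intro y
    have := LinearMap.congr_fun h1 y
    rw [LinearMap.sum_apply] at this
    exact this
  rw [hid x]
  refine sum_mem fun i _ => smul_mem_of_range (f _).2 ?_
  have h3 : ∀ z, sform g K (jvec (-lam i)) z = lam i ⬝ᵥ z := fun z => by
    rw [sform_jvec, neg_dotProduct, neg_neg]
  rw [← h3]
  refine hx _ fun z hz => ?_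
  rw [h3]
  exact ⟨_, (hlam i ⟨z, hz⟩).symm⟩

omit [IsDedekindDomain A] [IsFractionRing A K] in
theorem hasDenom_iff_mulVec {m : K} {c : Matrix (Fin g ⊕ Fin g) (Fin g ⊕ Fin g) K} :
    HasDenom (algebraMap A K).range m c ↔
      ∀ x ∈ stdLattice g A K, m • (c *ᵥ x) ∈ stdLattice g A K := by
  constructor
  · intro h x hx
    rw [mem_stdLattice] at hx ⊢
    intro i
    rw [Pi.smul_apply, Matrix.mulVec, dotProduct, Finset.smul_sum]
    refine sum_mem fun j _ => ?_
    rw [smul_eq_mul, ← mul_assoc]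
    exact mul_mem (h i j) (hx j)
  · intro h i j
    have := mem_stdLattice.1 (h _ (single_mem_stdLattice j)) i
    rwa [Matrix.mulVec_single_one] at this

omit [IsFractionRing A K] [IsDedekindDomain A] in
/-- The standard lattice is self-dual. -/
theorem mem_stdLattice_of_dual {x : Fin g ⊕ Fin g → K}
    (h : ∀ y ∈ stdLattice g A K, sform g K x y ∈ (algebraMap A K).range) :
    x ∈ stdLattice g A K := by
  rw [mem_stdLattice]
  rintro (i | i)
  · rw [← sform_single_inr x i]
    exact h _ (single_mem_stdLattice _)
  · have := neg_mem (h _ (single_mem_stdLattice (Sum.inl i)))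
    rwa [sform_single_inl, neg_neg] at this

/-- The translate of the standard lattice by a symplectic matrix. -/
def spLattice (A : Type) [CommRing A] [Algebra A K] (c : Sp g K) :
    Submodule A (Fin g ⊕ Fin g → K) :=
  (stdLattice g A K).comap ((Matrix.mulVecLin (c⁻¹).1).restrictScalars A)

omit [IsDedekindDomain A] [IsFractionRing A K] in
theorem mem_spLattice {c : Sp g K} {x : Fin g ⊕ Fin g → K} :
    x ∈ spLattice A c ↔ (c⁻¹).1 *ᵥ x ∈ stdLattice g A K := Iff.rfl

theorem Sp_mulVec_inv (c : Sp g K) (x : Fin g ⊕ Fin g → K) : c.1 *ᵥ ((c⁻¹).1 *ᵥ x) = x := by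
  rw [Matrix.mulVec_mulVec]
  have : c.1 * (c⁻¹).1 = 1 := congrArg Subtype.val (mul_inv_cancel c)
  rw [this, Matrix.one_mulVec]

theorem Sp_inv_mulVec (c : Sp g K) (x : Fin g ⊕ Fin g → K) : (c⁻¹).1 *ᵥ (c.1 *ᵥ x) = x := by
  simpa using Sp_mulVec_inv c⁻¹ x

omit [IsDedekindDomain A] [IsFractionRing A K] in
theorem mulVec_mem_spLattice {c : Sp g K} {x : Fin g ⊕ Fin g → K} :
    c.1 *ᵥ x ∈ spLattice A c ↔ x ∈ stdLattice g A K := by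
  rw [mem_spLattice, Sp_inv_mulVec]

omit [IsDedekindDomain A] [IsFractionRing A K] in
/-- Denominators of quotients measure the relative position of the lattices. -/
theorem hasDenom_inv_mul_iff {m : K} {a b : Sp g K} :
    HasDenom (algebraMap A K).range m (a⁻¹ * b).1 ↔
      ∀ x ∈ spLattice A b, m • x ∈ spLattice A a := by
  rw [hasDenom_iff_mulVec]
  have e : ∀ x, m • ((a⁻¹ * b).1 *ᵥ x) = (a⁻¹).1 *ᵥ (m • (b.1 *ᵥ x)) := fun x => by
    rw [Matrix.mulVec_smul, Matrix.mulVec_mulVec]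
    rfl
  constructor
  · intro h x hx
    have := h _ (mem_spLattice.1 hx)
    rwa [e, Sp_mulVec_inv] at this
  · intro h x hx
    rw [e]
    exact h _ (mulVec_mem_spLattice.2 hx)

omit [IsDedekindDomain A] [IsFractionRing A K] in
theorem sform_mem_of_mem_spLattice {c : Sp g K} {x y : Fin g ⊕ Fin g → K}
    (hx : x ∈ spLattice A c) (hy : y ∈ spLattice A c) :
    sform g K x y ∈ (algebraMap A K).range := by
  rw [← sform_mulVec (c⁻¹).2]
  exact isUnimod_stdLattice.int _ hx _ hy

/-- Full unimodular lattices are translates of the standard one. -/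
theorem IsUnimod.exists_spLattice {Λ : Submodule A (Fin g ⊕ Fin g → K)}
    (h : IsUnimod (sform g K) Λ)
    (hspan : Submodule.span K (Λ : Set (Fin g ⊕ Fin g → K)) = ⊤) :
    ∃ c : Sp g K, spLattice A c = Λ := by
  obtain ⟨n, e, f, hb⟩ := IsUnimod.exists_basis sform_isAlt h
  obtain rfl := hb.card_eq hspan
  let c : Sp n K := ⟨colMat e f, colMat_mem hb.ee hb.ff hb.ef⟩
  have hc : ∀ y, c.1 *ᵥ y = ∑ i, (y (Sum.inl i) • e i + y (Sum.inr i) • f i) := by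
    intro y
    funext k
    simp [c, Matrix.mulVec, dotProduct, colMat, Finset.sum_add_distrib, mul_comm]
  refine ⟨c, le_antisymm (fun x hx => ?_) fun x hx => ?_⟩
  · rw [← Sp_mulVec_inv c x, hc]
    have h1 := mem_stdLattice.1 (mem_spLattice.1 hx)
    exact sum_mem fun i _ => add_mem (smul_mem_of_range (hb.mem_e i) (h1 _))
      (smul_mem_of_range (hb.mem_f i) (h1 _))
  · have h1 : x = c.1 *ᵥ (Sum.elim (fun i => sform n K x (f i)) fun i => sform n K (e i) x) := by
      rw [hc]
      exact hb.expand x hx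
    rw [h1, mulVec_mem_spLattice, mem_stdLattice]
    rintro (i | i)
    · exact h.int _ hx _ (hb.mem_f i)
    · exact h.int _ (hb.mem_e i) _ hx

/-- The part of the lattice with denominator `q`, completed by the multiples of `q`. -/
def midLattice (q : A) (a : Sp g K) : Submodule A (Fin g ⊕ Fin g → K) :=
  (spLattice A a ⊓ (stdLattice g A K).comap (LinearMap.lsmul A _ q)) ⊔
    (stdLattice g A K).map (LinearMap.lsmul A _ q)

omit [IsDedekindDomain A] [IsFractionRing A K] in
theorem mem_midLattice {q : A} {a : Sp g K} {x : Fin g ⊕ Fin g → K} :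
    x ∈ midLattice q a ↔ ∃ u v, u ∈ spLattice A a ∧ q • u ∈ stdLattice g A K ∧
      v ∈ stdLattice g A K ∧ u + q • v = x := by
  rw [midLattice, Submodule.mem_sup]
  constructor
  · rintro ⟨u, ⟨h1, h2⟩, _, ⟨v, hv, rfl⟩, rfl⟩
    exact ⟨u, v, h1, h2, hv, rfl⟩
  · rintro ⟨u, v, h1, h2, hv, rfl⟩
    exact ⟨u, ⟨h1, h2⟩, _, ⟨v, hv, rfl⟩, rfl⟩

omit [IsDedekindDomain A] [IsFractionRing A K] in
theorem smul_mem_of_mem_midLattice {q : A} {a : Sp g K} {x : Fin g ⊕ Fin g → K}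
    (hx : x ∈ midLattice q a) : q • x ∈ stdLattice g A K := by
  obtain ⟨u, v, -, h2, hv, rfl⟩ := mem_midLattice.1 hx
  rw [smul_add]
  exact add_mem h2 (Submodule.smul_mem _ _ (Submodule.smul_mem _ _ hv))

omit [IsDedekindDomain A] [IsFractionRing A K] in
theorem smul_mem_midLattice {q : A} {a : Sp g K} {x : Fin g ⊕ Fin g → K}
    (hx : x ∈ stdLattice g A K) : q • x ∈ midLattice q a :=
  mem_midLattice.2 ⟨0, x, zero_mem _, by rw [smul_zero]; exact zero_mem _, hx, zero_add _⟩

omit [IsDedekindDomain A] [IsFractionRing A K] in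
theorem sform_smul_left (q : A) (x y : Fin g ⊕ Fin g → K) :
    sform g K (q • x) y = algebraMap A K q * sform g K x y := by
  rw [← algebraMap_smul K q x, map_smul, LinearMap.smul_apply, smul_eq_mul]

omit [IsDedekindDomain A] [IsFractionRing A K] in
theorem sform_smul_right (q : A) (x y : Fin g ⊕ Fin g → K) :
    sform g K x (q • y) = algebraMap A K q * sform g K x y := by
  rw [← algebraMap_smul K q y, map_smul, smul_eq_mul]

theorem isUnimod_midLattice {q d : A} (hq : q ≠ 0) (hd : d ≠ 0) {a : Sp g K}
    (ha : HasDenom (algebraMap A K).range (algebraMap A K d) a.1) :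
    IsUnimod (sform g K) (midLattice q a) where
  fg := by
    have hinj : Function.Injective (algebraMap A K) := IsFractionRing.injective A K
    have hqK : algebraMap A K q ≠ 0 := (map_ne_zero_iff _ hinj).2 hq
    have h1 : ((stdLattice g A K).map ((LinearMap.lsmul K (Fin g ⊕ Fin g → K)
        (algebraMap A K q)⁻¹).restrictScalars A)).FG := isUnimod_stdLattice.fg.map _
    have := isNoetherian_of_fg_of_noetherian _ h1
    have : IsNoetherian A (midLattice q a) := isNoetherian_of_le (t := (stdLattice g A K).map
      ((LinearMap.lsmul K (Fin g ⊕ Fin g → K) (algebraMap A K q)⁻¹).restrictScalars A))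
      fun x hx => ⟨q • x, smul_mem_of_mem_midLattice hx, by
        rw [← algebraMap_smul K q x]
        exact inv_smul_smul₀ hqK x⟩
    exact Module.Finite.iff_fg.1 inferInstance
  int := by
    intro x hx y hy
    obtain ⟨u, v, h1, h2, hv, rfl⟩ := mem_midLattice.1 hx
    obtain ⟨u', v', h1', h2', hv', rfl⟩ := mem_midLattice.1 hy
    have hint := (isUnimod_stdLattice (g := g) (A := A) (K := K)).int
    simp only [map_add, LinearMap.add_apply]
    refine add_mem (add_mem (sform_mem_of_mem_spLattice h1 h1') ?_) (add_mem ?_ ?_)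
    · rw [sform_smul_left, ← sform_smul_right]
      exact hint _ hv _ h2'
    · rw [sform_smul_right, ← sform_smul_left]
      exact hint _ h2 _ hv'
    · exact hint _ (Submodule.smul_mem _ _ hv) _ (Submodule.smul_mem _ _ hv')
  sat := by
    intro x _ t ht
    have ht' : ∀ y ∈ midLattice q a, sform g K (t • x) y ∈ (algebraMap A K).range := by
      intro y hy
      rw [map_smul, LinearMap.smul_apply, smul_eq_mul]
      exact ht y hy
    generalize t • x = z at ht'
    have hz : q • z ∈ stdLattice g A K := mem_stdLattice_of_dual fun y hy => by
      rw [sform_smul_left, ← sform_smul_right]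
      exact ht' _ (smul_mem_midLattice hy)
    have hfg : (spLattice A a).FG := by
      have : spLattice A a = (stdLattice g A K).map ((Matrix.mulVecLin a.1).restrictScalars A) := by
        ext x
        constructor
        · exact fun hx => ⟨_, hx, Sp_mulVec_inv a x⟩
        · rintro ⟨y, hy, rfl⟩
          exact mulVec_mem_spLattice.2 hy
      rw [this]
      exact isUnimod_stdLattice.fg.map _
    have hsp : ∀ y ∈ spLattice A a, d • y ∈ stdLattice g A K := by
      intro y hy
      have := hasDenom_iff_mulVec.1 ha _ (mem_spLattice.1 hy)
      rwa [Sp_mulVec_inv, algebraMap_smul] at this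
    have hz' : z ∈ spLattice A a ⊔ (stdLattice g A K).map (LinearMap.lsmul A _ q) := by
      refine mem_of_mem_bidual (hfg.sup (isUnimod_stdLattice.fg.map _)) hq hd
        (fun y hy => Submodule.mem_sup_right ⟨y, hy, rfl⟩) ?_ ?_
      · intro y hy
        obtain ⟨u, hu, _, ⟨v, hv, rfl⟩, rfl⟩ := Submodule.mem_sup.1 hy
        rw [smul_add]
        exact add_mem (hsp u hu) (Submodule.smul_mem _ _ (Submodule.smul_mem _ _ hv))
      · intro y hy
        rw [sform_swap]
        refine neg_mem (ht' y (mem_midLattice.2 ⟨y, 0, ?_, ?_, zero_mem _, by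
          rw [smul_zero, add_zero]⟩))
        · rw [mem_spLattice]
          refine mem_stdLattice_of_dual fun w hw => ?_
          have h3 := hy _ (Submodule.mem_sup_left (mulVec_mem_spLattice.2 hw))
          rwa [← sform_mulVec (a⁻¹).2, Sp_inv_mulVec] at h3
        · refine mem_stdLattice_of_dual fun w hw => ?_
          rw [sform_smul_left, ← sform_smul_right]
          exact hy _ (Submodule.mem_sup_right ⟨w, hw, rfl⟩)
    obtain ⟨u, hu, _, ⟨v, hv, rfl⟩, rfl⟩ := Submodule.mem_sup.1 hz'
    refine mem_midLattice.2 ⟨u, v, hu, ?_, hv, rfl⟩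
    have h4 := sub_mem hz (Submodule.smul_mem _ q (Submodule.smul_mem _ q hv))
    rw [smul_add] at h4
    simpa using h4
  nd := by
    have hinj : Function.Injective (algebraMap A K) := IsFractionRing.injective A K
    have hqK : algebraMap A K q ≠ 0 := (map_ne_zero_iff _ hinj).2 hq
    intro x _ h
    have h1 : ∀ i, sform g K x (Pi.single i 1) = 0 := fun i => by
      have := h _ (smul_mem_midLattice (single_mem_stdLattice i))
      rw [sform_smul_right] at this
      exact (mul_eq_zero.1 this).resolve_left hqK
    funext i
    rcases i with i | i
    · rw [← sform_single_inr x i, h1, Pi.zero_apply]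
    · have := h1 (Sum.inl i)
      rw [sform_single_inl] at this
      exact neg_eq_zero.1 this

theorem span_midLattice {q : A} (hq : q ≠ 0) (a : Sp g K) :
    Submodule.span K (midLattice q a : Set (Fin g ⊕ Fin g → K)) = ⊤ := by
  have hinj : Function.Injective (algebraMap A K) := IsFractionRing.injective A K
  have hqK : algebraMap A K q ≠ 0 := (map_ne_zero_iff _ hinj).2 hq
  rw [eq_top_iff, ← span_stdLattice (A := A), Submodule.span_le]
  intro x hx
  have h1 : algebraMap A K q • x ∈ Submodule.span K (midLattice q a : Set (Fin g ⊕ Fin g → K)) := by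
    rw [algebraMap_smul]
    exact Submodule.subset_span (smul_mem_midLattice hx)
  exact (Submodule.smul_mem_iff _ hqK).1 h1

/-- Every symplectic matrix with denominator `p ^ (n + 1)` is the product of one with denominator
`p ^ n` and one with denominator `p`, compatibly with proximity. -/
theorem exists_denominator_reduction {p : A} (hp : p ≠ 0) (n : ℕ) :
    ∃ F : Sp g K → Sp g K,
      (∀ a : Sp g K, HasDenom (algebraMap A K).range (algebraMap A K p ^ (n + 1)) a.1 →
        HasDenom (algebraMap A K).range (algebraMap A K p ^ n) (F a).1 ∧
        HasDenom (algebraMap A K).range (algebraMap A K p) ((F a)⁻¹ * a).1) ∧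
      ∀ a b : Sp g K, HasDenom (algebraMap A K).range (algebraMap A K p ^ (n + 1)) a.1 →
        HasDenom (algebraMap A K).range (algebraMap A K p ^ (n + 1)) b.1 →
        HasDenom (algebraMap A K).range (algebraMap A K p) (a⁻¹ * b).1 →
        HasDenom (algebraMap A K).range (algebraMap A K p) ((F a)⁻¹ * F b).1 := by
  have H : ∀ a : Sp g K, ∃ c : Sp g K,
      HasDenom (algebraMap A K).range (algebraMap A K p ^ (n + 1)) a.1 →
        spLattice A c = midLattice (p ^ n) a := by
    intro a
    by_cases ha : HasDenom (algebraMap A K).range (algebraMap A K p ^ (n + 1)) a.1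
    · rw [← map_pow] at ha
      obtain ⟨c, hc⟩ := (isUnimod_midLattice (pow_ne_zero n hp) (pow_ne_zero _ hp)
        ha).exists_spLattice (span_midLattice (pow_ne_zero n hp) a)
      exact ⟨c, fun _ => hc⟩
    · exact ⟨1, fun h => absurd h ha⟩
  choose F hF using H
  refine ⟨F, fun a ha => ⟨?_, ?_⟩, fun a b ha hb hab => ?_⟩
  · rw [hasDenom_iff_mulVec]
    intro x hx
    rw [← map_pow, algebraMap_smul]
    refine smul_mem_of_mem_midLattice (a := a) ?_
    rw [← hF a ha]
    exact mulVec_mem_spLattice.2 hx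
  · rw [hasDenom_inv_mul_iff, hF a ha]
    intro x hx
    rw [algebraMap_smul]
    refine mem_midLattice.2 ⟨p • x, 0, Submodule.smul_mem _ _ hx, ?_, zero_mem _, by
      rw [smul_zero, add_zero]⟩
    have := hasDenom_iff_mulVec.1 ha _ (mem_spLattice.1 hx)
    rwa [Sp_mulVec_inv, ← map_pow, algebraMap_smul, pow_succ, mul_smul] at this
  · rw [hasDenom_inv_mul_iff, hF a ha, hF b hb]
    rw [hasDenom_inv_mul_iff] at hab
    intro x hx
    obtain ⟨u, v, h1, h2, hv, rfl⟩ := mem_midLattice.1 hx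
    rw [algebraMap_smul]
    refine mem_midLattice.2 ⟨p • u, p • v, ?_, ?_, Submodule.smul_mem _ _ hv, ?_⟩
    · rw [← algebraMap_smul K p u]
      exact hab u h1
    · rw [smul_comm]
      exact Submodule.smul_mem _ _ h2
    · rw [smul_add, smul_comm p]

end SelfDual

section SIntegers

open IsDedekindDomain NumberField nonZeroDivisors

/-- Every finite set of maximal ideals of a Dedekind domain with finite class group is the set of
maximal ideals containing some nonzero element. -/
theorem exists_mem_asIdeal_iff {R : Type*} [CommRing R] [IsDedekindDomain R]
    [Finite (ClassGroup R)] {S : Set (HeightOneSpectrum R)} (hS : S.Finite) :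
    ∃ p : R, p ≠ 0 ∧ ∀ v : HeightOneSpectrum R, p ∈ v.asIdeal ↔ v ∈ S := by
  have H : ∀ v : HeightOneSpectrum R, ∃ q : R, Ideal.span {q} =
      v.asIdeal ^ Nat.card (ClassGroup R) := by
    intro v
    have h0 : v.asIdeal ∈ (Ideal R)⁰ := mem_nonZeroDivisors_of_ne_zero v.ne_bot
    have h1 : ClassGroup.mk0 (⟨v.asIdeal, h0⟩ ^ Nat.card (ClassGroup R)) = 1 := by
      rw [map_pow, pow_card_eq_one']
    rw [ClassGroup.mk0_eq_one_iff] at h1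
    obtain ⟨q, hq⟩ := h1
    exact ⟨q, hq.symm⟩
  choose q hq using H
  have hq0 : ∀ v, q v ≠ 0 := fun v h => by
    have := hq v
    rw [h, Ideal.span_singleton_zero] at this
    exact pow_ne_zero _ v.ne_bot this.symm
  refine ⟨∏ v ∈ hS.toFinset, q v, Finset.prod_ne_zero_iff.2 fun v _ => hq0 v, fun w => ?_⟩
  constructor
  · intro h
    obtain ⟨v, hv, h⟩ := (w.isPrime.prod_mem_iff).1 h
    have h1 : v.asIdeal ^ Nat.card (ClassGroup R) ≤ w.asIdeal := by
      rw [← hq v, Ideal.span_singleton_le_iff_mem]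
      exact h
    have h2 : v.asIdeal ≤ w.asIdeal := w.isPrime.le_of_pow_le h1
    have h3 : v = w := HeightOneSpectrum.ext
      (v.isMaximal.eq_of_le w.isPrime.ne_top h2)
    rw [← h3]
    exact hS.mem_toFinset.1 hv
  · intro h
    refine Ideal.mem_of_dvd _ (Finset.dvd_prod_of_mem q (hS.mem_toFinset.2 h)) ?_
    have : q w ∈ w.asIdeal ^ Nat.card (ClassGroup R) := by
      rw [← hq w]
      exact Ideal.mem_span_singleton_self _
    exact Ideal.pow_le_self Nat.card_pos.ne' this

variable {R K : Type*} [CommRing R] [IsDedekindDomain R] [Field K] [Algebra R K]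
  [IsFractionRing R K] {S : Set (HeightOneSpectrum R)}

theorem inv_mem_integer {p : R}
    (h : ∀ v : HeightOneSpectrum R, p ∈ v.asIdeal ↔ v ∈ S) :
    (algebraMap R K p)⁻¹ ∈ S.integer K := by
  intro v hv
  have h1 : v.valuation K (algebraMap R K p) = 1 :=
    le_antisymm (v.valuation_le_one p) (not_lt.1 fun h2 =>
      hv ((h v).1 ((v.valuation_lt_one_iff_mem p).1 h2)))
  rw [map_inv₀, h1, inv_one]

theorem exists_pow_mul_mem_of_mem_integer (hS : S.Finite) {p : R}
    (h : ∀ v : HeightOneSpectrum R, p ∈ v.asIdeal ↔ v ∈ S) {x : K} (hx : x ∈ S.integer K) :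
    ∃ j : ℕ, algebraMap R K p ^ j * x ∈ (algebraMap R K).range := by
  have H : ∀ v : HeightOneSpectrum R, ∃ j : ℕ, v ∈ S →
      v.valuation K (algebraMap R K p) ^ j * v.valuation K x ≤ 1 := by
    intro v
    by_cases hv : v ∈ S
    · have h1 : v.valuation K (algebraMap R K p) < 1 :=
        (v.valuation_lt_one_iff_mem p).2 ((h v).2 hv)
      by_cases h0 : v.valuation K (algebraMap R K p) = 0
      · exact ⟨1, fun _ => by rw [pow_one, h0, zero_mul]; exact zero_le_one⟩
      obtain ⟨j, hj⟩ := MulArchimedean.arch (v.valuation K x)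
        ((one_lt_inv₀ (zero_lt_iff.2 h0)).2 h1)
      refine ⟨j, fun _ => (mul_le_mul_right hj _).trans ?_⟩
      rw [inv_pow, mul_inv_cancel₀ (pow_ne_zero _ h0)]
    · exact ⟨0, fun h => absurd h hv⟩
  choose j hj using H
  refine ⟨∑ v ∈ hS.toFinset, j v, HeightOneSpectrum.mem_integers_of_valuation_le_one K _
    fun v => ?_⟩
  rw [map_mul, map_pow]
  by_cases hv : v ∈ S
  · refine le_trans (mul_le_mul_left ?_ _) (hj v hv)
    exact pow_le_pow_right_of_le_one' (v.valuation_le_one p)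
      (Finset.single_le_sum (f := j) (fun _ _ => Nat.zero_le _) (hS.mem_toFinset.2 hv))
  · exact mul_le_one' (pow_le_one' (v.valuation_le_one p) _) (hx v hv)

theorem isDedekindDomain_integer [Finite (ClassGroup R)] (hS : S.Finite) :
    IsDedekindDomain (S.integer K) := by
  obtain ⟨p, hp, h⟩ := exists_mem_asIdeal_iff hS
  have hinj : Function.Injective (algebraMap R K) := IsFractionRing.injective R K
  have hpK : algebraMap R K p ≠ 0 := (map_ne_zero_iff _ hinj).2 hp
  have hloc : IsLocalization (Submonoid.powers p) (S.integer K) := by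
    refine ⟨?_, ?_, ?_⟩
    · rintro ⟨_, n, rfl⟩
      rw [map_pow]
      refine IsUnit.pow _ (IsUnit.of_mul_eq_one ⟨_, inv_mem_integer h⟩ (Subtype.ext ?_))
      exact mul_inv_cancel₀ hpK
    · intro z
      obtain ⟨j, y, hy⟩ := exists_pow_mul_mem_of_mem_integer hS h z.2
      refine ⟨⟨y, ⟨p ^ j, j, rfl⟩⟩, Subtype.ext ?_⟩
      change z.1 * algebraMap R K (p ^ j) = algebraMap R K y
      rw [hy, map_pow, mul_comm]
    · intro x y hxy
      refine ⟨1, ?_⟩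
      rw [hinj (congrArg Subtype.val hxy)]
  exact IsLocalization.isDedekindDomain R
    (powers_le_nonZeroDivisors_of_noZeroDivisors hp) (S.integer K)

end SIntegers

section Arithmetic

open IsDedekindDomain NumberField

/-- The elements with bounded powers of `p` in the denominator filter a group of symplectic
matrices in which exactly the powers of `p` occur as denominators. -/
theorem groupFiltration_hasDenom {g : ℕ} {A K Γ : Type} [CommRing A] [IsDedekindDomain A]
    [Field K] [Algebra A K] [IsFractionRing A K] [Group Γ] {ι : Γ →* Sp g K} {p : A} (hp : p ≠ 0)
    (hι : ∀ c : Sp g K, c ∈ ι.range ↔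
      ∃ j, HasDenom (algebraMap A K).range (algebraMap A K p ^ j) c.1) :
    GroupFiltration fun j : ℕ =>
      {γ : Γ | HasDenom (algebraMap A K).range (algebraMap A K p ^ j) (ι γ).1} where
  one_mem := by
    rw [Set.mem_ofPred_eq, map_one, pow_zero]
    exact hasDenom_one
  inv_mem := by
    intro i a ha
    rw [Set.mem_ofPred_eq, map_inv]
    exact HasDenom.inv ha
  mul_mem := by
    intro i j a ha b hb
    rw [Set.mem_ofPred_eq, map_mul, pow_add]
    exact HasDenom.mul ha hb
  mono := by
    intro i j hij a ha
    refine HasDenom.of_dvd ha ⟨algebraMap A K p ^ (j - i), pow_mem (RingHom.mem_range_self _ p) _, ?_⟩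
    rw [← pow_add, Nat.sub_add_cancel hij]
  exhaust := fun a => (hι (ι a)).1 ⟨a, rfl⟩
  reduce := by
    intro k
    obtain ⟨F, h1, h2⟩ := exists_denominator_reduction (g := g) (K := K) hp (k + 1)
    have H : ∀ a : Γ, ∃ b : Γ, HasDenom (algebraMap A K).range (algebraMap A K p ^ (k + 2)) (ι a).1 →
        ι b = F (ι a) := by
      intro a
      by_cases ha : HasDenom (algebraMap A K).range (algebraMap A K p ^ (k + 2)) (ι a).1
      · obtain ⟨b, hb⟩ := (hι (F (ι a))).2 ⟨_, (h1 _ ha).1⟩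
        exact ⟨b, fun _ => hb⟩
      · exact ⟨1, fun h => absurd h ha⟩
    choose c hc using H
    refine ⟨c, fun a ha => ⟨?_, ?_⟩, fun a ha b hb hab => ?_⟩
    · rw [Set.mem_ofPred_eq, hc a ha]
      exact (h1 _ ha).1
    · rw [Set.mem_ofPred_eq, map_mul, map_inv, hc a ha, pow_one]
      exact (h1 _ ha).2
    · rw [Set.mem_ofPred_eq, map_mul, map_inv, pow_one] at hab
      rw [Set.mem_ofPred_eq, map_mul, map_inv, hc a ha, hc b hb, pow_one]
      exact h2 _ _ ha hb hab

variable {g : ℕ} {K : Type} [Field K]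

theorem intRing_eq_range : intRing K = (algebraMap (𝓞 K) K).range := by
  ext x
  exact ⟨fun h => ⟨⟨x, h⟩, rfl⟩, by
    rintro ⟨y, rfl⟩
    exact y.2⟩

/-- The symplectic matrices with denominator `m` fall into finitely many cosets of the integral
ones. -/
theorem exists_finite_cosets [NumberField K] (g : ℕ) {m : ℕ} (hm : m ≠ 0) :
    ∃ B : Set (Sp g K), B.Finite ∧ (∀ b ∈ B, HasDenom (intRing K) m b.1) ∧
      ∀ c : Sp g K, HasDenom (intRing K) m c.1 →
        ∃ b ∈ B, HasDenom (intRing K) 1 (c * b⁻¹).1 := by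
  have hmK : (m : K) ≠ 0 := Nat.cast_ne_zero.2 hm
  let I : Ideal (𝓞 K) := Ideal.span {(m : 𝓞 K) ^ 2}
  have hI : I ≠ ⊥ := by
    rw [Ne, Ideal.span_singleton_eq_bot]
    exact pow_ne_zero _ (Nat.cast_ne_zero.2 hm)
  have : Finite (𝓞 K ⧸ I) := Ideal.finiteQuotientOfFreeOfNeBot I hI
  let D := {c : Sp g K // HasDenom (intRing K) m c.1}
  have : Nonempty D := ⟨1, fun i j => by
    rw [OneMemClass.coe_one]
    have := mul_mem (natCast_mem_intRing (K := K) m) (hasDenom_one (O := intRing K) i j)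
    rwa [one_mul] at this⟩
  let f : D → (Fin g ⊕ Fin g) → (Fin g ⊕ Fin g) → 𝓞 K ⧸ I :=
    fun c i j => Ideal.Quotient.mk I ⟨m * c.1.1 i j, c.2 i j⟩
  refine ⟨Set.range fun y => (Function.invFun f y).1, Set.finite_range _, ?_, fun c hc => ?_⟩
  · rintro _ ⟨y, rfl⟩
    exact (Function.invFun f y).2
  · refine ⟨(Function.invFun f (f ⟨c, hc⟩)).1, ⟨_, rfl⟩, ?_⟩
    have hb := Function.invFun_eq (f := f) ⟨⟨c, hc⟩, rfl⟩
    generalize Function.invFun f (f ⟨c, hc⟩) = b at hb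
    have h1 : HasDenom (intRing K) (m : K)⁻¹ (c.1 - b.1.1) := by
      intro i j
      obtain ⟨t, ht⟩ := Ideal.mem_span_singleton.1
        (Ideal.Quotient.eq.1 (congrFun (congrFun hb.symm i) j))
      have h3 : (m : K) * c.1 i j - m * b.1.1 i j = m ^ 2 * t := congrArg (algebraMap (𝓞 K) K) ht
      have h4 : (m : K)⁻¹ * (c.1 - b.1.1) i j = t := by
        rw [Matrix.sub_apply]
        refine mul_left_cancel₀ (pow_ne_zero 2 hmK) ?_
        rw [← h3]
        field_simp
      rw [h4]
      exact t.2
    have h2 := h1.mul (HasDenom.inv b.2)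
    rw [inv_mul_cancel₀ hmK] at h2
    have h3 : (c * b.1⁻¹).1 = (c.1 - b.1.1) * (b.1⁻¹).1 + 1 := by
      have h4 : b.1.1 * (b.1⁻¹).1 = 1 := congrArg Subtype.val (mul_inv_cancel b.1)
      rw [Matrix.sub_mul, h4, sub_add_cancel]
      rfl
    rw [h3]
    intro i j
    rw [Matrix.add_apply, mul_add]
    exact add_mem (h2 i j) (hasDenom_one i j)

/-- Groups of symplectic matrices over a number field in which exactly the powers of a fixed
integer occur as denominators have finitely generated second homology. -/
theorem H2_finite_of_hasDenom [NumberField K] {Γ : Type} [Group Γ] {ι : Γ →* Sp g K}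
    (hinj : Function.Injective ι) {p : 𝓞 K} (hp : p ≠ 0)
    (hι : ∀ c : Sp g K, c ∈ ι.range ↔
      ∃ j, HasDenom (algebraMap (𝓞 K) K).range (algebraMap (𝓞 K) K p ^ j) c.1) :
    Module.Finite ℤ (GpH2.H2 Γ) := by
  obtain ⟨C, m, hm, hcov⟩ := exists_cover (K := K) g
  obtain ⟨B, hB, hBm, hBc⟩ := exists_finite_cosets (K := K) g hm
  have hE := groupFiltration_hasDenom hp hι
  letI : MulAction Γ (SymSpace g K) := MulAction.compHom _ ι
  have hsm : ∀ (γ : Γ) (x : SymSpace g K), γ • x = ι γ • x := fun _ _ => rfl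
  have : ContinuousConstSMul Γ (SymSpace g K) :=
    ⟨fun γ => continuous_const_smul (ι γ)⟩
  have := contractibleSpace_siegelSpace (realPlaces K) g
  obtain ⟨x₀⟩ : Nonempty (SymSpace g K) := inferInstance
  choose Cb hCb using fun b : Sp g K => exists_mem_siegelDom (b⁻¹ • x₀)
  obtain ⟨C₁, hC₁⟩ := (hB.image Cb).bddAbove
  set C' := max C C₁ with hC'
  set U : Set (SymSpace g K) :=
    ⋃ b : B, {x | b.1⁻¹ • x ∈ siegelDom (realPlaces K) C' g} with hU
  have hx₀ : ∀ b : B, b.1⁻¹ • x₀ ∈ siegelDom (realPlaces K) C' g := fun b =>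
    siegelDom_mono ((hC₁ ⟨b.1, b.2, rfl⟩).trans (le_max_right _ _)) g (hCb b.1)
  have hUo : IsOpen U := isOpen_iUnion fun b => isOpen_translate (isOpen_siegelDom C' g) _
  have hUp : IsPreconnected U := isPreconnected_iUnion ⟨x₀, Set.mem_iInter.2 hx₀⟩ fun b =>
    isPreconnected_translate (isPreconnected_siegelDom C' g) _
  have hcov' : ∀ x, ∃ α ∈ {γ : Γ | HasDenom (algebraMap (𝓞 K) K).range
      (algebraMap (𝓞 K) K p ^ 0) (ι γ).1}, α⁻¹ • x ∈ U := by
    intro x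
    obtain ⟨c, hc, hx⟩ := hcov x
    obtain ⟨b, hb, hcb⟩ := hBc c⁻¹ hc.inv
    rw [intRing_eq_range] at hcb
    obtain ⟨α, hα⟩ := (hι (c⁻¹ * b⁻¹)).2 ⟨0, by rwa [pow_zero]⟩
    refine ⟨α, ?_, Set.mem_iUnion.2 ⟨⟨b, hb⟩, ?_⟩⟩
    · rw [Set.mem_ofPred_eq, hα, pow_zero]
      exact hcb
    · rw [Set.mem_ofPred_eq, hsm, map_inv, hα, smul_smul, _root_.mul_inv_rev, inv_inv, inv_inv,
        inv_mul_cancel_left]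
      exact siegelDom_mono (le_max_left _ _) g hx
  have hUne : U.Nonempty := by
    obtain ⟨α, -, hα⟩ := hcov' x₀
    exact ⟨_, hα⟩
  obtain ⟨h1, h2⟩ := hE.local_presentation hUo hUp hUne hcov'
  refine H2_finite_of_local_presentation _ ?_ h1 h2
  obtain ⟨N, hN, t, ht⟩ : ∃ N : ℕ, N ≠ 0 ∧ ∃ t : 𝓞 K, (N : 𝓞 K) = t * p := by
    refine ⟨Ideal.absNorm (Ideal.span {p}), ?_, ?_⟩
    · rw [Ne, Ideal.absNorm_eq_zero_iff, Ideal.span_singleton_eq_bot]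
      exact hp
    · obtain ⟨t, ht⟩ := Ideal.mem_span_singleton'.1 (Ideal.absNorm_mem (Ideal.span {p}))
      exact ⟨t, ht.symm⟩
  have hNK : (N : K) = algebraMap (𝓞 K) K t * algebraMap (𝓞 K) K p := by
    rw [← map_mul, ← ht, map_natCast]
  have hfin := finite_siegelDom_near (K := K) C' g (m * N ^ 2 * m)
    (mul_ne_zero (mul_ne_zero hm (pow_ne_zero _ hN)) hm)
  refine Set.Finite.of_finite_image (f := ι) (((hB.prod (hfin.prod hB)).image
    fun y => y.1 * y.2.1 * y.2.2⁻¹).subset ?_) hinj.injOn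
  rintro _ ⟨γ, ⟨hγ, x, hxU, hγx⟩, rfl⟩
  obtain ⟨⟨b, hb⟩, hxb⟩ := Set.mem_iUnion.1 hxU
  obtain ⟨⟨b', hb'⟩, hxb'⟩ := Set.mem_iUnion.1 hγx
  refine ⟨(b, b⁻¹ * ι γ * b', b'), ⟨hb, ⟨?_, b'⁻¹ • (γ⁻¹ • x), hxb', ?_⟩, hb'⟩, ?_⟩
  · have h3 : HasDenom (intRing K) ((N : K) ^ 2) (ι γ).1 := by
      rw [intRing_eq_range]
      exact HasDenom.of_dvd hγ ⟨algebraMap (𝓞 K) K t ^ 2, pow_mem (RingHom.mem_range_self _ t) _, by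
        rw [hNK, mul_pow]⟩
    have h4 := ((hBm b hb).inv.mul h3).mul (hBm b' hb')
    push_cast
    exact h4
  · have h3 : b⁻¹ * ι γ * b' * b'⁻¹ * (ι γ)⁻¹ = b⁻¹ := by group
    rw [hsm, map_inv, smul_smul, smul_smul]
    change (b⁻¹ * ι γ * b' * b'⁻¹ * (ι γ)⁻¹) • x ∈ _
    rw [h3]
    exact hxb
  · simp only
    group

/-- The second homology of symplectic groups over rings of `S`-integers is finitely generated. -/
theorem H2_integer_finite [NumberField K] {S : Set (HeightOneSpectrum (𝓞 K))} (hS : S.Finite)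
    (g : ℕ) : Module.Finite ℤ (GpH2.H2 (Sp g (S.integer K))) := by
  obtain ⟨p, hp, h⟩ := exists_mem_asIdeal_iff hS
  refine H2_finite_of_hasDenom (ι := SpAux.SpMap (algebraMap (S.integer K) K) g) ?_ hp ?_
  · intro a b hab
    refine Subtype.ext (Matrix.ext fun i j => Subtype.ext ?_)
    exact congrFun (congrFun (congrArg Subtype.val hab) i) j
  · have hpK : algebraMap (𝓞 K) K p ≠ 0 :=
      (map_ne_zero_iff _ (IsFractionRing.injective (𝓞 K) K)).2 hp
    intro c
    constructor
    · rintro ⟨a, rfl⟩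
      choose j hj using fun y : (Fin g ⊕ Fin g) × (Fin g ⊕ Fin g) =>
        exists_pow_mul_mem_of_mem_integer hS h (a.1 y.1 y.2).2
      refine ⟨∑ y, j y, fun i k => ?_⟩
      have h1 : j (i, k) ≤ ∑ y, j y :=
        Finset.single_le_sum (f := j) (fun _ _ => Nat.zero_le _) (Finset.mem_univ (i, k))
      rw [← Nat.sub_add_cancel h1, pow_add, mul_assoc]
      exact mul_mem (pow_mem (RingHom.mem_range_self _ p) _) (hj (i, k))
    · rintro ⟨j, hj⟩
      refine exists_Sp_of_map fun i k => ?_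
      obtain ⟨y, hy⟩ := hj i k
      have h1 : c.1 i k = ((algebraMap (𝓞 K) K p)⁻¹) ^ j * algebraMap (𝓞 K) K y := by
        rw [hy, inv_pow, inv_mul_cancel_left₀ (pow_ne_zero _ hpK)]
      refine ⟨⟨c.1 i k, ?_⟩, rfl⟩
      rw [h1]
      exact mul_mem (pow_mem (inv_mem_integer h) _) ((S.integer K).algebraMap_mem y)

end Arithmetic

open GpH2 SpAux IsDedekindDomain NumberField in
/-- **Theorem (Statement 6).** Let `K` be a number field, `S` a finite set of places
containing all archimedean ones (encoded by its finite set of finite places), and `𝔄` the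
ring of `S`-integers. There is a constant `C`, depending only on `𝔄`, such that for every
`g ≥ 2` the torsion subgroup of `H₂(Sp(2g, 𝔄))` is finite of order at most `C`. -/
theorem H2_S_integers_torsion_bounded (K : Type) [Field K] [NumberField K]
    (S : Set (HeightOneSpectrum (𝓞 K))) (hS : S.Finite) :
    ∃ C : ℕ, ∀ g : ℕ, 2 ≤ g →
      Finite ↥(Submodule.torsion ℤ (H2 ↥(Sp g ↥(S.integer K)))) ∧
      Nat.card ↥(Submodule.torsion ℤ (H2 ↥(Sp g ↥(S.integer K)))) ≤ C := by
  have := isDedekindDomain_integer (K := K) hS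
  have hfin := H2_integer_finite hS
  obtain ⟨C, hC⟩ := exists_torsion_bound (fun g => H2 ↥(Sp g ↥(S.integer K)))
    (fun g => H2Map (stabHom g (S.integer K))) 12 fun g hg => H2Map_stabHom_surjective hg
  exact ⟨C, fun g _ => ⟨finite_torsion _, hC g⟩⟩
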